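/- arXiv:1301.4887 — 18 statements merged into one kernel-verified Lean document; each statement's English description precedes it below -/
import Mathlib

section
/- For every natural number n, all complex parameters α₁, β₁, α₂, β₂ and every complex x, one has Σ_{k=0}^{n} P_{n-k}^{(α₁+k, β₁+k)}(x) · P_k^{(α₂-k, β₂-k)}(x) = P_n^{(α₁+α₂, β₁+β₂)}(x). -/
/-- The Jacobi polynomial `P_n^{(α,β)}(x)` for arbitrary complex parameters,
defined by `P_n^{(α,β)}(x) = ∑_{k=0}^n ((n+α+β+1)_k (α+k+1)_{n-k})/(k! (n-k)!) ((x-1)/2)^k`. -/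
noncomputable def jacobiP (n : ℕ) (α β x : ℂ) : ℂ :=
  ∑ k ∈ Finset.range (n + 1),
    ((ascPochhammer ℂ k).eval ((n : ℂ) + α + β + 1) *
        (ascPochhammer ℂ (n - k)).eval (α + (k : ℂ) + 1)) /
      ((k.factorial : ℂ) * ((n - k).factorial : ℂ)) * ((x - 1) / 2) ^ k

lemma asc_div (r : ℂ) (k : ℕ) (s : ℂ) (h : s = r - k + 1) :
    (ascPochhammer ℂ k).eval s = (k.factorial : ℂ) * Ring.choose r k := by
  have h2 := Ring.factorial_nsmul_multichoose_eq_ascPochhammer s k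
  rw [Polynomial.ascPochhammer_smeval_eq_eval, Ring.multichoose_eq] at h2
  rw [← h2, nsmul_eq_mul, h]
  congr 2
  ring

lemma jacobi_aux (n : ℕ) (a b x : ℂ) :
    jacobiP n (a - n) (b - n) x = ∑ p ∈ Finset.HasAntidiagonal.antidiagonal n,
      Ring.choose a p.1 * (Ring.choose (a - p.1 + b) p.2 * ((x - 1) / 2) ^ p.2) := by
  rw [← Finset.Nat.sum_antidiagonal_swap, Finset.Nat.sum_antidiagonal_eq_sum_range_succ_mk]
  unfold jacobiP
  refine Finset.sum_congr rfl fun k hk => ?_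
  have hk' : k ≤ n := by simpa [Nat.lt_succ_iff] using hk
  simp only [Prod.fst_swap, Prod.snd_swap]
  rw [asc_div (a - (n - k : ℕ) + b) k _ (by push_cast [hk']; ring),
    asc_div a (n - k) _ (by push_cast [hk']; ring)]
  have h1 : (k.factorial : ℂ) ≠ 0 := by exact_mod_cast k.factorial_ne_zero
  have h2 : ((n - k).factorial : ℂ) ≠ 0 := by exact_mod_cast (n - k).factorial_ne_zero
  field_simp

lemma jacobi_gen (n : ℕ) (a b x : ℂ) :
    jacobiP n (a - n) (b - n) x = PowerSeries.coeff n
      (PowerSeries.rescale ((x - 1) / 2 + 1) (PowerSeries.binomialSeries ℂ a) *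
        PowerSeries.rescale ((x - 1) / 2) (PowerSeries.binomialSeries ℂ b)) := by
  rw [jacobi_aux, PowerSeries.coeff_mul]
  generalize (x - 1) / 2 = u
  simp only [PowerSeries.coeff_rescale, PowerSeries.binomialSeries_coeff, smul_eq_mul, mul_one]
  have hL : ∀ p ∈ Finset.HasAntidiagonal.antidiagonal n,
      Ring.choose a p.1 * (Ring.choose (a - p.1 + b) p.2 * u ^ p.2) =
      ∑ q ∈ Finset.HasAntidiagonal.antidiagonal p.2, Ring.choose a p.1 *
        (Ring.choose (a - p.1) q.1 * Ring.choose b q.2 * u ^ (q.1 + q.2)) := by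
    intro p _
    rw [Ring.add_choose_eq _ (Commute.all _ _), Finset.sum_mul, Finset.mul_sum]
    refine Finset.sum_congr rfl fun q hq => ?_
    rw [Finset.HasAntidiagonal.mem_antidiagonal.1 hq]
  have hR : ∀ p ∈ Finset.HasAntidiagonal.antidiagonal n,
      (u + 1) ^ p.1 * Ring.choose a p.1 * (u ^ p.2 * Ring.choose b p.2) =
      ∑ q ∈ Finset.HasAntidiagonal.antidiagonal p.1, Ring.choose a q.1 *
        (Ring.choose (a - q.1) q.2 * Ring.choose b p.2 * u ^ (q.2 + p.2)) := by
    intro p _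
    rw [add_comm u 1, (Commute.all (1 : ℂ) u).add_pow', Finset.sum_mul, Finset.sum_mul]
    refine Finset.sum_congr rfl fun q hq => ?_
    have hq := Finset.HasAntidiagonal.mem_antidiagonal.1 hq
    have h := Ring.choose_smul_choose a (n := p.1) (k := q.1) (by omega)
    rw [show p.1 - q.1 = q.2 by omega, nsmul_eq_mul] at h
    rw [nsmul_eq_mul, one_pow, pow_add]
    linear_combination (Ring.choose b p.2 * (u ^ q.2 * u ^ p.2)) * h
  rw [Finset.sum_congr rfl hL, Finset.sum_congr rfl hR, Finset.sum_sigma', Finset.sum_sigma']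
  refine Finset.sum_nbij' (fun s => ⟨(s.1.1 + s.2.1, s.2.2), (s.1.1, s.2.1)⟩)
    (fun s => ⟨(s.2.1, s.2.2 + s.1.2), (s.2.2, s.1.2)⟩) ?_ ?_ ?_ ?_ ?_
  · rintro ⟨⟨i, j⟩, ⟨k, l⟩⟩ h
    simp at h ⊢; omega
  · rintro ⟨⟨i, j⟩, ⟨k, l⟩⟩ h
    simp at h ⊢; omega
  · rintro ⟨⟨i, j⟩, ⟨k, l⟩⟩ h
    simp at h ⊢; simp [h]
  · rintro ⟨⟨i, j⟩, ⟨k, l⟩⟩ h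
    simp at h ⊢; simp [h]
  · rintro ⟨⟨i, j⟩, ⟨k, l⟩⟩ h
    rfl

theorem stmt0 (n : ℕ) (α₁ β₁ α₂ β₂ x : ℂ) :
    ∑ k ∈ Finset.range (n + 1),
        jacobiP (n - k) (α₁ + (k : ℂ)) (β₁ + (k : ℂ)) x *
          jacobiP k (α₂ - (k : ℂ)) (β₂ - (k : ℂ)) x
      = jacobiP n (α₁ + α₂) (β₁ + β₂) x := by
  have e : jacobiP n (α₁ + α₂) (β₁ + β₂) x =
      jacobiP n ((α₁ + n) + α₂ - n) ((β₁ + n) + β₂ - n) x := by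
    congr 1 <;> ring
  rw [e, jacobi_gen, PowerSeries.binomialSeries_add (α₁ + n) α₂,
    PowerSeries.binomialSeries_add (β₁ + n) β₂,
    map_mul (PowerSeries.rescale ((x - 1) / 2 + 1)), map_mul (PowerSeries.rescale ((x - 1) / 2)),
    mul_mul_mul_comm, mul_comm (_ * _) (_ * _), PowerSeries.coeff_mul,
    Finset.Nat.sum_antidiagonal_eq_sum_range_succ_mk]
  refine Finset.sum_congr rfl fun k hk => ?_
  have hk' : k ≤ n := by simpa [Nat.lt_succ_iff] using hk
  simp only
  rw [← jacobi_gen, ← jacobi_gen, mul_comm]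
  congr 2 <;> push_cast [hk'] <;> ring
end

section
/- For every natural number n ≥ 1, all complex parameters α₁, β₁, α₂, β₂ and every complex x, one has (α₁+α₂+β₁+β₂+2n) · Σ_{k=0}^{n} k · P_{n-k}^{(α₁+k, β₁+k)}(x) · P_k^{(α₂-k, β₂-k)}(x) = n(α₂+β₂) · P_n^{(α₁+α₂, β₁+β₂)}(x) + (α₂β₁ - α₁β₂ + n(α₂-β₂)) · P_{n-1}^{(α₁+α₂, β₁+β₂)}(x). -/
open PowerSeries in
/-- the formal power series `(1 + v t)^a` -/
noncomputable def jB (v a : ℂ) : PowerSeries ℂ := rescale v (binomialSeries ℂ a)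

lemma jB_coeff (v a : ℂ) (n : ℕ) :
    PowerSeries.coeff n (jB v a) = v ^ n * Ring.choose a n := by
  simp [jB, PowerSeries.coeff_rescale]

lemma jB_add (v a b : ℂ) : jB v (a + b) = jB v a * jB v b := by
  simp [jB, PowerSeries.binomialSeries_add]

lemma jB_one (v : ℂ) : jB v 1 = 1 + PowerSeries.C v * PowerSeries.X := by
  have h := PowerSeries.binomialSeries_nat (R := ℂ) (A := ℂ) 1
  rw [Nat.cast_one, pow_one] at h
  rw [jB, h, map_add, map_one, PowerSeries.rescale_X]

lemma jB_deriv (v a : ℂ) :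
    PowerSeries.derivative ℂ (jB v a) = PowerSeries.C (a * v) * jB v (a - 1) := by
  ext n
  rw [PowerSeries.coeff_derivative, PowerSeries.coeff_C_mul, jB_coeff, jB_coeff]
  have h := Ring.choose_smul_choose a (n := n + 1) (k := 1) (by omega)
  simp only [Nat.choose_one_right, nsmul_eq_mul, Nat.cast_add, Nat.cast_one,
    Ring.choose_one_right, Nat.add_sub_cancel] at h
  linear_combination v ^ (n + 1) * h

lemma jchoose_poch (r : ℂ) (n : ℕ) :
    (ascPochhammer ℂ n).eval (r - n + 1) / (n.factorial : ℂ) = Ring.choose r n := by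
  have h := Ring.factorial_nsmul_multichoose_eq_ascPochhammer (r - n + 1) n
  rw [Polynomial.ascPochhammer_smeval_eq_eval, nsmul_eq_mul] at h
  rw [Ring.choose, ← h]
  have : (n.factorial : ℂ) ≠ 0 := by exact_mod_cast n.factorial_ne_zero
  field_simp

lemma jacobiP_eq (n : ℕ) (a b x : ℂ) :
    jacobiP n (a - n) (b - n) x =
      PowerSeries.coeff n (jB ((x - 1) / 2 + 1) a * jB ((x - 1) / 2) b) := by
  set u := (x - 1) / 2 with hu
  have h1 : jacobiP n (a - n) (b - n) x = ∑ k ∈ Finset.range (n + 1),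
      Ring.choose (a - (n - k : ℕ) + b) k * Ring.choose a (n - k) * u ^ k := by
    unfold jacobiP
    refine Finset.sum_congr rfl fun k hk => ?_
    have hk' : k ≤ n := by simpa [Nat.lt_succ_iff] using hk
    rw [← jchoose_poch, ← jchoose_poch, mul_div_mul_comm]
    push_cast [hk']
    congr 4 <;> ring_nf
  have h2 : ∀ k ∈ Finset.range (n + 1),
      Ring.choose (a - (n - k : ℕ) + b) k * Ring.choose a (n - k) * u ^ k =
      ∑ s ∈ Finset.range (n + 1), (if s ≤ k then
        Ring.choose a (n - s) * Ring.choose b s * ((n - s).choose (k - s) : ℂ) * u ^ k else 0) := by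
    intro k hk
    have hk' : k ≤ n := by simpa [Nat.lt_succ_iff] using hk
    rw [add_comm, Ring.add_choose_eq k (Commute.all _ _), Finset.Nat.sum_antidiagonal_eq_sum_range_succ
      (fun i j => Ring.choose b i * Ring.choose (a - (n - k : ℕ)) j), Finset.sum_mul, Finset.sum_mul]
    rw [← Finset.sum_filter]
    refine Finset.sum_congr ?_ fun s hs => ?_
    · ext s; simp; omega
    · have hs' : s ≤ k := by
        simp at hs; omega
      have h := Ring.choose_smul_choose a (n := n - s) (k := n - k) (by omega)
      rw [show n - s - (n - k) = k - s by omega, nsmul_eq_mul,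
        ← Nat.choose_symm (by omega : n - k ≤ n - s),
        show n - s - (n - k) = k - s by omega] at h
      linear_combination (- Ring.choose b s * u ^ k) * h
  rw [h1, Finset.sum_congr rfl h2, Finset.sum_comm, mul_comm, PowerSeries.coeff_mul,
    Finset.Nat.sum_antidiagonal_eq_sum_range_succ
      (fun i j => PowerSeries.coeff i (jB u b) * PowerSeries.coeff j (jB (u + 1) a))]
  refine Finset.sum_congr rfl fun s hs => ?_
  have hs' : s ≤ n := by simpa [Nat.lt_succ_iff] using hs
  rw [jB_coeff, jB_coeff, add_pow, ← Finset.sum_filter]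
  have h3 : (Finset.range (n + 1)).filter (fun k => s ≤ k) =
      (Finset.range (n - s + 1)).image (fun j => j + s) := by
    ext k; simp
    constructor
    · intro h; exact ⟨k - s, by omega, by omega⟩
    · rintro ⟨j, hj, rfl⟩; omega
  rw [h3, Finset.sum_image (fun _ _ _ _ h => by simpa using h), Finset.sum_mul, Finset.mul_sum]
  refine Finset.sum_congr rfl fun j hj => ?_
  simp only [Nat.add_sub_cancel, one_pow, pow_add]
  ring

lemma jcore (m : ℕ) (α₁ β₁ α₂ β₂ u v : ℂ) (huv : v = u + 1) (A B N : ℂ)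
    (hA : A = α₁ + α₂) (hB : B = β₁ + β₂) (hN : N = m + 1) (F1 F2 F G : PowerSeries ℂ)
    (hF1 : F1 = jB v (α₁ + N) * jB u (β₁ + N)) (hF2 : F2 = jB v α₂ * jB u β₂)
    (hF : F = jB v (A + N) * jB u (B + N)) (hG : G = jB v (A + N - 1) * jB u (B + N - 1)) :
    (α₁ + α₂ + β₁ + β₂ + 2 * N) * PowerSeries.coeff m (F1 * PowerSeries.derivative ℂ F2) =
      (α₂ + β₂) * (N * PowerSeries.coeff (m + 1) F) +
      (α₂ * β₁ - α₁ * β₂ + N * (α₂ - β₂)) * PowerSeries.coeff m G := by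
  have e : ∀ w c : ℂ, jB w c = jB w (c - 1) * (1 + PowerSeries.C w * PowerSeries.X) := by
    intro w c
    rw [← jB_one, ← jB_add, sub_add_cancel]
  have lin : ∀ p q : ℂ, PowerSeries.coeff m
      ((PowerSeries.C (p * v) * (1 + PowerSeries.C u * PowerSeries.X) +
        PowerSeries.C (q * u) * (1 + PowerSeries.C v * PowerSeries.X)) * G) =
      (p * v + q * u) * PowerSeries.coeff m G +
        (p + q) * u * v * PowerSeries.coeff m (PowerSeries.X * G) := by
    intro p q
    have : (PowerSeries.C (p * v) * (1 + PowerSeries.C u * PowerSeries.X) +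
        PowerSeries.C (q * u) * (1 + PowerSeries.C v * PowerSeries.X)) * G =
        PowerSeries.C (p * v + q * u) * G +
        PowerSeries.C ((p + q) * u * v) * (PowerSeries.X * G) := by
      simp only [map_add, map_mul]; ring
    rw [this, map_add, PowerSeries.coeff_C_mul, PowerSeries.coeff_C_mul]
  have d : ∀ a b : ℂ, PowerSeries.derivative ℂ (jB v a * jB u b) =
      (PowerSeries.C (a * v) * (1 + PowerSeries.C u * PowerSeries.X) +
        PowerSeries.C (b * u) * (1 + PowerSeries.C v * PowerSeries.X)) *
        (jB v (a - 1) * jB u (b - 1)) := by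
    intro a b
    rw [Derivation.leibniz, jB_deriv, jB_deriv, e v a, e u b]
    simp only [smul_eq_mul]; ring
  have c1 : F1 * PowerSeries.derivative ℂ F2 =
      (PowerSeries.C (α₂ * v) * (1 + PowerSeries.C u * PowerSeries.X) +
        PowerSeries.C (β₂ * u) * (1 + PowerSeries.C v * PowerSeries.X)) * G := by
    rw [hF1, hF2, d, hG, hA, hB, show α₁ + α₂ + N - 1 = (α₁ + N) + (α₂ - 1) by ring,
      show β₁ + β₂ + N - 1 = (β₁ + N) + (β₂ - 1) by ring,
      jB_add v (α₁ + N) (α₂ - 1), jB_add u (β₁ + N) (β₂ - 1)]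
    ring
  have c2 : N * PowerSeries.coeff (m + 1) F =
      ((A + N) * v + (B + N) * u) * PowerSeries.coeff m G +
        ((A + N) + (B + N)) * u * v * PowerSeries.coeff m (PowerSeries.X * G) := by
    rw [← lin, hG, ← d, ← hF, PowerSeries.coeff_derivative, hN, mul_comm]
  rw [c1, lin, c2]
  subst huv hA hB
  ring

theorem stmt1 (n : ℕ) (hn : 1 ≤ n) (α₁ β₁ α₂ β₂ x : ℂ) :
    (α₁ + α₂ + β₁ + β₂ + 2 * (n : ℂ)) *
        ∑ k ∈ Finset.range (n + 1),
          (k : ℂ) * (jacobiP (n - k) (α₁ + (k : ℂ)) (β₁ + (k : ℂ)) x *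
            jacobiP k (α₂ - (k : ℂ)) (β₂ - (k : ℂ)) x)
      = (n : ℂ) * (α₂ + β₂) * jacobiP n (α₁ + α₂) (β₁ + β₂) x +
        (α₂ * β₁ - α₁ * β₂ + (n : ℂ) * (α₂ - β₂)) *
          jacobiP (n - 1) (α₁ + α₂) (β₁ + β₂) x := by
  obtain ⟨m, rfl⟩ : ∃ m, n = m + 1 := ⟨n - 1, by omega⟩
  have key := jcore m α₁ β₁ α₂ β₂ ((x - 1) / 2) ((x - 1) / 2 + 1) rfl _ _ ((m + 1 : ℕ) : ℂ)
    rfl rfl (by push_cast; rfl) _ _ _ _ rfl rfl rfl rfl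
  rw [← jacobiP_eq, add_sub_cancel_right, add_sub_cancel_right] at key
  have hG : PowerSeries.coeff m (jB ((x - 1) / 2 + 1) (α₁ + α₂ + ((m + 1 : ℕ) : ℂ) - 1) *
      jB ((x - 1) / 2) (β₁ + β₂ + ((m + 1 : ℕ) : ℂ) - 1)) =
      jacobiP m (α₁ + α₂) (β₁ + β₂) x := by
    rw [← jacobiP_eq]
    congr 1 <;> push_cast <;> ring
  rw [hG] at key
  have hS : ∑ k ∈ Finset.range (m + 1 + 1),
          (k : ℂ) * (jacobiP (m + 1 - k) (α₁ + (k : ℂ)) (β₁ + (k : ℂ)) x *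
            jacobiP k (α₂ - (k : ℂ)) (β₂ - (k : ℂ)) x) =
      PowerSeries.coeff m (jB ((x - 1) / 2 + 1) (α₁ + ((m + 1 : ℕ) : ℂ)) *
        jB ((x - 1) / 2) (β₁ + ((m + 1 : ℕ) : ℂ)) *
        PowerSeries.derivative ℂ (jB ((x - 1) / 2 + 1) α₂ * jB ((x - 1) / 2) β₂)) := by
    rw [mul_comm, PowerSeries.coeff_mul, Finset.Nat.sum_antidiagonal_eq_sum_range_succ_mk,
      Finset.sum_range_succ']
    simp only [Nat.cast_zero, zero_mul, add_zero]
    refine Finset.sum_congr rfl fun k hk => ?_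
    have hk' : k ≤ m := by simpa [Nat.lt_succ_iff] using hk
    rw [PowerSeries.coeff_derivative, ← jacobiP_eq, ← jacobiP_eq,
      show m + 1 - (k + 1) = m - k by omega]
    have e : ∀ c : ℂ, c + ((m + 1 : ℕ) : ℂ) - ((m - k : ℕ) : ℂ) = c + ((k + 1 : ℕ) : ℂ) := by
      intro c; push_cast [hk']; ring
    rw [e, e]
    push_cast
    ring
  rw [hS, key, Nat.add_sub_cancel]
  ring
end

section
/- For every natural number n, all complex α, β and every complex x, one has Σ_{k=0}^{n} P_{n-k}^{(α+k, β+k)}(x) · ((k+β) · P_k^{(-α-k, -β-k)}(x) + (α-β) · P_k^{(-α-k, -β-k-1)}(x)) = α · δ_{n,0}, where δ_{n,0} equals 1 if n = 0 and 0 otherwise. -/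
open PowerSeries in
noncomputable def bser (c r : ℂ) : PowerSeries ℂ := rescale c (binomialSeries ℂ r)

lemma bser_coeff (c r : ℂ) (k : ℕ) :
    PowerSeries.coeff k (bser c r) = c ^ k * Ring.choose r k := by
  simp [bser, PowerSeries.coeff_rescale]

lemma bser_add (c r s : ℂ) : bser c (r + s) = bser c r * bser c s := by
  simp [bser]

lemma bser_nat (c : ℂ) (d : ℕ) :
    bser c d = (1 + PowerSeries.C c * PowerSeries.X) ^ d := by
  simp [bser, PowerSeries.rescale_X]

lemma bser_deriv (c r : ℂ) :
    PowerSeries.derivative ℂ (bser c r) = PowerSeries.C (r * c) * bser c (r - 1) := by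
  ext k
  rw [PowerSeries.coeff_derivative, PowerSeries.coeff_C_mul, bser_coeff, bser_coeff]
  have h := Ring.choose_smul_choose r (n := k + 1) (k := 1) (by omega)
  rw [Ring.choose_one_right, nsmul_eq_mul] at h
  simp only [Nat.choose_one_right, Nat.cast_add, Nat.cast_one, Nat.add_sub_cancel] at h
  linear_combination c ^ (k + 1) * h

lemma asc_eq (r : ℂ) (k : ℕ) :
    (ascPochhammer ℂ k).eval (r - k + 1) = k.factorial * Ring.choose r k := by
  rw [Ring.choose, ← nsmul_eq_mul, Ring.factorial_nsmul_multichoose_eq_ascPochhammer,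
    Polynomial.ascPochhammer_smeval_eq_eval]

lemma jac_eq1 (n : ℕ) (a b x : ℂ) :
    jacobiP n a b x = ∑ p ∈ Finset.HasAntidiagonal.antidiagonal n, Ring.choose (n + a) p.1 *
      ((x - 1) / 2) ^ p.2 * Ring.choose (n + a - p.1 + (n + b)) p.2 := by
  rw [← Finset.Nat.sum_antidiagonal_swap, Finset.Nat.sum_antidiagonal_eq_sum_range_succ_mk]
  unfold jacobiP
  refine Finset.sum_congr rfl fun k hk => ?_
  have hk : k ≤ n := by simpa [Nat.lt_succ_iff] using hk
  simp only [Prod.swap, Nat.cast_sub hk]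
  have h1 := asc_eq (n + a - (n - k) + (n + b)) k
  have h2 := asc_eq (n + a) (n - k)
  rw [Nat.cast_sub hk] at h2
  rw [show (n : ℂ) + a - (n - k) + (n + b) - k + 1 = n + a + b + 1 by ring] at h1
  rw [show (n : ℂ) + a - (n - k) + 1 = a + k + 1 by ring] at h2
  rw [h1, h2]
  have := Nat.cast_ne_zero (R := ℂ).2 k.factorial_ne_zero
  have := Nat.cast_ne_zero (R := ℂ).2 (n - k).factorial_ne_zero
  field_simp

lemma sum_triple (n : ℕ) (f : ℕ → ℕ → ℕ → ℂ) :
    ∑ p ∈ Finset.HasAntidiagonal.antidiagonal n,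
      ∑ q ∈ Finset.HasAntidiagonal.antidiagonal p.1, f q.1 q.2 p.2 =
    ∑ p ∈ Finset.HasAntidiagonal.antidiagonal n,
      ∑ q ∈ Finset.HasAntidiagonal.antidiagonal p.2, f p.1 q.1 q.2 := by
  rw [Finset.sum_sigma', Finset.sum_sigma']
  refine Finset.sum_bij' (fun s _ => ⟨(s.2.1, s.2.2 + s.1.2), (s.2.2, s.1.2)⟩)
    (fun s _ => ⟨(s.1.1 + s.2.1, s.2.2), (s.1.1, s.2.1)⟩) ?_ ?_ ?_ ?_ ?_ <;>
  · rintro ⟨⟨a, b⟩, ⟨c, d⟩⟩ h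
    first
    | rfl
    | simp only [Finset.mem_sigma, Finset.HasAntidiagonal.mem_antidiagonal] at h ⊢
      obtain ⟨h1, h2⟩ := h
      try subst h2
      try subst h1
      try simp [add_assoc]

lemma jac_eq (n : ℕ) (a b x : ℂ) :
    jacobiP n a b x = PowerSeries.coeff n
      (bser (1 + (x - 1) / 2) (n + a) * bser ((x - 1) / 2) (n + b)) := by
  rw [jac_eq1, PowerSeries.coeff_mul]
  generalize (x - 1) / 2 = y
  generalize (n : ℂ) + a = N
  generalize (n : ℂ) + b = M
  have h1 : ∀ p ∈ Finset.HasAntidiagonal.antidiagonal n, PowerSeries.coeff p.1 (bser (1 + y) N) *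
      PowerSeries.coeff p.2 (bser y M) = ∑ q ∈ Finset.HasAntidiagonal.antidiagonal p.1,
        Ring.choose N q.1 * y ^ q.2 * Ring.choose (N - q.1) q.2 * (y ^ p.2 * Ring.choose M p.2) := by
    intro p _
    rw [bser_coeff, bser_coeff, (Commute.all 1 y).add_pow', Finset.sum_mul, Finset.sum_mul]
    refine Finset.sum_congr rfl fun q hq => ?_
    have hq := Finset.HasAntidiagonal.mem_antidiagonal.1 hq
    have h := Ring.choose_smul_choose N (n := p.1) (k := q.1) (by omega)
    rw [show p.1 - q.1 = q.2 by omega, nsmul_eq_mul] at h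
    rw [nsmul_eq_mul]
    linear_combination y ^ q.2 * y ^ p.2 * Ring.choose M p.2 * h
  rw [Finset.sum_congr rfl h1, sum_triple n (fun q l j => Ring.choose N q * y ^ l * Ring.choose (N - q) l *
    (y ^ j * Ring.choose M j))]
  refine Finset.sum_congr rfl fun p _ => ?_
  rw [Ring.add_choose_eq _ (Commute.all _ _), Finset.mul_sum]
  refine Finset.sum_congr rfl fun q hq => ?_
  rw [← Finset.HasAntidiagonal.mem_antidiagonal.1 hq, pow_add]
  ring

open PowerSeries in
lemma coeff_main (m : ℕ) (Q : PowerSeries ℂ) :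
    coeff (m + 1) (Q ^ m * (Q - X * derivative ℂ Q)) = 0 := by
  have h : C ((m : ℂ) + 1) * (Q ^ m * (Q - X * derivative ℂ Q)) =
      C ((m : ℂ) + 1) * Q ^ (m + 1) - X * derivative ℂ (Q ^ (m + 1)) := by
    rw [derivative_pow]
    simp
    ring
  have h2 := congrArg (coeff (m + 1)) h
  rw [coeff_C_mul, map_sub, coeff_C_mul, coeff_succ_X_mul, coeff_derivative] at h2
  have h3 : (m : ℂ) + 1 ≠ 0 := Nat.cast_add_one_ne_zero m
  apply mul_left_cancel₀ h3
  rw [h2]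
  ring

open PowerSeries in
lemma key (m : ℕ) (α β p y : ℂ) :
    (bser p ((m + 1 : ℕ) + α) * bser y ((m + 1 : ℕ) + β)) *
      (X * derivative ℂ (bser p (-α) * bser y (-β)) + C β * (bser p (-α) * bser y (-β))
        + C (α - β) * (bser p (-α) * bser y (-β - 1))) =
    C α * (((1 + C p * X) * (1 + C y * X)) ^ m * ((1 + C p * X) * (1 + C y * X) -
      X * derivative ℂ ((1 + C p * X) * (1 + C y * X)))) := by
  have e1 (c a : ℂ) : bser c ((m + 1 : ℕ) + a) * bser c (-a) = (1 + C c * X) ^ (m + 1) := by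
    rw [← bser_add, ← bser_nat]; congr 1; ring
  have e2 (c a : ℂ) : bser c ((m + 1 : ℕ) + a) * bser c (-a - 1) = (1 + C c * X) ^ m := by
    rw [← bser_add, ← bser_nat]; congr 1; push_cast; ring
  have a1 := e1 p α
  have a2 := e2 p α
  have b1 := e1 y β
  have b2 := e2 y β
  simp only [Derivation.leibniz, bser_deriv, smul_eq_mul, map_add, derivative_X, derivative_C,
    derivative_one, map_mul, map_neg, map_sub]
  generalize bser p ((m + 1 : ℕ) + α) = P at *
  generalize bser y ((m + 1 : ℕ) + β) = R at *
  generalize bser p (-α) = P1 at *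
  generalize bser p (-α - 1) = P2 at *
  generalize bser y (-β) = R1 at *
  generalize bser y (-β - 1) = R2 at *
  generalize C p = p at *
  generalize C y = y at *
  generalize C α = α at *
  generalize C β = β at *
  trans (-X * β * y * (P * P1) * (R * R2) - X * α * p * (P * P2) * (R * R1)
    + β * (P * P1) * (R * R1) + (α - β) * (P * P1) * (R * R2))
  · ring
  · rw [a1, a2, b1, b2, mul_pow]; ring

theorem stmt2 (n : ℕ) (α β x : ℂ) :
    ∑ k ∈ Finset.range (n + 1),
        jacobiP (n - k) (α + (k : ℂ)) (β + (k : ℂ)) x *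
          (((k : ℂ) + β) * jacobiP k (-α - (k : ℂ)) (-β - (k : ℂ)) x +
            (α - β) * jacobiP k (-α - (k : ℂ)) (-β - (k : ℂ) - 1) x)
      = α * (if n = 0 then 1 else 0) := by
  rcases n with _ | m
  · simp [jacobiP]
  rw [if_neg (Nat.succ_ne_zero m), mul_zero]
  have h := congrArg (PowerSeries.coeff (m + 1))
    (key m α β (1 + (x - 1) / 2) ((x - 1) / 2))
  rw [PowerSeries.coeff_C_mul, coeff_main, mul_zero, PowerSeries.coeff_mul,
    ← Finset.Nat.sum_antidiagonal_swap, Finset.Nat.sum_antidiagonal_eq_sum_range_succ_mk] at h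
  rw [← h]
  refine Finset.sum_congr rfl fun k hk => ?_
  have hk : k ≤ m + 1 := by simpa [Nat.lt_succ_iff] using hk
  simp only [Prod.swap]
  rw [jac_eq, jac_eq, jac_eq, Nat.cast_sub hk]
  rw [show ((m + 1 : ℕ) : ℂ) - k + (α + k) = (m + 1 : ℕ) + α by ring,
    show ((m + 1 : ℕ) : ℂ) - k + (β + k) = (m + 1 : ℕ) + β by ring,
    show (k : ℂ) + (-α - k) = -α by ring, show (k : ℂ) + (-β - k) = -β by ring,
    show (k : ℂ) + (-β - k - 1) = -β - 1 by ring]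
  congr 1
  rw [map_add, map_add, PowerSeries.coeff_C_mul, PowerSeries.coeff_C_mul, add_mul]
  congr 2
  rcases k with _ | k
  · simp
  · rw [PowerSeries.coeff_succ_X_mul, PowerSeries.coeff_derivative]
    push_cast
    ring
end

section
/- For every natural number n, every complex α and every complex x, one has Σ_{k=0}^{n} (k+α) · P_{n-k}^{(α+k, α+k)}(x) · P_k^{(-α-k, -α-k)}(x) = α · δ_{n,0}, where δ_{n,0} equals 1 if n = 0 and 0 otherwise. -/
open PowerSeries in
/-- The series `((1 + y t) (1 + (1 + y) t)) ^ a`. -/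
noncomputable def genF (y a : ℂ) : PowerSeries ℂ :=
  rescale y (PowerSeries.binomialSeries ℂ a) * rescale (1 + y) (PowerSeries.binomialSeries ℂ a)

lemma genF_add (y a b : ℂ) : genF y (a + b) = genF y a * genF y b := by
  simp only [genF, PowerSeries.binomialSeries_add, map_mul]
  ring

lemma choose_succ_aux (a : ℂ) (m : ℕ) :
    Ring.choose a (m + 1) * ((m : ℂ) + 1) = a * Ring.choose (a - 1) m := by
  have h := Ring.choose_smul_choose a (n := m + 1) (k := 1) (by omega)
  simp only [Nat.choose_one_right, nsmul_eq_mul, Ring.choose_one_right, Nat.add_sub_cancel] at h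
  push_cast at h
  rw [← h]; ring

open PowerSeries in
lemma deriv_aux (c a : ℂ) :
    derivative ℂ (rescale c (PowerSeries.binomialSeries ℂ a)) =
      C (a * c) * rescale c (PowerSeries.binomialSeries ℂ (a - 1)) := by
  ext m
  have h := choose_succ_aux a m
  rw [coeff_derivative, coeff_rescale, coeff_C_mul, coeff_rescale]
  simp only [binomialSeries_coeff, smul_eq_mul, mul_one]
  rw [pow_succ]
  linear_combination (c ^ m * c) * h

open PowerSeries in
lemma resc_aux (c a : ℂ) :
    rescale c (PowerSeries.binomialSeries ℂ a) =
      (1 + C c * X) * rescale c (PowerSeries.binomialSeries ℂ (a - 1)) := by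
  have h : PowerSeries.binomialSeries ℂ a = (1 + X) * PowerSeries.binomialSeries ℂ (a - 1) := by
    have h1 : PowerSeries.binomialSeries ℂ (1 : ℂ) = (1 + X) := by
      simpa using binomialSeries_nat (R := ℂ) (A := ℂ) 1
    rw [← h1, ← binomialSeries_add]
    congr 1; ring
  rw [h, map_mul, map_add, map_one, rescale_X]

open PowerSeries in
/-- derivative of the quadratic -/
noncomputable def genD (y : ℂ) : PowerSeries ℂ :=
  C y * (1 + C (1 + y) * X) + C (1 + y) * (1 + C y * X)

open PowerSeries in
lemma genF_deriv (y a : ℂ) :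
    derivative ℂ (genF y a) = C a * genF y (a - 1) * genD y := by
  rw [genF, Derivation.leibniz, deriv_aux, deriv_aux, resc_aux y a, resc_aux (1 + y) a, genF, genD]
  simp only [smul_eq_mul, map_mul]
  ring

lemma triple_aux (n : ℕ) (f : ℕ → ℕ → ℕ → ℂ) :
    ∑ p ∈ Finset.HasAntidiagonal.antidiagonal n, ∑ q ∈ Finset.HasAntidiagonal.antidiagonal p.2, f p.1 q.1 q.2 =
    ∑ p ∈ Finset.HasAntidiagonal.antidiagonal n, ∑ q ∈ Finset.HasAntidiagonal.antidiagonal p.1, f q.1 q.2 p.2 := by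
  rw [Finset.sum_sigma', Finset.sum_sigma']
  refine Finset.sum_bij' (fun z _ => ⟨(z.1.1 + z.2.1, z.2.2), (z.1.1, z.2.1)⟩)
    (fun z _ => ⟨(z.2.1, z.2.2 + z.1.2), (z.2.2, z.1.2)⟩) ?_ ?_ ?_ ?_ ?_
  · rintro ⟨⟨a, b⟩, ⟨c, d⟩⟩ h
    simp at h ⊢; omega
  · rintro ⟨⟨a, b⟩, ⟨c, d⟩⟩ h
    simp at h ⊢; omega
  · rintro ⟨⟨a, b⟩, ⟨c, d⟩⟩ h
    simp at h ⊢; obtain ⟨h1, rfl⟩ := h; rfl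
  · rintro ⟨⟨a, b⟩, ⟨c, d⟩⟩ h
    simp at h ⊢; obtain ⟨h1, rfl⟩ := h; rfl
  · rintro ⟨⟨a, b⟩, ⟨c, d⟩⟩ h
    rfl

lemma choose_asc (a : ℂ) (n : ℕ) :
    Ring.choose a n = (ascPochhammer ℂ n).eval (a - n + 1) / (n.factorial : ℂ) := by
  rw [Ring.choose_eq_smul, Polynomial.descPochhammer_smeval_eq_ascPochhammer,
    Polynomial.ascPochhammer_smeval_cast, Polynomial.ascPochhammer_smeval_eq_eval, smul_eq_mul]
  ring

lemma jacobi_coeff (n : ℕ) (a b x : ℂ) (hb : b = a - n) :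
    jacobiP n b b x = PowerSeries.coeff n (genF ((x - 1) / 2) a) := by
  subst hb
  set y := (x - 1) / 2 with hy
  have hR : PowerSeries.coeff n (genF y a) = ∑ p ∈ Finset.HasAntidiagonal.antidiagonal n,
      ∑ q ∈ Finset.HasAntidiagonal.antidiagonal p.2,
        Ring.choose a p.1 * (Ring.choose a q.2 * Ring.choose (a - q.2) q.1) * y ^ (p.1 + q.1) := by
    rw [genF, PowerSeries.coeff_mul]
    refine Finset.sum_congr rfl fun p _ => ?_
    rw [PowerSeries.coeff_rescale, PowerSeries.coeff_rescale, add_comm 1 y,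
      (Commute.all y 1).add_pow']
    simp only [PowerSeries.binomialSeries_coeff, smul_eq_mul, mul_one, Finset.sum_mul,
      Finset.mul_sum]
    refine Finset.sum_congr rfl fun q hq => ?_
    have hq' := Finset.HasAntidiagonal.mem_antidiagonal.1 hq
    have h := Ring.choose_smul_choose a (n := p.2) (k := q.2) (by omega)
    rw [show p.2 - q.2 = q.1 by omega, nsmul_eq_mul] at h
    rw [← h, ← hq', Nat.choose_symm_add, nsmul_eq_mul, one_pow, pow_add]
    ring
  rw [hR, triple_aux n (fun i j k => Ring.choose a i * (Ring.choose a k * Ring.choose (a - k) j)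
    * y ^ (i + j)), jacobiP, Finset.Nat.sum_antidiagonal_eq_sum_range_succ_mk]
  refine Finset.sum_congr rfl fun k hk => ?_
  have hk' : k ≤ n := by have := Finset.mem_range.1 hk; omega
  have hV := Ring.add_choose_eq (r := a) (s := a - ((n - k : ℕ) : ℂ)) k (Commute.all _ _)
  have : ∑ q ∈ Finset.HasAntidiagonal.antidiagonal k, Ring.choose a q.1 * (Ring.choose a (n - k) *
      Ring.choose (a - ((n - k : ℕ) : ℂ)) q.2) * y ^ (q.1 + q.2) =
      Ring.choose a (n - k) * Ring.choose (a + (a - ((n - k : ℕ) : ℂ))) k * y ^ k := by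
    rw [hV, Finset.mul_sum, Finset.sum_mul]
    refine Finset.sum_congr rfl fun q hq => ?_
    rw [Finset.HasAntidiagonal.mem_antidiagonal.1 hq]; ring
  refine Eq.trans ?_ this.symm
  rw [choose_asc, choose_asc, Nat.cast_sub hk', ← hy,
    show (n : ℂ) + (a - n) + (a - n) + 1 = a + (a - (n - k)) - k + 1 by ring,
    show a - n + (k : ℂ) + 1 = a - (n - k) + 1 by ring, div_mul_div_comm,
    mul_comm (k.factorial : ℂ)]
  ring

lemma coeff_X_deriv (k : ℕ) (f : PowerSeries ℂ) :
    PowerSeries.coeff k (PowerSeries.X * PowerSeries.derivative ℂ f) =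
      (k : ℂ) * PowerSeries.coeff k f := by
  cases k with
  | zero => simp
  | succ k =>
    rw [PowerSeries.coeff_succ_X_mul, PowerSeries.coeff_derivative]
    push_cast; ring


theorem stmt3 (n : ℕ) (α x : ℂ) :
    ∑ k ∈ Finset.range (n + 1),
        ((k : ℂ) + α) * (jacobiP (n - k) (α + (k : ℂ)) (α + (k : ℂ)) x *
          jacobiP k (-α - (k : ℂ)) (-α - (k : ℂ)) x)
      = α * (if n = 0 then 1 else 0) 
  := by
  set y := (x - 1) / 2 with hy
  have h1 : ∀ k ∈ Finset.range (n + 1),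
      ((k : ℂ) + α) * (jacobiP (n - k) (α + (k : ℂ)) (α + (k : ℂ)) x *
          jacobiP k (-α - (k : ℂ)) (-α - (k : ℂ)) x) =
      PowerSeries.coeff k (PowerSeries.X * PowerSeries.derivative ℂ (genF y (-α))
        + PowerSeries.C α * genF y (-α)) * PowerSeries.coeff (n - k) (genF y (α + n)) := by
    intro k hk
    have hk' : k ≤ n := by have := Finset.mem_range.1 hk; omega
    rw [jacobi_coeff (n - k) (α + n) (α + k) x (by rw [Nat.cast_sub hk']; ring),
      jacobi_coeff k (-α) _ x rfl, map_add, coeff_X_deriv, PowerSeries.coeff_C_mul]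
    ring
  rw [Finset.sum_congr rfl h1, ← Finset.Nat.sum_antidiagonal_eq_sum_range_succ_mk
    (fun p => PowerSeries.coeff p.1 (PowerSeries.X * PowerSeries.derivative ℂ (genF y (-α))
        + PowerSeries.C α * genF y (-α)) * PowerSeries.coeff p.2 (genF y (α + n))),
    ← PowerSeries.coeff_mul]
  have e1 : genF y (n : ℂ) = genF y (-α) * genF y (α + n) := by
    rw [← genF_add]; congr 1; ring
  have e2 : genF y ((n : ℂ) - 1) = genF y (-α - 1) * genF y (α + n) := by
    rw [← genF_add]; congr 1; ring
  have e3 : (PowerSeries.X * PowerSeries.derivative ℂ (genF y (-α))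
        + PowerSeries.C α * genF y (-α)) * genF y (α + n) =
      PowerSeries.C α * (genF y (n : ℂ) - PowerSeries.X * (genF y ((n : ℂ) - 1) * genD y)) := by
    rw [genF_deriv, e1, e2, map_neg]; ring
  rw [e3, PowerSeries.coeff_C_mul, map_sub]
  congr 1
  have h := coeff_X_deriv n (genF y (n : ℂ))
  rw [genF_deriv, mul_assoc, mul_left_comm, PowerSeries.coeff_C_mul] at h
  split_ifs with hn
  · subst hn
    have := PowerSeries.binomialSeries_zero (R := ℂ) (A := ℂ)
    simp [genF]
  · have : (n : ℂ) ≠ 0 := by exact_mod_cast hn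
    rw [mul_left_cancel₀ this h, sub_self]
end

section
/- (Scalar form of the matrix identity L·M = I of the paper's main theorem.) For all integers m and n with m ≥ n, all complex α, β and every complex x, one has Σ_{k=n}^{m} P_{m-k}^{(α+k, β+k)}(x) · ((k+β) · P_{k-n}^{(-α-k, -β-k)}(x) + (α-β) · P_{k-n}^{(-α-k, -β-k-1)}(x)) = (n+α) · δ_{m,n}, where δ_{m,n} equals 1 if m = n and 0 otherwise, and in each Jacobi polynomial the integer k is identified with the corresponding complex number. -/
open PowerSeries in
noncomputable def FF (c a : ℂ) : PowerSeries ℂ := rescale c (binomialSeries ℂ a)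

open PowerSeries in
lemma FF_coeff (c a : ℂ) (n : ℕ) : coeff n (FF c a) = c ^ n * Ring.choose a n := by
  simp [FF, coeff_rescale]

open PowerSeries in
lemma FF_add (c a b : ℂ) : FF c (a + b) = FF c a * FF c b := by
  simp [FF]

open PowerSeries in
lemma FF_nat (c : ℂ) (n : ℕ) : FF c n = (1 + C c * X) ^ n := by
  simp [FF, rescale_X]

open PowerSeries in
lemma FF_deriv (c a : ℂ) : d⁄dX ℂ (FF c a) = C (a * c) * FF c (a - 1) := by
  ext n
  rw [coeff_derivative, coeff_C_mul, FF_coeff, FF_coeff]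
  have := Ring.choose_smul_choose a (n := n + 1) (k := 1) (by omega)
  simp only [Nat.choose_one_right, nsmul_eq_mul, Ring.choose_one_right, Nat.add_sub_cancel] at this
  push_cast at this
  linear_combination c ^ (n+1) * this

lemma asc_choose (r : ℂ) (k : ℕ) :
    (ascPochhammer ℂ k).eval (r + 1) = k.factorial * Ring.choose (r + k) k := by
  have := Ring.factorial_nsmul_multichoose_eq_ascPochhammer (r + 1) k
  rw [Ring.multichoose_eq, ← Polynomial.ascPochhammer_smeval_eq_eval, ] at *
  rw [Polynomial.ascPochhammer_smeval_cast, ← this, nsmul_eq_mul]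
  congr 2
  ring

lemma jac_anti (n : ℕ) (a b x : ℂ) : jacobiP n a b x =
    ∑ p ∈ Finset.HasAntidiagonal.antidiagonal n, Ring.choose (n + a + b + p.1) p.1 * Ring.choose (n + a) p.2 *
      ((x - 1) / 2) ^ p.1 := by
  rw [Finset.Nat.sum_antidiagonal_eq_sum_range_succ_mk, jacobiP]
  refine Finset.sum_congr rfl fun k hk => ?_
  have hk : k ≤ n := by simpa [Nat.lt_succ_iff] using hk
  rw [asc_choose, asc_choose]
  have h1 : (k.factorial : ℂ) ≠ 0 := by exact_mod_cast k.factorial_ne_zero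
  have h2 : ((n-k).factorial : ℂ) ≠ 0 := by exact_mod_cast (n-k).factorial_ne_zero
  have : a + (k:ℂ) + ((n - k : ℕ) : ℂ) = n + a := by push_cast [hk]; ring
  rw [this]
  field_simp

open PowerSeries in
lemma jac_coeff (n : ℕ) (a b x : ℂ) : jacobiP n a b x =
    coeff n (FF ((x - 1) / 2 + 1) (n + a) * FF ((x - 1) / 2) (n + b)) := by
  rw [jac_anti, mul_comm, coeff_mul]
  generalize (x - 1) / 2 = y
  trans ∑ p ∈ Finset.HasAntidiagonal.antidiagonal n, ∑ q ∈ Finset.HasAntidiagonal.antidiagonal p.1,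
    Ring.choose (n + b) q.1 * Ring.choose ((n:ℂ) + a) (q.2 + p.2) * Nat.choose (q.2 + p.2) q.2 * y ^ (q.1 + q.2)
  · refine Finset.sum_congr rfl fun p hp => ?_
    rw [Finset.HasAntidiagonal.mem_antidiagonal] at hp
    have hn : (n : ℂ) = p.1 + p.2 := by rw [← hp]; push_cast; rfl
    rw [show (n:ℂ) + a + b + p.1 = (n + b) + (a + p.1) by ring,
      Ring.add_choose_eq _ (Commute.all _ _), Finset.sum_mul, Finset.sum_mul]
    refine Finset.sum_congr rfl fun q hq => ?_
    rw [Finset.HasAntidiagonal.mem_antidiagonal] at hq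
    have := Ring.choose_smul_choose ((n:ℂ) + a) (n := q.2 + p.2) (k := p.2) (by omega)
    rw [Nat.add_sub_cancel, nsmul_eq_mul, show (n:ℂ) + a - p.2 = a + p.1 by rw [hn]; ring,
      ← Nat.choose_symm_add] at this
    rw [hq]
    linear_combination (-Ring.choose (n + b) q.1 * y ^ p.1) * this
  · trans ∑ p ∈ Finset.HasAntidiagonal.antidiagonal n, ∑ q ∈ Finset.HasAntidiagonal.antidiagonal p.2,
      Ring.choose (n + b) p.1 * Ring.choose ((n:ℂ) + a) (q.1 + q.2) * Nat.choose (q.1 + q.2) q.1 *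
        y ^ (p.1 + q.1)
    · rw [Finset.sum_sigma', Finset.sum_sigma']
      refine Finset.sum_nbij' (fun ⟨⟨_i, j⟩, ⟨k, l⟩⟩ ↦ ⟨(k, l + j), (l, j)⟩)
        (fun ⟨⟨i, _j⟩, ⟨k, l⟩⟩ ↦ ⟨(i + k, l), (i, k)⟩) ?_ ?_ ?_ ?_ ?_
      · rintro ⟨⟨i, j⟩, ⟨k, l⟩⟩ h
        simp at h ⊢
        omega
      · rintro ⟨⟨i, j⟩, ⟨k, l⟩⟩ h
        simp at h ⊢
        omega
      · rintro ⟨⟨i, j⟩, ⟨k, l⟩⟩ h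
        simp at h ⊢
        omega
      · rintro ⟨⟨i, j⟩, ⟨k, l⟩⟩ h
        simp at h ⊢
        omega
      · rintro ⟨⟨i, j⟩, ⟨k, l⟩⟩ h
        rfl
    · refine Finset.sum_congr rfl fun p hp => ?_
      rw [FF_coeff, FF_coeff, (Commute.all y 1).add_pow', Finset.sum_mul, Finset.mul_sum]
      refine Finset.sum_congr rfl fun q hq => ?_
      rw [Finset.HasAntidiagonal.mem_antidiagonal] at hq
      rw [hq, nsmul_eq_mul, one_pow, pow_add]
      ring

open PowerSeries in
lemma main_nat (N : ℕ) (α β x : ℂ) :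
    ∑ p ∈ Finset.HasAntidiagonal.antidiagonal N,
      jacobiP p.1 (α + p.2) (β + p.2) x * ((p.2 + β) * jacobiP p.2 (-α - p.2) (-β - p.2) x +
        (α - β) * jacobiP p.2 (-α - p.2) (-β - p.2 - 1) x) = α * if N = 0 then 1 else 0 := by
  set y := (x - 1) / 2 with hy
  set S := FF (y + 1) (-α) * FF y (-β) with hS
  set U := FF (y + 1) (-α) * FF y (-β - 1) with hU
  have h : ∀ p ∈ Finset.HasAntidiagonal.antidiagonal N, jacobiP p.1 (α + p.2) (β + p.2) x *
      ((p.2 + β) * jacobiP p.2 (-α - p.2) (-β - p.2) x +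
        (α - β) * jacobiP p.2 (-α - p.2) (-β - p.2 - 1) x) =
      coeff p.1 (FF (y + 1) (N + α) * FF y (N + β)) *
        coeff p.2 (C β * S + C (α - β) * U + X * d⁄dX ℂ S) := by
    intro p hp
    rw [Finset.HasAntidiagonal.mem_antidiagonal] at hp
    have hn : (N : ℂ) = p.1 + p.2 := by rw [← hp]; push_cast; rfl
    rw [jac_coeff, jac_coeff, jac_coeff, ← hy]
    rw [show (p.1:ℂ) + (α + p.2) = N + α by rw [hn]; ring,
      show (p.1:ℂ) + (β + p.2) = N + β by rw [hn]; ring,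
      show (p.2:ℂ) + (-α - p.2) = -α by ring,
      show (p.2:ℂ) + (-β - p.2) = -β by ring,
      show (p.2:ℂ) + (-β - p.2 - 1) = -β - 1 by ring, ← hS, ← hU]
    congr 1
    have : coeff p.2 (X * d⁄dX ℂ S) = p.2 * coeff p.2 S := by
      rcases p.2 with _ | k
      · simp
      · rw [coeff_succ_X_mul, coeff_derivative]; push_cast; ring
    rw [map_add, map_add, coeff_C_mul, coeff_C_mul, this]
    ring
  rw [Finset.sum_congr rfl h, ← coeff_mul]
  have hd : d⁄dX ℂ S = C (-α * (y + 1)) * (FF (y + 1) (-α - 1) * FF y (-β))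
      + C (-β * y) * (FF (y+1) (-α) * FF y (-β - 1)) := by
    rw [hS, Derivation.leibniz, FF_deriv, FF_deriv]
    simp only [smul_eq_mul]
    ring
  rcases N with _ | M
  · have hc (c a : ℂ) : constantCoeff (FF c a) = 1 := by
      rw [← coeff_zero_eq_constantCoeff_apply, FF_coeff]
      simp
    rw [coeff_zero_eq_constantCoeff_apply]
    simp [hS, hU, hc]
  · have e1 (c a : ℂ) : FF c ((M + 1 : ℕ) + a) = (1 + C c * X) * (1 + C c * X) ^ M * FF c a := by
      rw [FF_add, FF_nat, pow_succ']
    have e0 (c a : ℂ) : FF c a = (1 + C c * X) * FF c (a - 1) := by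
      have := FF_add c (1:ℕ) (a - 1)
      rw [FF_nat, pow_one] at this
      rw [← this]; congr 1; push_cast; ring
    have e2 (c a : ℂ) : FF c a * FF c (-a) = 1 := by
      rw [← FF_add, add_neg_cancel]; simpa using FF_nat c 0
    have e3 (c a : ℂ) : FF c a * FF c (-a) = 1 := by
      rw [← FF_add, add_neg_cancel]; simpa using FF_nat c 0
    set A : PowerSeries ℂ := 1 + C (y+1) * X with hA
    set B : PowerSeries ℂ := 1 + C y * X with hB
    have f1 : A * (FF (y+1) α * FF (y+1) (-α - 1)) = 1 := by
      rw [← e2 (y+1) α, e0 _ (-α)]; ring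
    have f2 : B * (FF y β * FF y (-β - 1)) = 1 := by
      rw [← e2 y β, e0 _ (-β)]; ring
    have hdA : d⁄dX ℂ A = C (y+1) := by
      simp [hA, Derivation.leibniz]
    have hdB : d⁄dX ℂ B = C y := by
      simp [hB, Derivation.leibniz]
    have key : FF (y + 1) ((M + 1 : ℕ) + α) * FF y ((M + 1 : ℕ) + β) *
        (C β * S + C (α - β) * U + X * d⁄dX ℂ S) =
        C α * ((A * B) ^ (M + 1) - X * ((A * B) ^ M * d⁄dX ℂ (A * B))) := by
      rw [hd, e1, e1, hS, hU, e0 _ (-α), e0 _ (-β), ← hA, ← hB, Derivation.leibniz, hdA, hdB]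
      simp only [smul_eq_mul, map_mul, map_sub, map_neg, map_add, map_one] at *
      trans A ^ M * B ^ M * (A * (FF (y+1) α * FF (y+1) (-α - 1))) * (B * (FF y β * FF y (-β - 1))) *
        (C β * (A * B) + (C α - C β) * A - C α * (C y + 1) * X * B - C β * C y * X * A)
      · ring
      · rw [f1, f2, pow_succ (A * B) M, mul_pow]; generalize A ^ M = A1; generalize B ^ M = B1; rw [hA, hB]; ring
    rw [key, coeff_C_mul, map_sub, coeff_succ_X_mul]
    have h3 := coeff_derivative ((A * B) ^ (M + 1)) M
    rw [derivative_pow] at h3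
    have h4 : ((M:ℂ) + 1) ≠ 0 := by exact_mod_cast M.succ_ne_zero
    have h5 : coeff M ((A * B) ^ M * d⁄dX ℂ (A * B)) = coeff (M+1) ((A * B) ^ (M + 1)) := by
      apply mul_right_cancel₀ h4
      rw [← h3, Nat.add_sub_cancel, mul_assoc, show ((M + 1 : ℕ) : PowerSeries ℂ) = C ((M:ℂ) + 1) by simp, coeff_C_mul]
      ring
    rw [h5]; simp

theorem stmt4 (m n : ℤ) (h : n ≤ m) (α β x : ℂ) :
    ∑ k ∈ Finset.Icc n m,
        jacobiP (m - k).toNat (α + (k : ℂ)) (β + (k : ℂ)) x *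
          (((k : ℂ) + β) * jacobiP (k - n).toNat (-α - (k : ℂ)) (-β - (k : ℂ)) x +
            (α - β) * jacobiP (k - n).toNat (-α - (k : ℂ)) (-β - (k : ℂ) - 1) x)
      = ((n : ℂ) + α) * (if m = n then 1 else 0) := by
  obtain ⟨N, rfl⟩ := Int.le.dest h
  have := main_nat N (n + α) (n + β) x
  simp only [show (n + (N:ℤ) = n) ↔ N = 0 by omega]
  rw [← this]
  symm
  refine Finset.sum_bij (fun p _ => n + (p.2 : ℤ)) ?_ ?_ ?_ ?_
  · intro p hp
    rw [Finset.HasAntidiagonal.mem_antidiagonal] at hp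
    rw [Finset.mem_Icc]; omega
  · intro p hp q hq hpq
    rw [Finset.HasAntidiagonal.mem_antidiagonal] at hp hq
    ext <;> omega
  · intro k hk
    rw [Finset.mem_Icc] at hk
    refine ⟨((n + N - k).toNat, (k - n).toNat), ?_, ?_⟩
    · rw [Finset.HasAntidiagonal.mem_antidiagonal]; simp only; omega
    · simp only; omega
  · intro p hp
    rw [Finset.HasAntidiagonal.mem_antidiagonal] at hp
    rw [show (n + (N:ℤ) - (n + (p.2:ℤ))).toNat = p.1 by omega,
      show (n + (p.2:ℤ) - n).toNat = p.2 by omega]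
    push_cast
    rw [show (n:ℂ) + α + p.2 = α + (n + p.2) by ring, show (n:ℂ) + β + p.2 = β + (n + p.2) by ring,
      show -((n:ℂ) + α) - p.2 = -α - (n + p.2) by ring,
      show -((n:ℂ) + β) - p.2 = -β - (n + p.2) by ring]
    ring
end

section
/- (Scalar form of the matrix identity M·L = I of the paper's main theorem.) Let n ∈ ℕ, let α, β, x be complex numbers, and assume α + k ≠ 0 for every integer k with 0 ≤ k ≤ n. Then Σ_{k=0}^{n} P_k^{(α,β)}(x) · ( (n+β)/(k+α) · P_{n-k}^{(-α-n, -β-n)}(x) + (α-β)/(k+α) · P_{n-k}^{(-α-n, -β-n-1)}(x) ) = δ_{n,0}, where δ_{n,0} equals 1 if n = 0 and 0 otherwise. -/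
namespace JacobiAux

open PowerSeries Finset

lemma choose_formula (r : ℂ) (k : ℕ) :
    Ring.choose r k = (ascPochhammer ℂ k).eval (r - k + 1) / (k.factorial : ℂ) := by
  have h := Ring.factorial_nsmul_multichoose_eq_ascPochhammer (r - k + 1) k
  rw [Polynomial.ascPochhammer_smeval_eq_eval, nsmul_eq_mul] at h
  have hk : (k.factorial : ℂ) ≠ 0 := by exact_mod_cast k.factorial_ne_zero
  rw [eq_div_iff hk, ← h, mul_comm]
  rfl

/-- The power series `(1 + a t)^r`. -/
noncomputable def E (a r : ℂ) : PowerSeries ℂ := PowerSeries.mk fun k => Ring.choose r k * a ^ k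

lemma coeff_E (a r : ℂ) (k : ℕ) : coeff k (E a r) = Ring.choose r k * a ^ k := by
  simp [E]

lemma E_add (a r s : ℂ) : E a (r + s) = E a r * E a s := by
  ext n
  rw [coeff_E, coeff_mul, Ring.add_choose_eq n (Commute.all r s), sum_mul]
  refine sum_congr rfl fun p hp => ?_
  rw [coeff_E, coeff_E, ← mem_antidiagonal.mp hp, pow_add]
  ring

lemma E_zero (a : ℂ) : E a 0 = 1 := by
  ext n
  rw [coeff_E, Ring.choose_zero_ite, coeff_one]
  split_ifs with h <;> simp [h]

lemma choose_step (r : ℂ) (m : ℕ) :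
    (r - m) * Ring.choose r m = r * Ring.choose (r - 1) m := by
  have h1 := Ring.choose_smul_choose r (n := m + 1) (k := 1) (by omega)
  have h2 := Ring.choose_smul_choose r (n := m + 1) (k := m) (by omega)
  rw [Nat.add_sub_cancel] at h1
  rw [Nat.add_sub_cancel_left, Nat.choose_succ_self_right] at h2
  simp only [Ring.choose_one_right, Nat.choose_one_right, nsmul_eq_mul] at h1 h2
  push_cast at h1 h2
  linear_combination h1 - h2

lemma key (a b r s : ℂ) (m : ℕ) :
    (r + s - m) * coeff m (E a r * E b s) =
      r * coeff m (E a (r - 1) * E b s) + s * coeff m (E a r * E b (s - 1)) := by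
  simp only [coeff_mul, mul_sum, ← sum_add_distrib]
  refine sum_congr rfl fun p hp => ?_
  simp only [coeff_E]
  rw [← mem_antidiagonal.mp hp]
  push_cast
  linear_combination a ^ p.1 * b ^ p.2 * (Ring.choose s p.2 * choose_step r p.1 +
    Ring.choose r p.1 * choose_step s p.2)

lemma E_shift (b r : ℂ) (n m : ℕ) (hm : m ≤ n) :
    coeff m (E (b + 1) r) =
      coeff m (∑ i ∈ range (n + 1), PowerSeries.C (Ring.choose r i) * (X ^ i * E b (r - i))) := by
  simp only [map_sum, coeff_C_mul, coeff_X_pow_mul', coeff_E]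
  rw [add_comm b 1, add_pow, mul_sum]
  have hsub : range (m + 1) ⊆ range (n + 1) := range_subset_range.mpr (by omega)
  rw [← sum_subset hsub]
  · refine sum_congr rfl fun i hi => ?_
    have hi : i ≤ m := by simpa [Nat.lt_succ_iff] using hi
    rw [if_pos hi]
    obtain ⟨j, rfl⟩ := Nat.exists_eq_add_of_le' hi
    have h := Ring.choose_smul_choose r hi
    rw [nsmul_eq_mul, Nat.add_sub_cancel] at h
    rw [Nat.add_sub_cancel]
    simp only [one_pow]
    linear_combination b ^ j * h
  · intro i _ hi
    have : ¬ i ≤ m := by simpa [Nat.lt_succ_iff] using hi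
    rw [if_neg this, mul_zero]

lemma jacobi_eq (n : ℕ) (α β x : ℂ) :
    jacobiP n α β x = coeff n (E ((x - 1) / 2 + 1) (n + α) * E ((x - 1) / 2) (n + β)) := by
  set b := (x - 1) / 2 with hb
  have h1 : coeff n (E (b + 1) (n + α) * E b (n + β)) =
      coeff n ((∑ i ∈ range (n + 1), PowerSeries.C (Ring.choose (n + α) i) *
        (X ^ i * E b ((n + α) - i))) * E b (n + β)) := by
    rw [coeff_mul, coeff_mul]
    refine sum_congr rfl fun p hp => ?_
    rw [E_shift b (n + α) n p.1]
    have := mem_antidiagonal.mp hp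
    omega
  rw [h1, sum_mul, map_sum, ← sum_range_reflect]
  unfold jacobiP
  refine sum_congr rfl fun k hk => ?_
  have hk : k ≤ n := by simpa [Nat.lt_succ_iff] using hk
  rw [show n + 1 - 1 - k = n - k by omega, mul_assoc, coeff_C_mul, mul_assoc, ← E_add,
    coeff_X_pow_mul', if_pos (by omega), coeff_E, show n - (n - k) = k by omega,
    choose_formula, choose_formula, Nat.cast_sub hk,
    show (n : ℂ) + α - (n - k) + 1 = α + k + 1 by ring,
    show (n : ℂ) + α - (n - k) + (n + β) - k + 1 = n + α + β + 1 by ring, ← hb]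
  have hk1 : (k.factorial : ℂ) ≠ 0 := by exact_mod_cast k.factorial_ne_zero
  have hk2 : ((n - k).factorial : ℂ) ≠ 0 := by exact_mod_cast (n - k).factorial_ne_zero
  field_simp

/-- The correction factor. -/
noncomputable def psi (a b : ℂ) : PowerSeries ℂ := E a (-1) + E b (-1) - 1

lemma diag (a b : ℂ) (d : ℕ) :
    coeff d (E a d * E b d * psi a b) = if d = 0 then 1 else 0 := by
  have e : E a d * E b d * psi a b = E a ((d : ℂ) - 1) * E b d + E a d * E b ((d : ℂ) - 1)
      - E a d * E b d := by
    rw [sub_eq_add_neg (d : ℂ) 1, E_add, E_add, psi]; ring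
  rw [e, map_sub, map_add]
  split_ifs with h
  · subst h
    simp [coeff_mul, coeff_E, ← coeff_zero_eq_constantCoeff_apply]
  · have hd : (d : ℂ) ≠ 0 := by exact_mod_cast h
    apply mul_left_cancel₀ hd
    linear_combination -key a b d d d

noncomputable def B (a b α β : ℂ) (N : ℕ) : Matrix (Fin (N + 1)) (Fin (N + 1)) ℂ :=
  fun k i => coeff (k : ℕ) (X ^ (i : ℕ) * (E a (k + α) * E b (k + β)))

noncomputable def A (a b α β : ℂ) (N : ℕ) : Matrix (Fin (N + 1)) (Fin (N + 1)) ℂ :=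
  fun i j => coeff (i : ℕ) (X ^ (j : ℕ) * (E a (-α - j) * E b (-β - j) * psi a b))

lemma conv_sum (f h : PowerSeries ℂ) (N k : ℕ) (hk : k ≤ N) :
    ∑ i ∈ range (N + 1), coeff k (X ^ i * f) * coeff i h = coeff k (h * f) := by
  have hsub : range (k + 1) ⊆ range (N + 1) := range_subset_range.mpr (by omega)
  rw [← sum_subset hsub, coeff_mul, Nat.sum_antidiagonal_eq_sum_range_succ_mk]
  · refine sum_congr rfl fun i hi => ?_
    have hi : i ≤ k := by simpa [Nat.lt_succ_iff] using hi
    rw [coeff_X_pow_mul', if_pos hi, mul_comm]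
  · intro i _ hi
    have : ¬ i ≤ k := by simpa [Nat.lt_succ_iff] using hi
    rw [coeff_X_pow_mul', if_neg this, zero_mul]

lemma BA (a b α β : ℂ) (N : ℕ) : B a b α β N * A a b α β N = 1 := by
  ext k j
  rw [Matrix.mul_apply, Matrix.one_apply]
  simp only [B, A]
  rw [← Finset.sum_range (n := N + 1) (fun i => coeff (k : ℕ) (X ^ i * (E a (k + α) * E b (k + β))) *
    coeff i (X ^ (j : ℕ) * (E a (-α - j) * E b (-β - j) * psi a b))),
    conv_sum _ _ _ _ (by omega)]
  have e : X ^ (j : ℕ) * (E a (-α - j) * E b (-β - j) * psi a b) * (E a (k + α) * E b (k + β))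
      = X ^ (j : ℕ) * (E a ((k : ℂ) - j) * E b ((k : ℂ) - j) * psi a b) := by
    have e1 : E a ((k : ℂ) - j) = E a (-α - j) * E a (k + α) := by
      rw [← E_add]; congr 1; ring
    have e2 : E b ((k : ℂ) - j) = E b (-β - j) * E b (k + β) := by
      rw [← E_add]; congr 1; ring
    rw [e1, e2]
    ring
  rw [e, coeff_X_pow_mul']
  by_cases h : (j : ℕ) ≤ k
  · rw [if_pos h, ← Nat.cast_sub h, diag]
    congr 1
    rw [Fin.ext_iff, eq_iff_iff]
    omega
  · rw [if_neg h, if_neg]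
    rintro rfl
    exact h le_rfl

end JacobiAux

open JacobiAux in
theorem stmt5 (n : ℕ) (α β x : ℂ)
    (hα : ∀ k : ℤ, 0 ≤ k → k ≤ (n : ℤ) → α + (k : ℂ) ≠ 0) :
    ∑ k ∈ Finset.range (n + 1),
        jacobiP k α β x *
          (((n : ℂ) + β) / ((k : ℂ) + α) *
              jacobiP (n - k) (-α - (n : ℂ)) (-β - (n : ℂ)) x +
            (α - β) / ((k : ℂ) + α) *
              jacobiP (n - k) (-α - (n : ℂ)) (-β - (n : ℂ) - 1) x)
      = (if n = 0 then 1 else 0) := by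
  have hAB := mul_eq_one_comm.mp (BA ((x - 1) / 2 + 1) ((x - 1) / 2) α β n)
  have h := congrFun (congrFun hAB (Fin.last n)) 0
  rw [Matrix.mul_apply, Matrix.one_apply] at h
  simp only [A, B, Fin.val_last, Fin.val_zero, pow_zero, one_mul] at h
  rw [← Finset.sum_range (n := n + 1) (fun i => PowerSeries.coeff n (PowerSeries.X ^ i *
    (E ((x - 1) / 2 + 1) (-α - i) * E ((x - 1) / 2) (-β - i) *
      psi ((x - 1) / 2 + 1) ((x - 1) / 2))) * PowerSeries.coeff i
      (E ((x - 1) / 2 + 1) (i + α) * E ((x - 1) / 2) (i + β)))] at h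
  have hif : (if Fin.last n = 0 then (1 : ℂ) else 0) = if n = 0 then 1 else 0 := by
    congr 1
    rw [Fin.ext_iff]
    simp
  rw [← hif, ← h]
  refine Finset.sum_congr rfl fun k hk => ?_
  have hk : k ≤ n := by simpa [Nat.lt_succ_iff] using hk
  have hk0 : (k : ℂ) + α ≠ 0 := by
    have := hα k (by omega) (by exact_mod_cast hk)
    rw [add_comm]
    exact_mod_cast this
  rw [PowerSeries.coeff_X_pow_mul', if_pos hk, jacobi_eq, jacobi_eq, jacobi_eq, mul_comm]
  congr 1
  generalize (x - 1) / 2 + 1 = a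
  generalize (x - 1) / 2 = b
  rw [Nat.cast_sub hk, show (n : ℂ) - k + (-α - n) = -α - k by ring,
    show (n : ℂ) - k + (-β - n) = -β - k by ring,
    show (n : ℂ) - k + (-β - n - 1) = -β - k - 1 by ring]
  have e : E a (-α - k) * E b (-β - k) * psi a b = E a (-α - k - 1) * E b (-β - k)
      + E a (-α - k) * E b (-β - k - 1) - E a (-α - k) * E b (-β - k) := by
    rw [sub_eq_add_neg (-α - (k : ℂ)) 1, sub_eq_add_neg (-β - (k : ℂ)) 1, E_add, E_add, psi]; ring
  have hkey := key a b (-α - k) (-β - k) (n - k)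
  rw [Nat.cast_sub hk] at hkey
  rw [e, map_sub, map_add]
  field_simp
  linear_combination -hkey
end

section
/- For n ∈ ℕ and complex α, β, the Jacobi polynomial P_n^{(α,β)}(x) vanishes identically in x if and only if there exist integers a ≤ -1 and b ≤ -1 with α = a, β = b, max(-a, -b) ≤ n and n ≤ -a - b - 1. -/
theorem sum_pow_zero_aux (n : ℕ) (c : ℕ → ℂ)
    (h : ∀ y : ℂ, ∑ k ∈ Finset.range (n + 1), c k * y ^ k = 0) (k : ℕ) (hk : k ≤ n) : c k = 0 := by
  have hp : (∑ k ∈ Finset.range (n + 1), Polynomial.C (c k) * Polynomial.X ^ k) = 0 := by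
    apply Polynomial.funext
    intro y
    simpa [Polynomial.eval_finsetSum] using h y
  have h2 := congrArg (fun p => Polynomial.coeff p k) hp
  simp only [Polynomial.finsetSum_coeff, Polynomial.coeff_C_mul_X_pow, Polynomial.coeff_zero] at h2
  rw [Finset.sum_ite_eq] at h2
  simpa [Nat.lt_succ_of_le hk] using h2

theorem stmt6 (n : ℕ) (α β : ℂ) :
    (∀ x : ℂ, jacobiP n α β x = 0) ↔
      ∃ a b : ℤ, a ≤ -1 ∧ b ≤ -1 ∧ α = (a : ℂ) ∧ β = (b : ℂ) ∧
        max (-a) (-b) ≤ (n : ℤ) ∧ (n : ℤ) ≤ -a - b - 1 := by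
  constructor
  · intro h
    have hc : ∀ k ≤ n, (ascPochhammer ℂ k).eval ((n : ℂ) + α + β + 1) = 0 ∨
        (ascPochhammer ℂ (n - k)).eval (α + (k : ℂ) + 1) = 0 := by
      intro k hk
      have h1 := sum_pow_zero_aux n _ (fun y => by
        have h2 := h (2 * y + 1)
        unfold jacobiP at h2
        have e : (2 * y + 1 - 1) / 2 = y := by ring
        rw [e] at h2
        exact h2) k hk
      rw [div_eq_zero_iff] at h1
      rcases h1 with h1 | h1
      · exact mul_eq_zero.mp h1
      · exfalso
        rw [mul_eq_zero] at h1
        rcases h1 with h1 | h1 <;> exact Nat.factorial_ne_zero _ (by exact_mod_cast h1)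
    simp only [ascPochhammer_eval_eq_zero_iff] at hc
    obtain ⟨i, hi, hi'⟩ : ∃ i < n, (i : ℂ) = -(α + 1) := by
      rcases hc 0 (Nat.zero_le _) with ⟨j, hj, _⟩ | ⟨j, hj, hj'⟩
      · omega
      · exact ⟨j, by omega, by rw [hj']; simp⟩
    obtain ⟨j, hj, hj'⟩ : ∃ j < i + 1, (j : ℂ) = -((n : ℂ) + α + β + 1) := by
      rcases hc (i + 1) hi with h1 | ⟨l, hl, hl'⟩
      · exact h1
      · exfalso
        have : ((l + 1 : ℕ) : ℂ) = 0 := by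
          push_cast at hl' ⊢
          linear_combination hl' - hi'
        exact Nat.succ_ne_zero l (by exact_mod_cast this)
    refine ⟨-i - 1, i - j - n, by omega, by omega, ?_, ?_, by omega, by omega⟩
    · push_cast; linear_combination hi'
    · push_cast; linear_combination hj' - hi'
  · rintro ⟨a, b, ha, hb, rfl, rfl, hmax, hn⟩ x
    unfold jacobiP
    apply Finset.sum_eq_zero
    intro k hk
    have hk' : k ≤ n := Nat.lt_succ_iff.mp (Finset.mem_range.mp hk)
    have : (ascPochhammer ℂ k).eval ((n : ℂ) + a + b + 1) = 0 ∨
        (ascPochhammer ℂ (n - k)).eval ((a : ℂ) + (k : ℂ) + 1) = 0 := by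
      simp only [ascPochhammer_eval_eq_zero_iff]
      have h1 : -a ≤ n := le_trans (le_max_left _ _) hmax
      have h2 : -b ≤ n := le_trans (le_max_right _ _) hmax
      by_cases hka : -a ≤ k
      · left
        obtain ⟨m, hm⟩ := Int.eq_ofNat_of_zero_le (show 0 ≤ -(n + a + b + 1) by omega)
        refine ⟨m, by omega, ?_⟩
        have := congrArg (Int.cast : ℤ → ℂ) hm
        push_cast at this
        exact this.symm
      · right
        obtain ⟨m, hm⟩ := Int.eq_ofNat_of_zero_le (show 0 ≤ -(a + k + 1) by omega)
        refine ⟨m, by omega, ?_⟩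
        have := congrArg (Int.cast : ℤ → ℂ) hm
        push_cast at this
        exact this.symm
    rw [mul_eq_zero.mpr this]
    simp
end

section
/- Let n ≥ 1 and let α, β be complex numbers such that P_n^{(α,β)} does not vanish identically in x. Then P_n^{(α,β)} has degree strictly less than n in x if and only if α + β is an integer s with s ≤ -2, n + s + 1 ≤ 0 and 2n + s ≥ 0; and in that case the degree of P_n^{(α,β)} equals -n - s - 1 and P_n^{(α,β)}(x) = ((-n-β)_{2n+s+1} / (-n-s)_{2n+s+1}) · P_{-n-s-1}^{(α,β)}(x) for all complex x. -/
/-- The Jacobi polynomial `P_n^{(α,β)}` for arbitrary complex parameters, as a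
polynomial in `x`:
`P_n^{(α,β)}(x) = ∑_{k=0}^n ((n+α+β+1)_k (α+k+1)_{n-k})/(k! (n-k)!) ((x-1)/2)^k`. -/
noncomputable def jacobiPoly (n : ℕ) (α β : ℂ) : Polynomial ℂ :=
  ∑ k ∈ Finset.range (n + 1),
    Polynomial.C (((ascPochhammer ℂ k).eval ((n : ℂ) + α + β + 1) *
        (ascPochhammer ℂ (n - k)).eval (α + (k : ℂ) + 1)) /
      ((k.factorial : ℂ) * ((n - k).factorial : ℂ))) *
      (Polynomial.C (2⁻¹ : ℂ) * (Polynomial.X - 1)) ^ k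

open Polynomial in
theorem aux_deg (c : ℕ → ℂ) (n : ℕ) :
    (∑ k ∈ Finset.range (n + 1), C (c k) * (C (2⁻¹ : ℂ) * (X - 1)) ^ k).natDegree ≤ n ∧
    (∑ k ∈ Finset.range (n + 1), C (c k) * (C (2⁻¹ : ℂ) * (X - 1)) ^ k).coeff n
      = c n * 2⁻¹ ^ n := by
  have hd : ∀ k, (C (c k) * (C (2⁻¹ : ℂ) * (X - 1)) ^ k).natDegree ≤ k := by
    intro k
    refine (natDegree_C_mul_le _ _).trans ?_
    refine natDegree_pow_le.trans ?_
    have : (C (2⁻¹ : ℂ) * (X - 1)).natDegree ≤ 1 := by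
      refine (natDegree_C_mul_le _ _).trans ?_
      rw [← C_1, natDegree_X_sub_C]
    nlinarith
  constructor
  · apply natDegree_sum_le_of_forall_le
    intro k hk
    have := Finset.mem_range.1 hk
    exact (hd k).trans (by omega)
  · rw [finsetSum_coeff, Finset.sum_range_succ, Finset.sum_eq_zero, zero_add, coeff_C_mul,
      mul_pow, ← C_pow, coeff_C_mul]
    · have h1 : ((X - 1 : ℂ[X]) ^ n).coeff n = 1 := by
        have hm : ((X - C 1 : ℂ[X]) ^ n).Monic := (monic_X_sub_C 1).pow n
        have := hm.coeff_natDegree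
        rw [natDegree_pow, natDegree_X_sub_C, mul_one, C_1] at this
        exact this
      rw [h1, mul_one]
    · intro k hk
      exact coeff_eq_zero_of_natDegree_lt ((hd k).trans_lt (Finset.mem_range.1 hk))

theorem aux_jac_le (n : ℕ) (α β : ℂ) : (jacobiPoly n α β).natDegree ≤ n :=
  (aux_deg _ n).1

theorem aux_jac_coeff (n : ℕ) (α β : ℂ) : (jacobiPoly n α β).coeff n =
    (ascPochhammer ℂ n).eval ((n : ℂ) + α + β + 1) / (n.factorial : ℂ) * 2⁻¹ ^ n := by
  unfold jacobiPoly
  rw [(aux_deg _ n).2]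
  simp

theorem aux_neg (m k : ℕ) (h : k ≤ m) :
    (ascPochhammer ℂ k).eval (-(m : ℂ)) * ((m - k).factorial : ℂ)
      = (-1) ^ k * (m.factorial : ℂ) := by
  rw [ascPochhammer_eval_neg_eq_descPochhammer, descPochhammer_eval_eq_descFactorial,
    ← Nat.factorial_mul_descFactorial h]
  push_cast; ring

theorem aux_core (n m : ℕ) (h : m ≤ n) (α β : ℂ) (hs : α + β = -(n : ℂ) - m - 1) :
    jacobiPoly n α β = Polynomial.C ((ascPochhammer ℂ (n - m)).eval (α + m + 1) *
      m.factorial / n.factorial) * jacobiPoly m α β := by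
  unfold jacobiPoly
  rw [Finset.mul_sum]
  symm
  have e1 : (n : ℂ) + α + β + 1 = -(m : ℂ) := by linear_combination hs
  have e2 : (m : ℂ) + α + β + 1 = -(n : ℂ) := by linear_combination hs
  rw [e1, e2]
  refine Finset.sum_subset_zero_on_sdiff ?_ ?_ ?_
  · intro k; simp only [Finset.mem_range]; omega
  · intro k hk
    simp only [Finset.mem_sdiff, Finset.mem_range] at hk
    rw [ascPochhammer_eval_neg_coe_nat_of_lt (by omega)]
    simp
  · intro k hk
    have hk : k ≤ m := by simpa [Nat.lt_succ_iff] using hk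
    rw [← mul_assoc, ← Polynomial.C_mul]
    congr 2
    have a1 := aux_neg m k hk
    have a2 := aux_neg n k (hk.trans h)
    have a3 : (ascPochhammer ℂ (n - k)).eval (α + k + 1) =
        (ascPochhammer ℂ (m - k)).eval (α + k + 1) *
        (ascPochhammer ℂ (n - m)).eval (α + m + 1) := by
      have : n - k = (m - k) + (n - m) := by omega
      rw [this, ← ascPochhammer_mul]
      simp only [Polynomial.eval_mul, Polynomial.eval_comp, Polynomial.eval_add,
        Polynomial.eval_X, Polynomial.eval_natCast]
      congr 2
      push_cast [hk]; ring
    rw [a3]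
    have f1 : (k.factorial : ℂ) ≠ 0 := by exact_mod_cast k.factorial_ne_zero
    have f2 : ((n - k).factorial : ℂ) ≠ 0 := by exact_mod_cast (n - k).factorial_ne_zero
    have f3 : ((m - k).factorial : ℂ) ≠ 0 := by exact_mod_cast (m - k).factorial_ne_zero
    have f4 : (n.factorial : ℂ) ≠ 0 := by exact_mod_cast n.factorial_ne_zero
    rw [← eq_div_iff f2] at a2
    rw [← eq_div_iff f3] at a1
    rw [a1, a2]
    field_simp

theorem stmt7 (n : ℕ) (hn : 1 ≤ n) (α β : ℂ)
    (hnz : ¬ ∀ x : ℂ, (jacobiPoly n α β).eval x = 0) :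
    ((jacobiPoly n α β).natDegree < n ↔
      ∃ s : ℤ, α + β = (s : ℂ) ∧ s ≤ -2 ∧ (n : ℤ) + s + 1 ≤ 0 ∧ 0 ≤ 2 * (n : ℤ) + s) ∧
    ∀ s : ℤ, α + β = (s : ℂ) → s ≤ -2 → (n : ℤ) + s + 1 ≤ 0 → 0 ≤ 2 * (n : ℤ) + s →
      (jacobiPoly n α β).natDegree = (-(n : ℤ) - s - 1).toNat ∧
      ∀ x : ℂ,
        (jacobiPoly n α β).eval x =
          (ascPochhammer ℂ (2 * (n : ℤ) + s + 1).toNat).eval (-(n : ℂ) - β) /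
            (ascPochhammer ℂ (2 * (n : ℤ) + s + 1).toNat).eval (-(n : ℂ) - (s : ℂ)) *
            (jacobiPoly (-(n : ℤ) - s - 1).toNat α β).eval x := by
  have hden : ∀ k : ℕ, (k.factorial : ℂ) ≠ 0 := fun k => by exact_mod_cast k.factorial_ne_zero
  constructor
  · have h0 : (jacobiPoly n α β).natDegree < n ↔
        (ascPochhammer ℂ n).eval ((n : ℂ) + α + β + 1) = 0 := by
      have hc := aux_jac_coeff n α β
      constructor
      · intro h
        rw [Polynomial.coeff_eq_zero_of_natDegree_lt h] at hc
        simpa [hden n] using hc.symm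
      · intro h
        rw [h] at hc
        refine lt_of_le_of_ne (aux_jac_le n α β) fun he => ?_
        have : (jacobiPoly n α β).leadingCoeff = 0 := by
          rw [Polynomial.leadingCoeff, he, hc]; simp
        rw [Polynomial.leadingCoeff_eq_zero] at this
        exact hnz fun x => by rw [this]; simp
    rw [h0, ascPochhammer_eval_eq_zero_iff]
    constructor
    · rintro ⟨k, hk, he⟩
      refine ⟨-n - 1 - k, ?_, by omega, by omega, by omega⟩
      push_cast
      linear_combination he
    · rintro ⟨s, hs, h1, h2, h3⟩
      obtain ⟨k, hk⟩ := Int.eq_ofNat_of_zero_le (show 0 ≤ -n - s - 1 by omega)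
      refine ⟨k, by omega, ?_⟩
      have : s = -n - 1 - k := by omega
      rw [this] at hs
      push_cast at hs
      linear_combination hs
  · intro s hs h1 h2 h3
    obtain ⟨m, hm⟩ := Int.eq_ofNat_of_zero_le (show 0 ≤ -n - s - 1 by omega)
    have hs' : s = -n - 1 - m := by omega
    have hmn : m < n := by omega
    have t2 : (2 * (n : ℤ) + s + 1).toNat = n - m := by omega
    have t1 : (-(n : ℤ) - s - 1).toNat = m := by omega
    rw [t1, t2]
    have hs2 : α + β = -(n : ℂ) - m - 1 := by rw [hs, hs']; push_cast; ring
    have core := aux_core n m hmn.le α β hs2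
    constructor
    · have hK : (ascPochhammer ℂ (n - m)).eval (α + m + 1) * m.factorial / n.factorial ≠ 0 := by
        intro hK
        rw [hK] at core
        exact hnz fun x => by rw [core]; simp
      rw [core, Polynomial.natDegree_C_mul hK]
      refine le_antisymm (aux_jac_le m α β) (Polynomial.le_natDegree_of_ne_zero ?_)
      rw [aux_jac_coeff]
      have e2 : (m : ℂ) + α + β + 1 = -(n : ℂ) := by linear_combination hs2
      have hz : (ascPochhammer ℂ m).eval (-(n : ℂ)) ≠ 0 := by
        intro hz
        have := aux_neg n m hmn.le
        rw [hz] at this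
        simp [hden n] at this
      rw [e2]
      exact mul_ne_zero (div_ne_zero hz (hden m)) (by simp)
    · intro x
      have e1 : -(n : ℂ) - β = α + m + 1 := by linear_combination -hs2
      have e2 : -(n : ℂ) - s = ((m + 1 : ℕ) : ℂ) := by rw [hs']; push_cast; ring
      have e3 : (ascPochhammer ℂ (n - m)).eval (((m + 1 : ℕ) : ℂ)) * m.factorial
          = n.factorial := by
        rw [← ascPochhammer_eval_cast, ascPochhammer_nat_eq_ascFactorial]
        have := Nat.factorial_mul_ascFactorial m (n - m)
        rw [show m + (n - m) = n by omega] at this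
        rw [← this]; push_cast; ring
      have e4 : (ascPochhammer ℂ (n - m)).eval (((m + 1 : ℕ) : ℂ)) ≠ 0 := by
        intro h; rw [h, zero_mul] at e3; exact hden n e3.symm
      rw [core, e1, e2, Polynomial.eval_mul, Polynomial.eval_C, ← e3]
      have := hden m
      congr 1
      field_simp
end

section
/- Let n ≥ 1 and let α, β be complex numbers such that P_n^{(α,β)} does not vanish identically in x. Then P_n^{(α,β)}(1) = 0 if and only if α is an integer a with a ≤ -1 and n + a ≥ 0; and in that case the zero of P_n^{(α,β)} at x = 1 has multiplicity exactly -a, and P_n^{(α,β)}(x) = ((n+α+β+1)_{-a} · (n+a)! / n!) · ((x-1)/2)^{-a} · P_{n+a}^{(-α, β)}(x) for all complex x. -/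
open Polynomial in
theorem asc_fact (p q : ℕ) :
    (p.factorial : ℂ) * (ascPochhammer ℂ q).eval ((p : ℂ) + 1) = ((p + q).factorial : ℂ) := by
  have h : ((p : ℂ) + 1) = ((p + 1 : ℕ) : ℂ) := by push_cast; ring
  rw [h, ← ascPochhammer_eval_cast, ascPochhammer_nat_eq_ascFactorial]
  exact_mod_cast Nat.factorial_mul_ascFactorial p q

theorem asc_add (x : ℂ) (p q : ℕ) :
    (ascPochhammer ℂ (p + q)).eval x =
      (ascPochhammer ℂ p).eval x * (ascPochhammer ℂ q).eval (x + p) := by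
  rw [← ascPochhammer_mul]
  simp

theorem asc_zero (q : ℕ) (x : ℂ) :
    (ascPochhammer ℂ q).eval x = 0 ↔ ∃ k < q, x + k = 0 := by
  induction q with
  | zero => simp
  | succ q ih =>
    rw [ascPochhammer_succ_eval, mul_eq_zero, ih]
    constructor
    · rintro (⟨k, hk, h⟩ | h)
      · exact ⟨k, by omega, h⟩
      · exact ⟨q, by omega, h⟩
    · rintro ⟨k, hk, h⟩
      rcases Nat.lt_succ_iff_lt_or_eq.mp hk with h1 | rfl
      · exact Or.inl ⟨k, h1, h⟩
      · exact Or.inr h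

theorem jacobi_eval_one (n : ℕ) (α β : ℂ) :
    (jacobiPoly n α β).eval 1 = (ascPochhammer ℂ n).eval (α + 1) / (n.factorial : ℂ) := by
  unfold jacobiPoly
  rw [Polynomial.eval_finset_sum, Finset.sum_range_succ']
  simp

theorem jacobi_eval_one_iff (n : ℕ) (α β : ℂ) :
    (jacobiPoly n α β).eval 1 = 0 ↔ ∃ k < n, α + 1 + k = 0 := by
  rw [jacobi_eval_one, div_eq_zero_iff, asc_zero]
  simp [Nat.factorial_ne_zero]

theorem jacobi_factor (N m : ℕ) (hm : 1 ≤ m) (β : ℂ) :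
    jacobiPoly (N + m) (-(m : ℂ)) β =
      Polynomial.C ((ascPochhammer ℂ m).eval (((N + m : ℕ) : ℂ) + -(m : ℂ) + β + 1) *
        ((N.factorial : ℂ) / ((N + m).factorial : ℂ))) *
      (Polynomial.C (2⁻¹ : ℂ) * (Polynomial.X - 1)) ^ m * jacobiPoly N (m : ℂ) β := by
  unfold jacobiPoly
  have e : N + m + 1 = m + (N + 1) := by ring
  rw [e, Finset.sum_range_add, Finset.sum_eq_zero, zero_add, Finset.mul_sum]
  · apply Finset.sum_congr rfl
    intro j hj
    have hj' : j ≤ N := by simpa [Nat.lt_succ_iff] using hj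
    obtain ⟨r, rfl⟩ := Nat.exists_eq_add_of_le hj'
    have e1 : j + r + m - (m + j) = r := by omega
    have e2 : j + r - j = r := by omega
    rw [e1, e2, pow_add, asc_add]
    have h1 := asc_fact j r
    have h2 := asc_fact (m + j) r
    have a1 : -(m : ℂ) + ((m + j : ℕ) : ℂ) + 1 = (j : ℂ) + 1 := by push_cast; ring
    have a2 : (m : ℂ) + (j : ℂ) + 1 = ((m + j : ℕ) : ℂ) + 1 := by push_cast; ring
    have a3 : ((j + r + m : ℕ) : ℂ) + -(m : ℂ) + β + 1 + m
      = ((j + r : ℕ) : ℂ) + m + β + 1 := by push_cast; ring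
    have a4 : j + r + m = m + j + r := by ring
    rw [a1, a2, a3]
    have n1 : (j.factorial : ℂ) ≠ 0 := by exact_mod_cast Nat.factorial_ne_zero j
    have n2 : ((m + j).factorial : ℂ) ≠ 0 := by exact_mod_cast Nat.factorial_ne_zero _
    have n3 : (r.factorial : ℂ) ≠ 0 := by exact_mod_cast Nat.factorial_ne_zero r
    have n4 : ((m + j + r).factorial : ℂ) ≠ 0 := by exact_mod_cast Nat.factorial_ne_zero _
    generalize (ascPochhammer ℂ m).eval (((j + r + m : ℕ) : ℂ) + -(m : ℂ) + β + 1) = A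
    generalize (ascPochhammer ℂ j).eval (((j + r : ℕ) : ℂ) + m + β + 1) = B
    rw [eq_div_of_mul_eq n1 ((mul_comm _ _).trans h1),
      eq_div_of_mul_eq n2 ((mul_comm _ _).trans h2), a4]
    generalize (Polynomial.C (2⁻¹ : ℂ) * (Polynomial.X - 1)) = Y
    have key : A * B * (((j + r).factorial : ℂ) / j.factorial) /
        (((m + j).factorial : ℂ) * r.factorial) =
        (A * (((j + r).factorial : ℂ) / (m + j + r).factorial)) *
        (B * (((m + j + r).factorial : ℂ) / (m + j).factorial) /
          ((j.factorial : ℂ) * r.factorial)) := by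
      field_simp
    rw [key, Polynomial.C_mul]
    ring
  · intro k hk
    have hk' : k < m := by simpa using hk
    have : (ascPochhammer ℂ (N + m - k)).eval (-(m : ℂ) + (k : ℂ) + 1) = 0 := by
      rw [asc_zero]
      refine ⟨m - k - 1, by omega, ?_⟩
      obtain ⟨r, rfl⟩ := Nat.exists_eq_add_of_lt hk'
      have : k + r + 1 - k - 1 = r := by omega
      rw [this]; push_cast; ring
    rw [this]; simp


theorem stmt8 (n : ℕ) (hn : 1 ≤ n) (α β : ℂ)
    (hnz : ¬ ∀ x : ℂ, (jacobiPoly n α β).eval x = 0) :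
    ((jacobiPoly n α β).eval 1 = 0 ↔
      ∃ a : ℤ, α = (a : ℂ) ∧ a ≤ -1 ∧ 0 ≤ (n : ℤ) + a) ∧
    ∀ a : ℤ, α = (a : ℂ) → a ≤ -1 → 0 ≤ (n : ℤ) + a →
      (jacobiPoly n α β).rootMultiplicity 1 = (-a).toNat ∧
      ∀ x : ℂ,
        (jacobiPoly n α β).eval x =
          (ascPochhammer ℂ (-a).toNat).eval ((n : ℂ) + α + β + 1) *
            ((((n : ℤ) + a).toNat.factorial : ℂ) / (n.factorial : ℂ)) *
            ((x - 1) / 2) ^ (-a).toNat *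
            (jacobiPoly ((n : ℤ) + a).toNat (-α) β).eval x := by

  constructor
  · rw [jacobi_eval_one_iff]
    constructor
    · rintro ⟨k, hk, h⟩
      refine ⟨-(k : ℤ) - 1, ?_, by omega, by omega⟩
      push_cast
      linear_combination h
    · rintro ⟨a, rfl, h1, h2⟩
      refine ⟨(-a - 1).toNat, by omega, ?_⟩
      have : (((-a - 1).toNat : ℤ) : ℂ) = ((-a - 1 : ℤ) : ℂ) := by
        rw [Int.toNat_of_nonneg (by omega)]
      push_cast at this
      rw [this]; ring
  · intro a ha h1 h2
    obtain ⟨m, rfl⟩ : ∃ m : ℕ, a = -(m : ℤ) := ⟨(-a).toNat, by omega⟩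
    obtain ⟨N, rfl⟩ : ∃ N : ℕ, n = N + m := ⟨n - m, by omega⟩
    have e1 : (-(-(m : ℤ))).toNat = m := by omega
    have e2 : (((N + m : ℕ) : ℤ) + -(m : ℤ)).toNat = N := by omega
    have ha' : α = -(m : ℂ) := by rw [ha]; push_cast; rfl
    subst ha'
    rw [e1, e2, neg_neg]
    have hf := jacobi_factor N m (by omega) β
    constructor
    · have h0 : jacobiPoly (N + m) (-(m : ℂ)) β ≠ 0 := by
        intro h; apply hnz; intro x; rw [h]; simp
      have hQ : ¬ (jacobiPoly N (m : ℂ) β).IsRoot 1 := by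
        rw [Polynomial.IsRoot, jacobi_eval_one_iff]
        rintro ⟨k, -, h⟩
        have : ((m + 1 + k : ℕ) : ℂ) = 0 := by push_cast; exact h
        rw [Nat.cast_eq_zero] at this
        omega
      generalize (ascPochhammer ℂ m).eval (((N + m : ℕ) : ℂ) + -(m : ℂ) + β + 1) *
        ((N.factorial : ℂ) / ((N + m).factorial : ℂ)) = c at hf
      have hf2 : jacobiPoly (N + m) (-(m : ℂ)) β =
          (Polynomial.C (c * 2⁻¹ ^ m) * jacobiPoly N (m : ℂ) β) *
            (Polynomial.X - Polynomial.C 1) ^ m := by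
        rw [hf, mul_pow, Polynomial.C_mul, Polynomial.C_pow, Polynomial.C_1]; ring
      have hc : c * 2⁻¹ ^ m ≠ 0 := by
        intro h; apply h0; rw [hf2, h]; simp
      have hne : Polynomial.C (c * 2⁻¹ ^ m) * jacobiPoly N (m : ℂ) β ≠ 0 := by
        intro h; apply h0; rw [hf2, h]; simp
      rw [hf2, Polynomial.rootMultiplicity_mul_X_sub_C_pow hne,
        Polynomial.rootMultiplicity_eq_zero, zero_add]
      rw [Polynomial.IsRoot, Polynomial.eval_mul, Polynomial.eval_C, mul_eq_zero]
      rintro (h | h)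
      · exact hc h
      · exact hQ h
    · intro x
      rw [hf]
      simp only [Polynomial.eval_mul, Polynomial.eval_C, Polynomial.eval_pow,
        Polynomial.eval_sub, Polynomial.eval_X, Polynomial.eval_one]
      rw [div_eq_mul_inv (x - 1) 2, mul_comm (x - 1)]
end

section
/- Let n ≥ 1 and let α, β be complex numbers such that P_n^{(α,β)} does not vanish identically in x. Then P_n^{(α,β)}(-1) = 0 if and only if β is an integer b with b ≤ -1 and n + b ≥ 0; and in that case the zero of P_n^{(α,β)} at x = -1 has multiplicity exactly -b, and P_n^{(α,β)}(x) = ((n+α+β+1)_{-b} · (n+b)! / n!) · ((x+1)/2)^{-b} · P_{n+b}^{(α, -β)}(x) for all complex x. -/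
open Polynomial Finset

theorem r_split (i j : ℕ) (a : ℂ) : (ascPochhammer ℂ (i+j)).eval a =
    (ascPochhammer ℂ i).eval a * (ascPochhammer ℂ j).eval (a + i) := by
  rw [← ascPochhammer_mul]; simp

theorem r_fact (i j : ℕ) : (ascPochhammer ℂ j).eval ((i : ℂ) + 1) * (i.factorial : ℂ) = ((i+j).factorial : ℂ) := by
  induction j with
  | zero => simp
  | succ j ih =>
    rw [ascPochhammer_succ_eval, ← add_assoc, Nat.factorial_succ]
    push_cast
    rw [← ih]; ring

theorem r_neg (N : ℕ) : ∀ a : ℂ, (ascPochhammer ℂ N).eval (-a) =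
    (-1)^N * (ascPochhammer ℂ N).eval (a - N + 1) := by
  induction N with
  | zero => simp
  | succ N ih =>
    intro a
    rw [ascPochhammer_succ_eval, ih, add_comm N 1, r_split 1 N]
    simp only [ascPochhammer_one, eval_X]
    push_cast
    rw [show a - (1 + (N:ℂ)) + 1 + 1 = a - N + 1 by ring]
    ring

theorem chu (N : ℕ) : ∀ a c : ℂ, ∑ ij ∈ antidiagonal N, (N.choose ij.1 : ℂ) *
    ((-1)^ij.1 * (ascPochhammer ℂ ij.1).eval a * (ascPochhammer ℂ ij.2).eval (c + ij.1)) =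
    (ascPochhammer ℂ N).eval (c - a) := by
  induction N with
  | zero => simp
  | succ N ih =>
    intro a c
    rw [Finset.sum_antidiagonal_choose_succ_mul (fun i j => (-1 : ℂ)^i * (ascPochhammer ℂ i).eval a * (ascPochhammer ℂ j).eval (c + i))]
    have h1 : ∑ ij ∈ antidiagonal N, (N.choose ij.1 : ℂ) *
      ((-1)^ij.1 * (ascPochhammer ℂ ij.1).eval a * (ascPochhammer ℂ (ij.2+1)).eval (c + ij.1)) = (c + N) * (ascPochhammer ℂ N).eval (c - a) := by
      rw [← ih, mul_sum]
      refine sum_congr rfl fun p hp => ?_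
      rw [HasAntidiagonal.mem_antidiagonal] at hp
      rw [ascPochhammer_succ_eval, ← hp]
      push_cast; ring
    have h2 : ∑ ij ∈ antidiagonal N, (N.choose ij.2 : ℂ) *
      ((-1)^(ij.1+1) * (ascPochhammer ℂ (ij.1+1)).eval a * (ascPochhammer ℂ (ij.2)).eval (c + (ij.1+1 : ℕ))) = -a * (ascPochhammer ℂ N).eval (c - a) := by
      rw [show c - a = (c+1) - (a+1) by ring, ← ih, mul_sum]
      refine sum_congr rfl fun p hp => ?_
      rw [HasAntidiagonal.mem_antidiagonal] at hp
      rw [← Nat.choose_symm_of_eq_add (hp.symm), add_comm p.1 1, r_split 1 p.1]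
      simp only [ascPochhammer_one, eval_X]
      push_cast
      rw [← add_assoc c]; ring
    rw [h1, h2, ascPochhammer_succ_eval]; ring

theorem jeval (n : ℕ) (α β x : ℂ) : (jacobiPoly n α β).eval x = ∑ k ∈ range (n+1),
   (((ascPochhammer ℂ k).eval ((n : ℂ) + α + β + 1) *
        (ascPochhammer ℂ (n - k)).eval (α + (k : ℂ) + 1)) /
      ((k.factorial : ℂ) * ((n - k).factorial : ℂ))) * ((x-1)/2)^k := by
  simp [jacobiPoly, eval_finsetSum, div_eq_inv_mul (x-1)]

theorem jsymm (n : ℕ) (α β x : ℂ) : (jacobiPoly n α β).eval x = ∑ j ∈ range (n+1),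
   (-1)^(n-j) * (((ascPochhammer ℂ j).eval ((n : ℂ) + α + β + 1) *
        (ascPochhammer ℂ (n - j)).eval (β + (j : ℂ) + 1)) /
      ((j.factorial : ℂ) * ((n - j).factorial : ℂ))) * ((x+1)/2)^j := by
  rw [jeval]
  have hz : (x-1)/2 = (x+1)/2 + (-1) := by ring
  rw [hz]
  generalize (x+1)/2 = z
  simp only [add_pow, mul_sum]
  rw [sum_comm' (t' := range (n+1)) (s' := fun j => Ico j (n+1)) (by
    intro a b; simp only [mem_range, mem_Ico]; omega)]
  refine sum_congr rfl fun j hj => ?_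
  have hj : j ≤ n := by simpa [Nat.lt_succ_iff] using hj
  obtain ⟨N, rfl⟩ := Nat.exists_eq_add_of_le hj
  rw [sum_Ico_eq_sum_range, show j + N + 1 - j = N + 1 by omega, show j + N - j = N by omega]
  have key := chu N (((j+N : ℕ) : ℂ) + α + β + 1 + j) (α + j + 1)
  rw [show α + j + 1 - (((j+N : ℕ) : ℂ) + α + β + 1 + j) = -(β + j + N) by push_cast; ring, r_neg,
    show β + j + N - N + 1 = β + j + 1 by ring, Nat.sum_antidiagonal_eq_sum_range_succ_mk] at key
  generalize ((j+N : ℕ) : ℂ) + α + β + 1 = s at *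
  rw [show (-1)^N * (((ascPochhammer ℂ j).eval s * (ascPochhammer ℂ N).eval (β + j + 1)) / ((j.factorial : ℂ) * (N.factorial : ℂ))) * z^j = ((-1)^N * (ascPochhammer ℂ N).eval (β + j + 1)) * ((ascPochhammer ℂ j).eval s / ((j.factorial : ℂ) * (N.factorial : ℂ)) * z^j) by ring, ← key, sum_mul]
  refine sum_congr rfl fun i hi => ?_
  have hi : i ≤ N := by simpa [Nat.lt_succ_iff] using hi
  rw [Nat.cast_choose ℂ hi, Nat.cast_choose ℂ (show j ≤ j + i by omega), r_split j i,
    show j + N - (j + i) = N - i by omega, show j + i - j = i by omega]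
  have f1 := fun k : ℕ => (Nat.cast_ne_zero (R := ℂ)).2 k.factorial_ne_zero
  have := f1 i; have := f1 j; have := f1 N; have := f1 (N-i); have := f1 (j+i)
  rw [show α + ((j + i : ℕ) : ℂ) + 1 = α + j + 1 + i by push_cast; ring]
  field_simp

theorem jneg1 (n : ℕ) (α β : ℂ) : (jacobiPoly n α β).eval (-1) =
    (-1)^n * (ascPochhammer ℂ n).eval (β + 1) / (n.factorial : ℂ) := by
  rw [jsymm, sum_range_succ']
  simp
  ring

theorem jfac (m p : ℕ) (α x : ℂ) : (jacobiPoly (m+p) α (-(m:ℂ))).eval x =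
    (ascPochhammer ℂ m).eval (((m+p:ℕ) : ℂ) + α + (-(m:ℂ)) + 1) *
            ((p.factorial : ℂ) / ((m+p).factorial : ℂ)) *
            ((x + 1) / 2) ^ m * (jacobiPoly p α m).eval x := by
  rw [jsymm, jsymm, add_assoc m p 1, sum_range_add, sum_eq_zero, zero_add, mul_sum]
  · refine sum_congr rfl fun j hj => ?_
    have hj : j ≤ p := by simpa [Nat.lt_succ_iff] using hj
    obtain ⟨q, rfl⟩ := Nat.exists_eq_add_of_le hj
    rw [show m + (j+q) - (m+j) = q by omega, show j + q - j = q by omega, r_split m j]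
    have h1 := r_fact j q
    have h2 := r_fact (m+j) q
    rw [show -(m:ℂ) + ((m+j : ℕ) : ℂ) + 1 = j + 1 by push_cast; ring,
     show ((m+(j+q) : ℕ) : ℂ) + α + -(m:ℂ) + 1 + m = ((j+q : ℕ) : ℂ) + α + m + 1 by push_cast; ring,
     ← h1, ← add_assoc m, ← h2]
    rw [show ((m+j:ℕ):ℂ) + 1 = m + j + 1 by push_cast; ring] at *
    have f1 := fun k : ℕ => (Nat.cast_ne_zero (R := ℂ)).2 k.factorial_ne_zero
    have := f1 j; have := f1 q; have := f1 (m+j); have h3 := f1 (m+j+q)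
    rw [← h2] at h3
    have := left_ne_zero_of_mul h3
    rw [pow_add]
    field_simp
  · intro k hk
    have hk : k < m := by simpa using hk
    have : (ascPochhammer ℂ (m+p-k)).eval (-(m:ℂ) + k + 1) = 0 := by
      rw [ascPochhammer_eval_eq_zero_iff]
      refine ⟨m - k - 1, by omega, ?_⟩
      rw [Nat.sub_sub, Nat.cast_sub (by omega)]; push_cast; ring
    rw [this]; simp

theorem stmt9 (n : ℕ) (hn : 1 ≤ n) (α β : ℂ)
    (hnz : ¬ ∀ x : ℂ, (jacobiPoly n α β).eval x = 0) :
    ((jacobiPoly n α β).eval (-1) = 0 ↔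
      ∃ b : ℤ, β = (b : ℂ) ∧ b ≤ -1 ∧ 0 ≤ (n : ℤ) + b) ∧
    ∀ b : ℤ, β = (b : ℂ) → b ≤ -1 → 0 ≤ (n : ℤ) + b →
      (jacobiPoly n α β).rootMultiplicity (-1) = (-b).toNat ∧
      ∀ x : ℂ,
        (jacobiPoly n α β).eval x =
          (ascPochhammer ℂ (-b).toNat).eval ((n : ℂ) + α + β + 1) *
            ((((n : ℤ) + b).toNat.factorial : ℂ) / (n.factorial : ℂ)) *
            ((x + 1) / 2) ^ (-b).toNat *
            (jacobiPoly ((n : ℤ) + b).toNat α (-β)).eval x := by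
  have f1 := fun k : ℕ => (Nat.cast_ne_zero (R := ℂ)).2 k.factorial_ne_zero
  constructor
  · have : (jacobiPoly n α β).eval (-1) = 0 ↔ (ascPochhammer ℂ n).eval (β + 1) = 0 := by
      rw [jneg1]; simp [f1 n, Nat.factorial_ne_zero]
    rw [this, ascPochhammer_eval_eq_zero_iff]
    constructor
    · rintro ⟨k, hk, h⟩
      refine ⟨-k - 1, ?_, by omega, by omega⟩
      push_cast; linear_combination h
    · rintro ⟨b, rfl, h1, h2⟩
      obtain ⟨k, hk⟩ := Int.eq_ofNat_of_zero_le (show 0 ≤ -b - 1 by omega)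
      refine ⟨k, by omega, ?_⟩
      rw [show b = -k - 1 by omega]; push_cast; ring
  · intro b hb h1 h2
    obtain ⟨m, hm⟩ := Int.eq_ofNat_of_zero_le (show 0 ≤ -b by omega)
    obtain ⟨p, hp⟩ := Int.eq_ofNat_of_zero_le h2
    obtain rfl : n = m + p := by omega
    obtain rfl : b = -m := by omega
    obtain rfl : β = -(m:ℂ) := by rw [hb]; push_cast; ring
    rw [hp]
    simp only [neg_neg, Int.toNat_natCast]
    have fac := jfac m p α
    refine ⟨?_, fac⟩
    set c := (ascPochhammer ℂ m).eval (((m+p:ℕ) : ℂ) + α + (-(m:ℂ)) + 1) *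
            ((p.factorial : ℂ) / ((m+p).factorial : ℂ)) with hc
    have hc0 : c ≠ 0 := by
      intro h; apply hnz; intro x; rw [fac, h]; simp
    have hq : (jacobiPoly p α m).eval (-1) ≠ 0 := by
      rw [jneg1]
      have := r_fact m p
      have h3 := f1 (m+p)
      rw [← this] at h3
      have := left_ne_zero_of_mul h3
      have := f1 p
      exact div_ne_zero (mul_ne_zero (by simp) (by assumption)) (by assumption)
    have hpoly : jacobiPoly (m+p) α (-(m:ℂ)) = (C (c / 2^m) * jacobiPoly p α m) * (X - C (-1))^m := by
      apply Polynomial.funext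
      intro x
      rw [fac]
      simp [div_pow]; ring
    have hA : (C (c / 2^m) * jacobiPoly p α m).eval (-1) ≠ 0 := by
      simp [hc0, hq]
    have hA0 : C (c / 2^m) * jacobiPoly p α m ≠ 0 := by
      intro h; rw [h] at hA; simp at hA
    rw [hpoly, rootMultiplicity_mul_X_sub_C_pow hA0, rootMultiplicity_eq_zero hA, zero_add]
end

section
/- Let a and b be integers with a ≥ 1 and b ≥ 1, and let n be a natural number with n ≥ a + b. Then for all complex x, P_n^{(-a,-b)}(x) = ((x-1)/2)^a · ((x+1)/2)^b · P_{n-a-b}^{(a,b)}(x). -/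
lemma aux_inner (N k : ℕ) (h : k ≤ N) (t : ℂ) :
    ∑ j ∈ Finset.range (N + 1), (N.choose j : ℂ) * (j.choose k : ℂ) * t ^ j
      = (N.choose k : ℂ) * t ^ k * (1 + t) ^ (N - k) := by
  obtain ⟨r, rfl⟩ := Nat.exists_eq_add_of_le h
  rw [add_assoc, Finset.sum_range_add, Finset.sum_eq_zero, zero_add, Nat.add_sub_cancel_left,
    add_comm 1 t, add_pow, Finset.mul_sum]
  · apply Finset.sum_congr rfl
    intro j hj
    have hj' : j ≤ r := by simpa [Nat.lt_succ_iff] using hj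
    have := Nat.choose_mul (n := k + r) (k := k + j) (s := k) (by omega)
    rw [Nat.add_sub_cancel_left, Nat.add_sub_cancel_left] at this
    have h2 : ((k+r).choose (k+j) : ℂ) * ((k+j).choose k : ℂ)
      = ((k+r).choose k : ℂ) * (r.choose j : ℂ) := by exact_mod_cast this
    rw [h2, pow_add]
    ring
  · intro j hj
    rw [Nat.choose_eq_zero_of_lt (Finset.mem_range.1 hj)]
    simp

lemma aux_inner2 (m k : ℕ) (h : k ≤ m) (t : ℂ) :
    t ^ k * (1 + t) ^ (m - k)
      = ∑ i ∈ Finset.range (m + 1), ((m - k).choose (m - i) : ℂ) * t ^ i := by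
  obtain ⟨r, rfl⟩ := Nat.exists_eq_add_of_le h
  rw [add_assoc, Finset.sum_range_add, Finset.sum_eq_zero, zero_add, Nat.add_sub_cancel_left,
    add_comm 1 t, add_pow, Finset.mul_sum]
  · apply Finset.sum_congr rfl
    intro j hj
    have hj' : j ≤ r := by simpa [Nat.lt_succ_iff] using hj
    rw [show k + r - (k + j) = r - j by omega, Nat.choose_symm hj', pow_add]
    ring
  · intro j hj
    have := Finset.mem_range.1 hj
    rw [Nat.choose_eq_zero_of_lt (by omega)]
    simp

lemma vand (p q i : ℕ) : ((p + q).choose i : ℂ)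
    = ∑ k ∈ Finset.range (i + 1), (p.choose k : ℂ) * (q.choose (i - k) : ℂ) := by
  rw [Nat.add_choose_eq, Finset.Nat.sum_antidiagonal_eq_sum_range_succ_mk]
  push_cast
  rfl

lemma step1 (N M m : ℕ) (h : m ≤ N) (t : ℂ) :
    ∑ j ∈ Finset.range (N + 1), (N.choose j : ℂ) * ((M + j).choose m : ℂ) * t ^ j
     = ∑ k ∈ Finset.range (m + 1), (M.choose (m - k) : ℂ) *
        ((N.choose k : ℂ) * t ^ k * (1 + t) ^ (N - k)) := by
  have : ∀ k ∈ Finset.range (m + 1), (M.choose (m - k) : ℂ) *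
        ((N.choose k : ℂ) * t ^ k * (1 + t) ^ (N - k)) =
      ∑ j ∈ Finset.range (N + 1),
        (M.choose (m - k) : ℂ) * ((N.choose j : ℂ) * (j.choose k : ℂ) * t ^ j) := by
    intro k hk
    have := Finset.mem_range.1 hk
    rw [← aux_inner N k (by omega) t, Finset.mul_sum]
  rw [Finset.sum_congr rfl this, Finset.sum_comm]
  apply Finset.sum_congr rfl
  intro j _
  rw [add_comm M j, vand, Finset.mul_sum, Finset.sum_mul]
  apply Finset.sum_congr rfl
  intro k _
  ring

lemma coef (a b m i : ℕ) (h : i ≤ m) :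
    ((m + a + b + i).choose i : ℂ) * ((m + a).choose (m - i) : ℂ) =
    ∑ k ∈ Finset.range (m + 1), ((m + a).choose (m - k) : ℂ) * ((m + b).choose k : ℂ) *
      ((m - k).choose (m - i) : ℂ) := by
  rw [show m + a + b + i = (m + b) + (a + i) by ring, vand, Finset.sum_mul]
  have hs : Finset.range (i + 1) ⊆ Finset.range (m + 1) := by
    apply Finset.range_subset_range.2; omega
  rw [← Finset.sum_subset hs]
  · apply Finset.sum_congr rfl
    intro k hk
    have hk' := Finset.mem_range.1 hk
    have := Nat.choose_mul (n := m + a) (k := m - k) (s := m - i) (by omega)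
    rw [show m + a - (m - i) = a + i by omega, show m - k - (m - i) = i - k by omega] at this
    have h2 : ((m + a).choose (m - k) : ℂ) * ((m - k).choose (m - i) : ℂ) =
      ((m + a).choose (m - i) : ℂ) * ((a + i).choose (i - k) : ℂ) := by exact_mod_cast this
    linear_combination (-((m + b).choose k : ℂ)) * h2
  · intro k hk hk'
    simp only [Finset.mem_range] at hk hk'
    rw [Nat.choose_eq_zero_of_lt (show m - k < m - i by omega)]
    simp

lemma main_id (a b m : ℕ) (t : ℂ) :
    ∑ j ∈ Finset.range (m + b + 1), ((m + b).choose j : ℂ) * ((m + a + j).choose m : ℂ) * t ^ j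
     = (1 + t) ^ b * ∑ i ∈ Finset.range (m + 1),
        ((m + a + b + i).choose i : ℂ) * ((m + a).choose (m - i) : ℂ) * t ^ i := by
  rw [step1 _ _ _ (by omega)]
  have : ∀ k ∈ Finset.range (m + 1), ((m + a).choose (m - k) : ℂ) *
        (((m + b).choose k : ℂ) * t ^ k * (1 + t) ^ (m + b - k)) =
      (1 + t) ^ b * ∑ i ∈ Finset.range (m + 1), ((m + a).choose (m - k) : ℂ) *
        ((m + b).choose k : ℂ) * ((m - k).choose (m - i) : ℂ) * t ^ i := by
    intro k hk
    have := Finset.mem_range.1 hk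
    simp_rw [mul_assoc (((m + a).choose (m - k) : ℂ) * ((m + b).choose k : ℂ))]
    rw [← Finset.mul_sum, ← aux_inner2 m k (by omega), show m + b - k = (m - k) + b by omega,
      pow_add]
    ring
  rw [Finset.sum_congr rfl this, ← Finset.mul_sum, Finset.sum_comm]
  congr 1
  apply Finset.sum_congr rfl
  intro i hi
  have := Finset.mem_range.1 hi
  rw [coef a b m i (by omega), Finset.sum_mul]

lemma poch (p k : ℕ) : (ascPochhammer ℂ k).eval ((p : ℂ) + 1) = ((p + k).factorial : ℂ) / (p.factorial : ℂ) := by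
  have hp : (p.factorial : ℂ) ≠ 0 := by exact_mod_cast p.factorial_ne_zero
  rw [eq_div_iff hp]
  have h := ascPochhammer_nat_eq_natCast_ascFactorial ℂ (p + 1) k
  push_cast at h
  rw [h, ← Nat.factorial_mul_ascFactorial p k]
  push_cast
  ring

lemma ch (p q : ℕ) : ((p + q).choose p : ℂ) = ((p + q).factorial : ℂ) / (p.factorial * q.factorial) := by
  exact Nat.cast_add_choose ℂ

lemma nat_version (a b m : ℕ) (x : ℂ) :
    jacobiP (a + b + m) (-(a : ℂ)) (-(b : ℂ)) x
      = ((x - 1) / 2) ^ a * ((x + 1) / 2) ^ b * jacobiP m (a : ℂ) (b : ℂ) x := by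
  have f0 : ∀ p : ℕ, (p.factorial : ℂ) ≠ 0 := fun p => by exact_mod_cast p.factorial_ne_zero
  unfold jacobiP
  rw [show (x + 1) / 2 = 1 + (x - 1) / 2 by ring]
  generalize (x - 1) / 2 = t
  have hR : ∀ i ∈ Finset.range (m + 1),
      ((ascPochhammer ℂ i).eval ((m : ℂ) + a + b + 1) *
        (ascPochhammer ℂ (m - i)).eval ((a : ℂ) + (i : ℂ) + 1)) /
      ((i.factorial : ℂ) * ((m - i).factorial : ℂ)) * t ^ i =
      ((m + a + b + i).choose i : ℂ) * ((m + a).choose (m - i) : ℂ) * t ^ i := by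
    intro i hi
    obtain ⟨r, rfl⟩ := Nat.exists_eq_add_of_le (Nat.lt_succ_iff.1 (Finset.mem_range.1 hi))
    have h1 := poch (i + r + a + b) i
    have h2 := poch (a + i) r
    push_cast at h1 h2 ⊢
    rw [Nat.add_sub_cancel_left, h1, h2, add_comm (i + r + a + b) i, ch,
      show i + r + a = r + (a + i) by ring, ch, show a + i + r = r + (a + i) by ring]
    have := f0 (r + (a + i) + b)
    have := f0 (a + i)
    have := f0 i
    have := f0 r
    field_simp
  rw [Finset.sum_congr rfl hR, mul_assoc, ← main_id,
    show a + b + m + 1 = a + (m + b + 1) by ring, Finset.sum_range_add, Finset.sum_eq_zero,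
    zero_add, Finset.mul_sum]
  · apply Finset.sum_congr rfl
    intro j hj
    obtain ⟨r, hr⟩ := Nat.exists_eq_add_of_le (Nat.lt_succ_iff.1 (Finset.mem_range.1 hj))
    have h1 := poch m (a + j)
    have h2 := poch j r
    rw [show a + b + m - (a + j) = r by omega,
      show ((a + b + m : ℕ) : ℂ) + -(a : ℂ) + -(b : ℂ) + 1 = (m : ℂ) + 1 by push_cast; ring,
      show -(a : ℂ) + ((a + j : ℕ) : ℂ) + 1 = (j : ℂ) + 1 by push_cast; ring, h1, h2, hr, ch,
      show m + a + j = m + (a + j) by ring, ch, pow_add]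
    have := f0 m
    have := f0 (a + j)
    have := f0 j
    have := f0 r
    field_simp
  · intro k hk
    have hk := Finset.mem_range.1 hk
    obtain ⟨r, rfl⟩ := Nat.exists_eq_add_of_lt hk
    have := ascPochhammer_eval_neg_coe_nat_of_lt (R := ℂ) (n := k + r + 1 + b + m - k) (k := r)
      (by omega)
    rw [show -((k + r + 1 : ℕ) : ℂ) + (k : ℂ) + 1 = -(r : ℂ) by push_cast; ring, this]
    simp

theorem stmt10 (a b : ℤ) (ha : 1 ≤ a) (hb : 1 ≤ b) (n : ℕ) (hn : a + b ≤ (n : ℤ)) (x : ℂ) :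
    jacobiP n (-(a : ℂ)) (-(b : ℂ)) x
      = ((x - 1) / 2) ^ a.toNat * ((x + 1) / 2) ^ b.toNat *
        jacobiP ((n : ℤ) - a - b).toNat (a : ℂ) (b : ℂ) x := by
  lift a to ℕ using by omega
  lift b to ℕ using by omega
  obtain ⟨m, rfl⟩ := Nat.exists_eq_add_of_le (show a + b ≤ n by omega)
  have := nat_version a b m x
  rw [show (((a + b + m : ℕ) : ℤ) - a - b).toNat = m by omega]
  simpa using this
end

section
/- For every natural number n, all complex parameters α₁, β₁, α₂, β₂ and every complex x, one has Σ_{k=0}^{n} P_{n-k}^{(α₁,β₁)}(x) · P_k^{(α₂,β₂)}(x) = Σ_{k=0}^{n} P_{n-k}^{(0,0)}(x) · P_k^{(α₁+α₂, β₁+β₂)}(x). -/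
namespace JacAux

open Polynomial

noncomputable def po (k : ℕ) (p : ℂ) : ℂ := (ascPochhammer ℂ k).eval p

lemma po_zero (p : ℂ) : po 0 p = 1 := by simp [po]

lemma po_right (k : ℕ) (p : ℂ) : po (k+1) p = po k p * (p + k) := by
  simp [po, ascPochhammer_succ_eval]

lemma po_left (k : ℕ) (p : ℂ) : po (k+1) p = p * po k (p + 1) := by
  simp [po, ascPochhammer_succ_left, Polynomial.eval_comp]

noncomputable def cc (n : ℕ) (a b : ℂ) (k : ℕ) : ℂ :=
  if k ≤ n then po k ((n:ℂ) + a + b + 1) * po (n - k) (a + k + 1) /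
    ((k.factorial : ℂ) * ((n - k).factorial : ℂ)) else 0

lemma jac_eq (n : ℕ) (a b x : ℂ) :
    jacobiP n a b x = ∑ k ∈ Finset.range (n+1), cc n a b k * ((x-1)/2)^k := by
  unfold jacobiP
  apply Finset.sum_congr rfl
  intro k hk
  have : k ≤ n := by simpa [Nat.lt_succ_iff] using hk
  simp [cc, this, po]

lemma jac_eq' (n : ℕ) (a b x : ℂ) :
    jacobiP n a b x = ∑ k ∈ Finset.range (n+1), cc n a b (k+1) * ((x-1)/2)^(k+1) + cc n a b 0 := by
  rw [jac_eq]
  have : cc n a b (n+1) = 0 := by simp [cc]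
  have h := Finset.sum_range_succ (fun k => cc n a b k * ((x-1)/2)^k) (n+1)
  rw [this, zero_mul, add_zero] at h
  rw [← h, Finset.sum_range_succ']
  simp

lemma jac_eq'' (n : ℕ) (a b x : ℂ) :
    jacobiP (n+1) a b x =
      ∑ k ∈ Finset.range (n+1), cc (n+1) a b (k+1) * ((x-1)/2)^(k+1) + cc (n+1) a b 0 := by
  rw [jac_eq, Finset.sum_range_succ']
  simp

lemma jac_mul (n : ℕ) (a b x : ℂ) :
    ((x-1)/2) * jacobiP n a b x =
      ∑ k ∈ Finset.range (n+1), cc n a b k * ((x-1)/2)^(k+1) := by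
  rw [jac_eq, Finset.mul_sum]
  apply Finset.sum_congr rfl
  intro k _
  ring

lemma c1_zero (n : ℕ) (a b : ℂ) :
    cc (n+1) a b 0 = cc (n+1) (a+1) b 0 - cc n (a+1) b 0 := by
  simp only [cc, Nat.zero_le, if_true, po_zero, Nat.sub_zero]
  rw [po_left n, po_right n, Nat.factorial_succ]
  have : (n.factorial : ℂ) ≠ 0 := by exact_mod_cast n.factorial_ne_zero
  have h2 : ((n : ℂ) + 1) ≠ 0 := by exact_mod_cast n.succ_ne_zero
  have e : a + ((0:ℕ):ℂ) + 1 + 1 = a + 1 + ((0:ℕ):ℂ) + 1 := by ring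
  rw [e]
  push_cast
  field_simp
  ring

lemma c1_succ (n k : ℕ) (hk : k ≤ n) (a b : ℂ) :
    cc (n+1) a b (k+1) = cc (n+1) (a+1) b (k+1) - cc n (a+1) b (k+1) - cc n (a+2) b k := by
  obtain ⟨m, rfl⟩ := Nat.exists_eq_add_of_le hk
  have hk' : (k.factorial : ℂ) ≠ 0 := by exact_mod_cast k.factorial_ne_zero
  have h2 : ((k : ℂ) + 1) ≠ 0 := by exact_mod_cast k.succ_ne_zero
  rcases m with _ | m
  · simp only [cc, Nat.add_zero, le_refl, if_true, Nat.sub_self, po_zero]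
    rw [if_neg (by omega), po_left k, po_right k, Nat.factorial_succ]
    have e1 : ((k+1:ℕ):ℂ) + a + b + 1 + 1 = k + a + b + 3 := by push_cast; ring
    have e2 : ((k+1:ℕ):ℂ) + (a+1) + b + 1 = k + a + b + 3 := by push_cast; ring
    have e3 : (k:ℂ) + (a+2) + b + 1 = k + a + b + 3 := by push_cast; ring
    rw [e1, e2, e3]
    push_cast
    simp only [Nat.factorial_zero, Nat.cast_one]
    field_simp
    ring
  · have hm : (m.factorial : ℂ) ≠ 0 := by exact_mod_cast m.factorial_ne_zero
    have h3 : ((m : ℂ) + 1) ≠ 0 := by exact_mod_cast m.succ_ne_zero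
    simp only [cc]
    rw [if_pos (by omega), if_pos (by omega), if_pos (by omega), if_pos (by omega)]
    have i1 : k + (m+1) + 1 - (k+1) = m + 1 := by omega
    have i2 : k + (m+1) - (k+1) = m := by omega
    have i3 : k + (m+1) - k = m + 1 := by omega
    rw [i1, i2, i3]
    have e0 : ((k+(m+1)+1:ℕ):ℂ) + a + b + 1 = k + m + a + b + 3 := by push_cast; ring
    have e1 : ((k+(m+1)+1:ℕ):ℂ) + (a+1) + b + 1 = k + m + a + b + 4 := by push_cast; ring
    have e2 : ((k+(m+1):ℕ):ℂ) + (a+1) + b + 1 = k + m + a + b + 3 := by push_cast; ring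
    have e3 : ((k+(m+1):ℕ):ℂ) + (a+2) + b + 1 = k + m + a + b + 4 := by push_cast; ring
    have f0 : a + ((k+1:ℕ):ℂ) + 1 = a + k + 2 := by push_cast; ring
    have f1 : a + 1 + ((k+1:ℕ):ℂ) + 1 = a + k + 3 := by push_cast; ring
    have f2 : a + 2 + (k:ℂ) + 1 = a + k + 3 := by ring
    rw [e0, e1, e2, e3, f0, f1, f2, po_left k, po_right k, po_left m, po_right m,
      Nat.factorial_succ k, Nat.factorial_succ m]
    have g0 : (k + m + a + b + 3 + 1 : ℂ) = k + m + a + b + 4 := by ring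
    have g1 : (a + k + 2 + 1 : ℂ) = a + k + 3 := by ring
    rw [g0, g1]
    push_cast
    field_simp
    ring

lemma c2_zero (n : ℕ) (a b : ℂ) :
    cc (n+1) a b 0 = cc (n+1) a (b+1) 0 + cc n a (b+1) 0 - cc n a (b+2) 0 := by
  simp only [cc, Nat.zero_le, if_true, po_zero, Nat.sub_zero]
  ring

lemma c2_succ (n k : ℕ) (hk : k ≤ n) (a b : ℂ) :
    cc (n+1) a b (k+1) = cc (n+1) a (b+1) (k+1) + cc n a (b+1) (k+1)
      - cc n a (b+2) (k+1) - cc n a (b+2) k := by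
  obtain ⟨m, rfl⟩ := Nat.exists_eq_add_of_le hk
  have hk' : (k.factorial : ℂ) ≠ 0 := by exact_mod_cast k.factorial_ne_zero
  have h2 : ((k : ℂ) + 1) ≠ 0 := by exact_mod_cast k.succ_ne_zero
  rcases m with _ | m
  · simp only [cc, Nat.add_zero, le_refl, if_true, Nat.sub_self, po_zero]
    rw [if_neg (by omega), if_neg (by omega), po_left k, po_right k, Nat.factorial_succ]
    have e1 : ((k+1:ℕ):ℂ) + a + b + 1 + 1 = k + a + b + 3 := by push_cast; ring
    have e2 : ((k+1:ℕ):ℂ) + a + (b+1) + 1 = k + a + b + 3 := by push_cast; ring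
    have e3 : (k:ℂ) + a + (b+2) + 1 = k + a + b + 3 := by push_cast; ring
    rw [e1, e2, e3]
    push_cast
    simp only [Nat.factorial_zero, Nat.cast_one]
    field_simp
    ring
  · have hm : (m.factorial : ℂ) ≠ 0 := by exact_mod_cast m.factorial_ne_zero
    have h3 : ((m : ℂ) + 1) ≠ 0 := by exact_mod_cast m.succ_ne_zero
    simp only [cc]
    rw [if_pos (by omega), if_pos (by omega), if_pos (by omega), if_pos (by omega),
      if_pos (by omega)]
    have i1 : k + (m+1) + 1 - (k+1) = m + 1 := by omega
    have i2 : k + (m+1) - (k+1) = m := by omega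
    have i3 : k + (m+1) - k = m + 1 := by omega
    rw [i1, i2, i3]
    have e0 : ((k+(m+1)+1:ℕ):ℂ) + a + b + 1 = k + m + a + b + 3 := by push_cast; ring
    have e1 : ((k+(m+1)+1:ℕ):ℂ) + a + (b+1) + 1 = k + m + a + b + 4 := by push_cast; ring
    have e2 : ((k+(m+1):ℕ):ℂ) + a + (b+1) + 1 = k + m + a + b + 3 := by push_cast; ring
    have e3 : ((k+(m+1):ℕ):ℂ) + a + (b+2) + 1 = k + m + a + b + 4 := by push_cast; ring
    have f0 : a + ((k+1:ℕ):ℂ) + 1 = a + k + 2 := by push_cast; ring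
    rw [e0, e1, e2, e3, f0, po_left k, po_right k, po_right m (a+k+2), po_left m (a+k+1),
      Nat.factorial_succ k, Nat.factorial_succ m]
    have g0 : (k + m + a + b + 3 + 1 : ℂ) = k + m + a + b + 4 := by ring
    have g1 : (a + k + 1 + 1 : ℂ) = a + k + 2 := by ring
    rw [g0, g1]
    push_cast
    field_simp
    ring

lemma jac1 (n : ℕ) (a b x : ℂ) :
    jacobiP (n+1) a b x = jacobiP (n+1) (a+1) b x - jacobiP n (a+1) b x
      - ((x-1)/2) * jacobiP n (a+2) b x := by
  rw [jac_eq'', jac_eq'', jac_eq', jac_mul, c1_zero]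
  have : ∑ k ∈ Finset.range (n+1), cc (n+1) a b (k+1) * ((x-1)/2)^(k+1) =
      ∑ k ∈ Finset.range (n+1), cc (n+1) (a+1) b (k+1) * ((x-1)/2)^(k+1)
      - ∑ k ∈ Finset.range (n+1), cc n (a+1) b (k+1) * ((x-1)/2)^(k+1)
      - ∑ k ∈ Finset.range (n+1), cc n (a+2) b k * ((x-1)/2)^(k+1) := by
    rw [← Finset.sum_sub_distrib, ← Finset.sum_sub_distrib]
    apply Finset.sum_congr rfl
    intro k hk
    rw [c1_succ n k (by simpa [Nat.lt_succ_iff] using hk)]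
    ring
  rw [this]
  ring

lemma jac2 (n : ℕ) (a b x : ℂ) :
    jacobiP (n+1) a b x = jacobiP (n+1) a (b+1) x + jacobiP n a (b+1) x
      - (1 + (x-1)/2) * jacobiP n a (b+2) x := by
  rw [add_mul, one_mul, jac_mul, jac_eq'', jac_eq'', jac_eq', jac_eq', c2_zero]
  have : ∑ k ∈ Finset.range (n+1), cc (n+1) a b (k+1) * ((x-1)/2)^(k+1) =
      ∑ k ∈ Finset.range (n+1), cc (n+1) a (b+1) (k+1) * ((x-1)/2)^(k+1)
      + ∑ k ∈ Finset.range (n+1), cc n a (b+1) (k+1) * ((x-1)/2)^(k+1)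
      - ∑ k ∈ Finset.range (n+1), cc n a (b+2) (k+1) * ((x-1)/2)^(k+1)
      - ∑ k ∈ Finset.range (n+1), cc n a (b+2) k * ((x-1)/2)^(k+1) := by
    rw [← Finset.sum_add_distrib, ← Finset.sum_sub_distrib, ← Finset.sum_sub_distrib]
    apply Finset.sum_congr rfl
    intro k hk
    rw [c2_succ n k (by simpa [Nat.lt_succ_iff] using hk)]
    ring
  rw [this]
  ring

lemma jac_zero (a b x : ℂ) : jacobiP 0 a b x = 1 := by simp [jacobiP]

noncomputable def F (x a b : ℂ) : PowerSeries ℂ := PowerSeries.mk fun n => jacobiP n a b x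

lemma F1 (x a b : ℂ) : F x a b = (1 - PowerSeries.X) * F x (a+1) b
    - PowerSeries.X * (PowerSeries.C ((x-1)/2) * F x (a+2) b) := by
  ext n
  rcases n with _ | n
  · simp [F, jac_zero, sub_mul]
  · simp only [sub_mul, one_mul, map_sub, PowerSeries.coeff_succ_X_mul, PowerSeries.coeff_C_mul]
    simp only [F, PowerSeries.coeff_mk]
    exact jac1 n a b x

lemma F2 (x a b : ℂ) : F x a b = (1 + PowerSeries.X) * F x a (b+1)
    - PowerSeries.X * (PowerSeries.C (1 + (x-1)/2) * F x a (b+2)) := by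
  ext n
  rcases n with _ | n
  · simp [F, jac_zero, add_mul]
  · simp only [add_mul (1 : PowerSeries ℂ), one_mul, map_sub, map_add (PowerSeries.coeff (n+1)),
      PowerSeries.coeff_succ_X_mul, PowerSeries.coeff_C_mul]
    simp only [F, PowerSeries.coeff_mk]
    exact jac2 n a b x

lemma caso (P Q : PowerSeries ℂ) (f g : ℂ → PowerSeries ℂ)
    (hf : ∀ z, f z = P * f (z+1) - PowerSeries.X * (Q * f (z+2)))
    (hg : ∀ z, g z = P * g (z+1) - PowerSeries.X * (Q * g (z+2))) (z w : ℂ) :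
    f (z+1) * g w = f z * g (w+1) := by
  have key : ∀ k : ℕ, ∀ z w : ℂ, PowerSeries.X ^ k ∣ f z * g (w+1) - f (z+1) * g w := by
    intro k
    induction k with
    | zero => intro z w; simp
    | succ k ih =>
      intro z w
      obtain ⟨c, hc⟩ := ih (z+1) (w+1)
      refine ⟨Q * c, ?_⟩
      have e : ∀ z : ℂ, z + 1 + 1 = z + 2 := fun z => by ring
      rw [e, e] at hc
      rw [hf z, hg w, pow_succ]
      linear_combination PowerSeries.X * Q * hc
  symm
  rw [← sub_eq_zero]
  ext n
  have := (PowerSeries.X_pow_dvd_iff.mp (key (n+1) z w)) n (Nat.lt_succ_self n)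
  simpa using this

def IsP (f : ℂ → ℂ) : Prop := ∃ p : ℂ[X], ∀ s, f s = p.eval s

lemma IsP.mul {f g : ℂ → ℂ} (hf : IsP f) (hg : IsP g) : IsP (fun s => f s * g s) := by
  obtain ⟨p, hp⟩ := hf
  obtain ⟨q, hq⟩ := hg
  exact ⟨p * q, fun s => by simp [hp, hq]⟩

lemma IsP.sum {ι : Type} (t : Finset ι) {f : ι → ℂ → ℂ} (hf : ∀ i, IsP (f i)) :
    IsP (fun s => ∑ i ∈ t, f i s) := by
  choose p hp using hf
  exact ⟨∑ i ∈ t, p i, fun s => by simp [hp, Polynomial.eval_finset_sum]⟩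

lemma IsP.jac (n : ℕ) (x a c b d : ℂ) :
    IsP (fun s => jacobiP n (a + c * s) (b + d * s) x) := by
  unfold jacobiP
  apply IsP.sum
  intro k
  refine ⟨((ascPochhammer ℂ k).comp (C (n:ℂ) + (C a + C c * X) + (C b + C d * X) + 1) *
    (ascPochhammer ℂ (n-k)).comp (C a + C c * X + C (k:ℂ) + 1)) *
    C (((k.factorial : ℂ) * ((n - k).factorial : ℂ))⁻¹ * ((x-1)/2)^k), fun s => ?_⟩
  simp only [eval_mul, eval_comp, eval_add, eval_C, eval_X, eval_one]
  rw [div_eq_mul_inv]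
  ring

lemma IsP.const {f : ℂ → ℂ} (hf : IsP f) (h : ∀ s, f (s+1) = f s) (s : ℂ) : f s = f 0 := by
  obtain ⟨p, hp⟩ := hf
  have h0 : ∀ m : ℕ, f m = f 0 := by
    intro m
    induction m with
    | zero => simp
    | succ m ih => push_cast; rw [h, ih]
  have : p = C (f 0) := by
    apply Polynomial.eq_of_infinite_eval_eq
    apply Set.Infinite.mono (s := Set.range (fun m : ℕ => (m : ℂ)))
    · rintro _ ⟨m, rfl⟩
      simp [← hp, h0]
    · exact Set.infinite_range_of_injective Nat.cast_injective
  rw [hp, this]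
  simp

lemma coeff_F (x a b c d : ℂ) (n : ℕ) : PowerSeries.coeff n (F x a b * F x c d) =
    ∑ k ∈ Finset.range (n + 1), jacobiP (n - k) a b x * jacobiP k c d x := by
  rw [mul_comm, PowerSeries.coeff_mul, Finset.Nat.sum_antidiagonal_eq_sum_range_succ_mk]
  simp [F, mul_comm]

lemma IsP.coeffF (n : ℕ) (x a a' b b' c c' d d' : ℂ) :
    IsP (fun s => PowerSeries.coeff n
      (F x (a + a' * s) (b + b' * s) * F x (c + c' * s) (d + d' * s))) := by
  simp only [coeff_F]
  apply IsP.sum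
  intro k
  exact (IsP.jac _ _ _ _ _ _).mul (IsP.jac _ _ _ _ _ _)

lemma shift1 (x a b c d : ℂ) : F x a b * F x c d = F x (a + c) b * F x 0 d := by
  ext n
  have h := (IsP.coeffF n x a 1 b 0 c (-1) d 0).const (by
    intro s
    have := caso _ _ (fun z => F x z b) (fun z => F x z d) (fun z => F1 x z b) (fun z => F1 x z d)
      (a + s) (c - s - 1)
    have e1 : a + 1 * (s+1) = a + s + 1 := by ring
    have e2 : c + -1 * (s+1) = c - s - 1 := by ring
    have e3 : c + -1 * s = c - s - 1 + 1 := by ring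
    rw [e1, e2, e3]
    simp only [zero_mul, add_zero, one_mul, this]) c
  simpa using h.symm

lemma shift2 (x a b c d : ℂ) : F x a b * F x c d = F x a (b + d) * F x c 0 := by
  ext n
  have h := (IsP.coeffF n x a 0 b 1 c 0 d (-1)).const (by
    intro s
    have := caso _ _ (fun z => F x a z) (fun z => F x c z) (fun z => F2 x a z) (fun z => F2 x c z)
      (b + s) (d - s - 1)
    have e1 : b + 1 * (s+1) = b + s + 1 := by ring
    have e2 : d + -1 * (s+1) = d - s - 1 := by ring
    have e3 : d + -1 * s = d - s - 1 + 1 := by ring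
    rw [e1, e2, e3]
    simp only [zero_mul, add_zero, one_mul, this]) d
  simpa using h.symm

end JacAux

theorem stmt12 (n : ℕ) (α₁ β₁ α₂ β₂ x : ℂ) :
    ∑ k ∈ Finset.range (n + 1), jacobiP (n - k) α₁ β₁ x * jacobiP k α₂ β₂ x
      = ∑ k ∈ Finset.range (n + 1),
          jacobiP (n - k) 0 0 x * jacobiP k (α₁ + α₂) (β₁ + β₂) x := by
  rw [← JacAux.coeff_F, ← JacAux.coeff_F, JacAux.shift1, JacAux.shift2, mul_comm]
end

section
/- For every natural number n, all complex ν, λ and every complex x, one has Σ_{k=0}^{n} C_k^{(ν)}(x) · C_{n-k}^{(λ)}(x) = C_n^{(ν+λ)}(x). -/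
/-- The Gegenbauer polynomial `C_n^{(λ)}(x)` for an arbitrary complex parameter,
defined by `C_n^{(λ)}(x) = ∑_{k=0}^{⌊n/2⌋} ((-1)^k (λ)_{n-k})/(k! (n-2k)!) (2x)^{n-2k}`. -/
noncomputable def gegenbauerC (n : ℕ) (l x : ℂ) : ℂ :=
  ∑ k ∈ Finset.range (n / 2 + 1),
    ((-1 : ℂ) ^ k * (ascPochhammer ℂ (n - k)).eval l) /
      ((k.factorial : ℂ) * ((n - 2 * k).factorial : ℂ)) * (2 * x) ^ (n - 2 * k)

lemma geg_multichoose (l : ℂ) (m : ℕ) :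
    Ring.choose (-l) m = (-1) ^ m * ((ascPochhammer ℂ m).eval l / (m.factorial : ℂ)) := by
  have h := Ring.factorial_nsmul_multichoose_eq_ascPochhammer l m
  rw [Polynomial.ascPochhammer_smeval_eq_eval, nsmul_eq_mul] at h
  have hm : (m.factorial : ℂ) ≠ 0 := by exact_mod_cast m.factorial_ne_zero
  rw [Ring.choose_neg', ← h, mul_div_cancel_left₀ _ hm]
  simp [Units.smul_def]

noncomputable def gegP (x : ℂ) : PowerSeries ℂ :=
  PowerSeries.X * ((Polynomial.X + Polynomial.C (-(2 * x)) : Polynomial ℂ) : PowerSeries ℂ)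

lemma gegP_hasSubst (x : ℂ) : PowerSeries.HasSubst (gegP x) :=
  PowerSeries.HasSubst.of_constantCoeff_zero' (by simp [gegP])

lemma gegP_coeff (x : ℂ) (n m : ℕ) :
    PowerSeries.coeff n (gegP x ^ m) =
      if m ≤ n then (-(2 * x)) ^ (m - (n - m)) * (m.choose (n - m) : ℂ) else 0 := by
  rw [gegP, mul_pow, PowerSeries.coeff_X_pow_mul', ← Polynomial.coe_pow, Polynomial.coeff_coe,
    Polynomial.coeff_X_add_C_pow]

lemma geg_coeff (n : ℕ) (l x : ℂ) :
    PowerSeries.coeff n ((PowerSeries.binomialSeries ℂ (-l)).subst (gegP x)) =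
      gegenbauerC n l x := by
  rw [PowerSeries.coeff_subst' (gegP_hasSubst x),
    finsum_eq_sum_of_support_subset (s := Finset.range (n + 1))]
  · rw [← Finset.sum_range_reflect, gegenbauerC]
    symm
    have hsub : Finset.range (n / 2 + 1) ⊆ Finset.range (n + 1) := by
      intro k hk
      simp only [Finset.mem_range] at *
      omega
    rw [← Finset.sum_subset hsub]
    · apply Finset.sum_congr rfl
      intro k hk
      simp only [Finset.mem_range] at hk
      obtain ⟨j, rfl⟩ : ∃ j, n = j + 2 * k := ⟨n - 2 * k, by omega⟩
      have e1 : j + 2 * k + 1 - 1 - k = j + k := by omega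
      have e2 : j + 2 * k - k = j + k := by omega
      have e3 : j + 2 * k - 2 * k = j := by omega
      have e4 : j + 2 * k - (j + k) = k := by omega
      have e5 : j + k - k = j := by omega
      rw [e1, e2, e3, gegP_coeff, e4, e5, if_pos (by omega), PowerSeries.binomialSeries_coeff,
        geg_multichoose, Nat.add_choose]
      rw [Nat.cast_div (Nat.factorial_mul_factorial_dvd_factorial_add j k)
        (by exact_mod_cast (Nat.mul_ne_zero j.factorial_ne_zero k.factorial_ne_zero))]
      have h1 : (k.factorial : ℂ) ≠ 0 := by exact_mod_cast k.factorial_ne_zero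
      have h2 : (j.factorial : ℂ) ≠ 0 := by exact_mod_cast j.factorial_ne_zero
      have h3 : ((j + k).factorial : ℂ) ≠ 0 := by exact_mod_cast (j + k).factorial_ne_zero
      have h4 : (-1 : ℂ) ^ j * (-1) ^ j = 1 := by rw [← mul_pow]; simp
      rw [neg_pow (2 * x) j, pow_add]
      simp only [smul_eq_mul, mul_one]
      push_cast
      field_simp
      linear_combination (-(ascPochhammer ℂ (j + k)).eval l * (2 * x) ^ j) * h4
    · intro k hk hk'
      simp only [Finset.mem_range] at hk hk'
      rw [gegP_coeff, Nat.choose_eq_zero_of_lt (by omega)]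
      simp
  · intro m hm
    by_contra hm'
    apply hm
    simp only [Finset.coe_range, Set.mem_Iio] at hm'
    simp only [gegP_coeff]
    rw [if_neg (by omega), smul_zero]

theorem stmt13 (n : ℕ) (ν lam x : ℂ) :
    ∑ k ∈ Finset.range (n + 1), gegenbauerC k ν x * gegenbauerC (n - k) lam x
      = gegenbauerC n (ν + lam) x := by
  rw [← geg_coeff, neg_add, PowerSeries.binomialSeries_add,
    PowerSeries.subst_mul (gegP_hasSubst x), PowerSeries.coeff_mul,
    Finset.Nat.sum_antidiagonal_eq_sum_range_succ_mk]
  simp only [geg_coeff]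
end

section
/- Define R_0(x) = 1, R_j(x) = 2·((x²-1)/4)^{j/2} for even j ≥ 2, and R_j(x) = x·((x²-1)/4)^{(j-1)/2} for odd j ≥ 1; define S_0(x) = 1 and S_j(x) = ((-1-x)/2)^j + ((1-x)/2)^j for j ≥ 1. Then for every natural number n and every complex x, Σ_{k=0}^{n} R_{n-k}(x) · S_k(x) = δ_{n,0}, where δ_{n,0} equals 1 if n = 0 and 0 otherwise. -/
/-- `R_j(x)`: `R_0(x) = 1`, `R_j(x) = 2 ((x²-1)/4)^{j/2}` for even `j ≥ 2`,
and `R_j(x) = x ((x²-1)/4)^{(j-1)/2}` for odd `j ≥ 1`. -/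
noncomputable def Rfun (j : ℕ) (x : ℂ) : ℂ :=
  if j = 0 then 1
  else if Even j then 2 * ((x ^ 2 - 1) / 4) ^ (j / 2)
  else x * ((x ^ 2 - 1) / 4) ^ ((j - 1) / 2)

/-- `S_j(x)`: `S_0(x) = 1` and `S_j(x) = ((-1-x)/2)^j + ((1-x)/2)^j` for `j ≥ 1`. -/
noncomputable def Sfun (j : ℕ) (x : ℂ) : ℂ :=
  if j = 0 then 1 else ((-1 - x) / 2) ^ j + ((1 - x) / 2) ^ j

theorem Rfun_step (j : ℕ) (x : ℂ) :
    Rfun (j + 3) x = ((x ^ 2 - 1) / 4) * Rfun (j + 1) x := by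
  unfold Rfun
  have h1 : (j + 3) / 2 = (j + 1) / 2 + 1 := by omega
  have h2 : (j + 3 - 1) / 2 = (j + 1 - 1) / 2 + 1 := by omega
  have h3 : Even (j + 3) ↔ Even (j + 1) := by
    rw [Nat.even_iff, Nat.even_iff]; omega
  rw [h1, h2, if_neg (show ¬ (j + 3 = 0) by omega), if_neg (show ¬ (j + 1 = 0) by omega)]
  by_cases h : Even (j + 1)
  · rw [if_pos h, if_pos (h3.2 h)]; ring
  · rw [if_neg h, if_neg (fun q => h (h3.1 q))]; ring

theorem T_step (n : ℕ) (x : ℂ) :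
    ∑ k ∈ Finset.range (n + 2 + 1), Rfun (n + 2 - k) x * Sfun k x
      = ((x ^ 2 - 1) / 4) * ∑ k ∈ Finset.range (n + 1), Rfun (n - k) x * Sfun k x
        + ((x ^ 2 - 1) / 4 * Sfun n x + x * Sfun (n + 1) x + Sfun (n + 2) x) := by
  have e : ∑ k ∈ Finset.range n, Rfun (n + 2 - k) x * Sfun k x
      = ((x ^ 2 - 1) / 4) * ∑ k ∈ Finset.range n, Rfun (n - k) x * Sfun k x := by
    rw [Finset.mul_sum]
    refine Finset.sum_congr rfl fun k hk => ?_
    have hk := Finset.mem_range.1 hk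
    obtain ⟨d, rfl⟩ : ∃ d, n = k + d + 1 := ⟨n - k - 1, by omega⟩
    rw [show k + d + 1 + 2 - k = d + 3 by omega, show k + d + 1 - k = d + 1 by omega, Rfun_step]
    ring
  have r0 : Rfun 0 x = 1 := by simp [Rfun]
  have r1 : Rfun 1 x = x := by simp [Rfun]
  have r2 : Rfun 2 x = 2 * ((x ^ 2 - 1) / 4) := by simp [Rfun]
  rw [Finset.sum_range_succ, Finset.sum_range_succ, Finset.sum_range_succ, e,
    Finset.sum_range_succ, show n + 2 - n = 2 by omega, show n + 2 - (n + 1) = 1 by omega,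
    Nat.sub_self, Nat.sub_self, r0, r1, r2]
  ring

theorem stmt14 (n : ℕ) (x : ℂ) :
    ∑ k ∈ Finset.range (n + 1), Rfun (n - k) x * Sfun k x
      = (if n = 0 then 1 else 0) := by
  induction n using Nat.strong_induction_on with
  | _ n ih =>
    match n, ih with
    | 0, _ => simp [Rfun, Sfun]
    | 1, _ =>
      simp [Finset.sum_range_succ, Rfun, Sfun]
      ring
    | 2, ih =>
      have h := T_step 0 x
      rw [ih 0 (by omega)] at h
      simp only [Nat.zero_add] at h
      rw [h]
      simp [Sfun]
      ring
    | m + 3, ih =>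
      rw [T_step (m + 1) x, ih (m + 1) (by omega)]
      simp [Sfun]
      ring
end

section
/- For every natural number n ≥ 1 and every complex x, the complex derivative of the function α ↦ P_n^{(α,0)}(x) at the point α = 0 equals Σ_{k=1}^{n} (1/k) · P_k^{(0,-1)}(x) · P_{n-k}^{(0,0)}(x). -/
noncomputable def jcc (n k : ℕ) : ℂ := (n.choose k : ℂ) * ((n + k).choose k : ℂ)

noncomputable def jhh (n k : ℕ) : ℂ := ∑ i ∈ Finset.range n, 1 / ((k : ℂ) + 1 + i)

lemma jcc_zero (n k : ℕ) (h : n < k) : jcc n k = 0 := by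
  simp [jcc, Nat.choose_eq_zero_of_lt h]

lemma jch1 (n k : ℕ) : ((k : ℂ) + 1) * (n.choose (k + 1) : ℂ) = ((n : ℂ) - k) * n.choose k := by
  rcases le_or_gt k n with h | h
  · have := Nat.choose_succ_right_eq n k
    have h2 : ((n.choose (k + 1) * (k + 1) : ℕ) : ℂ) = ((n.choose k * (n - k) : ℕ) : ℂ) := by
      rw [this]
    push_cast [Nat.cast_sub h] at h2
    linear_combination h2
  · simp [Nat.choose_eq_zero_of_lt h, Nat.choose_eq_zero_of_lt (show n < k + 1 by omega)]

lemma jch2 (n k : ℕ) : ((k : ℂ) + 1) * ((n + 1).choose (k + 1) : ℂ) = ((n : ℂ) + 1) * n.choose k := by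
  have := Nat.add_one_mul_choose_eq n k
  have h2 : (((n + 1) * n.choose k : ℕ) : ℂ) = (((n + 1).choose (k + 1) * (k + 1) : ℕ) : ℂ) := by
    rw [this]
  push_cast at h2
  linear_combination -h2

lemma jch3 (n k : ℕ) : ((n : ℂ) + 1 - k) * ((n + 1).choose k : ℂ) = ((n : ℂ) + 1) * n.choose k := by
  have h1 := jch1 (n + 1) k
  have h2 := jch2 n k
  push_cast at h1
  linear_combination h2 - h1

lemma jch4 (n k : ℕ) :
    ((n : ℂ) + 1) * ((n + k + 1).choose k : ℂ) = ((n : ℂ) + k + 1) * (n + k).choose k := by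
  have := jch3 (n + k) k
  push_cast at this
  linear_combination this

lemma jcc_A (n k : ℕ) :
    ((k : ℂ) + 1) ^ 2 * jcc n (k + 1) = ((n : ℂ) - k) * (n + k + 1) * jcc n k := by
  have h1 := jch1 n k
  have h2 := jch2 (n + k) k
  push_cast at h2
  simp only [jcc, ← add_assoc]
  calc _ = (((k : ℂ) + 1) * (n.choose (k + 1) : ℂ)) *
        (((k : ℂ) + 1) * ((n + k + 1).choose (k + 1) : ℂ)) := by ring
    _ = _ := by rw [h1, h2]; ring

lemma jcc_D (n k : ℕ) :
    ((n : ℂ) + 1 - k) * jcc (n + 1) k = ((n : ℂ) + k + 1) * jcc n k := by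
  have h1 := jch3 n k
  have h2 := jch4 n k
  simp only [jcc]
  rw [show n + 1 + k = n + k + 1 by ring]
  calc _ = (((n : ℂ) + 1 - k) * ((n + 1).choose k : ℂ)) * ((n + k + 1).choose k : ℂ) := by ring
    _ = _ := by rw [h1]; linear_combination (n.choose k : ℂ) * h2

lemma jcc_B (n k : ℕ) :
    ((k : ℂ) + 1) ^ 2 * jcc (n + 1) (k + 1) = ((n : ℂ) + k + 2) * (n + k + 1) * jcc n k := by
  have h1 := jcc_A (n + 1) k
  have h2 := jcc_D n k
  push_cast at h1
  linear_combination h1 + ((n : ℂ) + k + 2) * h2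

lemma jcc_C (n k : ℕ) :
    ((k : ℂ) + 1) ^ 2 * jcc n (k + 1) = ((n : ℂ) - k) * (n + 1 - k) * jcc (n + 1) k := by
  have h1 := jcc_A n k
  have h2 := jcc_D n k
  linear_combination h1 - ((n : ℂ) - k) * h2

lemma jne (a b : ℕ) : (a : ℂ) + 1 + b ≠ 0 := by
  have : ((a + 1 + b : ℕ) : ℂ) ≠ 0 := Nat.cast_ne_zero.2 (by omega)
  push_cast at this; exact this

lemma jhh_succ (n k : ℕ) : jhh (n + 1) k = jhh n k + 1 / ((k : ℂ) + 1 + n) := by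
  simp [jhh, Finset.sum_range_succ]

lemma jhh_k (n k : ℕ) : jhh n (k + 1) = jhh n k + 1 / ((k : ℂ) + 1 + n) - 1 / ((k : ℂ) + 1) := by
  rw [← jhh_succ]
  simp only [jhh, Finset.sum_range_succ']
  push_cast
  rw [add_zero, add_sub_cancel_right]
  exact Finset.sum_congr rfl fun i _ => by ring

noncomputable def jp (t : ℂ) (n : ℕ) : ℂ := ∑ k ∈ Finset.range (n + 1), jcc n k * t ^ k
noncomputable def jd (t : ℂ) (n : ℕ) : ℂ := ∑ k ∈ Finset.range (n + 1), jcc n k * jhh n k * t ^ k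

lemma jp_ext (t : ℂ) (n N : ℕ) (h : n ≤ N) :
    jp t n = ∑ k ∈ Finset.range (N + 1), jcc n k * t ^ k := by
  apply Finset.sum_subset
  · intro i; simp; omega
  · intro i _ hi
    rw [jcc_zero n i (by simpa using hi)]; simp

lemma jd_ext (t : ℂ) (n N : ℕ) (h : n ≤ N) :
    jd t n = ∑ k ∈ Finset.range (N + 1), jcc n k * jhh n k * t ^ k := by
  apply Finset.sum_subset
  · intro i; simp; omega
  · intro i _ hi
    rw [jcc_zero n i (by simpa using hi)]; simp

lemma jshift (t : ℂ) (A B : ℕ → ℂ) (N : ℕ) (h0 : A 0 = 0) (hs : ∀ k, A (k + 1) + B k = 0)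
    (hN : B N = 0) :
    ∑ k ∈ Finset.range (N + 1), A k * t ^ k + t * ∑ k ∈ Finset.range (N + 1), B k * t ^ k = 0 := by
  rw [Finset.sum_range_succ', Finset.sum_range_succ (fun k => B k * t ^ k), h0, hN]
  simp only [zero_mul, add_zero]
  rw [Finset.mul_sum, ← Finset.sum_add_distrib]
  apply Finset.sum_eq_zero
  intro k _
  linear_combination t ^ (k + 1) * hs k

lemma jc_rec (n k : ℕ) :
    ((n : ℂ) + 2) * jcc (n + 2) (k + 1) - (2 * n + 3) * jcc (n + 1) (k + 1)
      + (n + 1) * jcc n (k + 1) + (-2 * (2 * n + 3) * jcc (n + 1) k) = 0 := by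
  have hk : ((k : ℂ) + 1) ^ 2 ≠ 0 := pow_ne_zero _ (Nat.cast_add_one_ne_zero k)
  have h1 := jcc_A (n + 1) k
  have h2 := jcc_B (n + 1) k
  have h3 := jcc_C n k
  push_cast at h1 h2
  apply mul_left_cancel₀ hk
  linear_combination ((n : ℂ) + 2) * h2 - (2 * n + 3) * h1 + (n + 1) * h3

lemma jp_rec (t : ℂ) (n : ℕ) :
    ((n : ℂ) + 2) * jp t (n + 2) - (2 * n + 3) * (1 + 2 * t) * jp t (n + 1)
      + (n + 1) * jp t n = 0 := by
  have := jshift t (fun k => ((n : ℂ) + 2) * jcc (n + 2) k - (2 * n + 3) * jcc (n + 1) k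
      + (n + 1) * jcc n k) (fun k => -2 * (2 * n + 3) * jcc (n + 1) k) (n + 2)
      (by simp [jcc]; ring) (fun k => jc_rec n k) (by simp [jcc_zero])
  rw [jp_ext t n (n + 2) (by omega), jp_ext t (n + 1) (n + 2) (by omega),
    jp_ext t (n + 2) (n + 2) (by omega)]
  rw [← this]
  simp only [add_mul, sub_mul, Finset.sum_add_distrib, Finset.sum_sub_distrib, mul_assoc,
    ← Finset.mul_sum]
  ring

lemma jd_rec (t : ℂ) (n : ℕ) :
    ((n : ℂ) + 2) * jd t (n + 2) - (2 * n + 3) * (1 + 2 * t) * jd t (n + 1)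
      + (n + 1) * jd t n
      + (1 / 2) * (jp t (n + 2) - 2 * (1 + 2 * t) * jp t (n + 1) + jp t n) = 0 := by
  have := jshift t (fun k => ((n : ℂ) + 2) * (jcc (n + 2) k * jhh (n + 2) k)
      - (2 * n + 3) * (jcc (n + 1) k * jhh (n + 1) k)
      + (n + 1) * (jcc n k * jhh n k)
      + (1 / 2) * (jcc (n + 2) k - 2 * jcc (n + 1) k + jcc n k))
      (fun k => -2 * (2 * n + 3) * (jcc (n + 1) k * jhh (n + 1) k) + (-2) * jcc (n + 1) k) (n + 2)
      (by
        have e1 := jne 0 n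
        have e2 := jne 0 (n + 1)
        rw [jhh_succ (n + 1), jhh_succ n]
        simp [jcc] at e1 e2 ⊢
        field_simp
        ring)
      (fun k => by
        have hk : ((k : ℂ) + 1) ^ 2 ≠ 0 := pow_ne_zero _ (Nat.cast_add_one_ne_zero k)
        have hk1 : ((k : ℂ) + 1) ≠ 0 := (Nat.cast_add_one_ne_zero k)
        have h1 := jcc_A (n + 1) k
        have h2 := jcc_B (n + 1) k
        have h3 := jcc_C n k
        have e1 := jne k n
        have e2 := jne k (n + 1)
        have e3 := jne k (n + 2)
        push_cast at h1 h2 e2 e3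
        have f1 : jcc (n + 1) (k + 1) = ((n : ℂ) + 1 - k) * (n + 1 + k + 1) * jcc (n + 1) k / (k + 1) ^ 2 := by
          rw [eq_div_iff hk]; linear_combination h1
        have f2 : jcc (n + 2) (k + 1) = ((n : ℂ) + 1 + k + 2) * (n + 1 + k + 1) * jcc (n + 1) k / (k + 1) ^ 2 := by
          rw [eq_div_iff hk]; linear_combination h2
        have f3 : jcc n (k + 1) = ((n : ℂ) - k) * (n + 1 - k) * jcc (n + 1) k / (k + 1) ^ 2 := by
          rw [eq_div_iff hk]; linear_combination h3
        simp only [jhh_k, jhh_succ, f1, f2, f3]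
        push_cast
        generalize jcc (n + 1) k = u
        generalize jhh n k = h
        field_simp
        ring) (by simp [jcc_zero])
  rw [jp_ext t n (n + 2) (by omega), jp_ext t (n + 1) (n + 2) (by omega),
    jp_ext t (n + 2) (n + 2) (by omega), jd_ext t n (n + 2) (by omega),
    jd_ext t (n + 1) (n + 2) (by omega), jd_ext t (n + 2) (n + 2) (by omega)]
  rw [← this]
  simp only [add_mul, sub_mul, mul_add, mul_sub, Finset.sum_add_distrib, Finset.sum_sub_distrib,
    mul_assoc, ← Finset.mul_sum]
  ring

lemma jasc (m k : ℕ) :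
    (ascPochhammer ℂ m).eval ((k : ℂ) + 1) = (m.factorial : ℂ) * ((k + m).choose m : ℂ) := by
  have := ascPochhammer_nat_eq_natCast_ascFactorial ℂ (k + 1) m
  rw [Nat.ascFactorial_eq_factorial_mul_choose] at this
  push_cast at this
  exact this

lemma jasc_mul (n k : ℕ) (h : k ≤ n) (α : ℂ) :
    (ascPochhammer ℂ k).eval ((n : ℂ) + α + 1) * (ascPochhammer ℂ (n - k)).eval (α + k + 1)
      = (ascPochhammer ℂ n).eval (α + k + 1) := by
  have := congrArg (Polynomial.eval (α + k + 1)) (ascPochhammer_mul ℂ (n - k) k)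
  rw [Nat.sub_add_cancel h] at this
  rw [← this]
  simp only [Polynomial.eval_mul, Polynomial.eval_comp, Polynomial.eval_add, Polynomial.eval_X,
    Polynomial.eval_natCast]
  rw [Nat.cast_sub h, mul_comm]
  congr 2
  ring

lemma jfac_s15 (n k : ℕ) (h : k ≤ n) :
    (n.choose k : ℂ) = n.factorial / ((k.factorial : ℂ) * ((n - k).factorial : ℂ)) :=
  Nat.cast_choose ℂ h

lemma jP_alpha (n : ℕ) (α x : ℂ) :
    jacobiP n α 0 x = ∑ k ∈ Finset.range (n + 1),
      (ascPochhammer ℂ n).eval (α + k + 1) * ((n.choose k : ℂ) / n.factorial * ((x - 1) / 2) ^ k) := by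
  apply Finset.sum_congr rfl
  intro k hk
  have hk : k ≤ n := by simp at hk; omega
  rw [add_zero, jasc_mul n k hk, jfac_s15 n k hk]
  have : (n.factorial : ℂ) ≠ 0 := Nat.cast_ne_zero.2 n.factorial_ne_zero
  field_simp

lemma jP_zero (n : ℕ) (x : ℂ) : jacobiP n 0 0 x = jp ((x - 1) / 2) n := by
  rw [jP_alpha]
  apply Finset.sum_congr rfl
  intro k hk
  rw [zero_add, jasc, jcc]
  have : (n.factorial : ℂ) ≠ 0 := Nat.cast_ne_zero.2 n.factorial_ne_zero
  rw [add_comm k n, Nat.choose_symm_add]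
  field_simp

lemma jasc_deriv (n k : ℕ) :
    HasDerivAt (fun α : ℂ => (ascPochhammer ℂ n).eval (α + k + 1))
      ((ascPochhammer ℂ n).eval ((k : ℂ) + 1) * jhh n k) 0 := by
  induction n with
  | zero => simpa [jhh] using hasDerivAt_const (0 : ℂ) (1 : ℂ)
  | succ n ih =>
    simp only [ascPochhammer_succ_eval]
    have h2 : HasDerivAt (fun α : ℂ => α + k + 1 + n) 1 0 :=
      (((hasDerivAt_id (0 : ℂ)).add_const _).add_const _).add_const _
    refine (ih.mul h2).congr_deriv ?_
    rw [jhh_succ]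
    have := jne k n
    simp only [zero_add]
    field_simp

lemma jP_deriv (n : ℕ) (x : ℂ) :
    HasDerivAt (fun α : ℂ => jacobiP n α 0 x) (jd ((x - 1) / 2) n) 0 := by
  simp only [jP_alpha]
  have := HasDerivAt.fun_sum (u := Finset.range (n + 1)) (fun k _ => (jasc_deriv n k).mul_const
    ((n.choose k : ℂ) / n.factorial * ((x - 1) / 2) ^ k))
  refine this.congr_deriv ?_
  apply Finset.sum_congr rfl
  intro k hk
  rw [jasc, jcc]
  have : (n.factorial : ℂ) ≠ 0 := Nat.cast_ne_zero.2 n.factorial_ne_zero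
  rw [add_comm k n, Nat.choose_symm_add]
  field_simp

lemma jQ (n : ℕ) (x : ℂ) :
    jacobiP (n + 1) 0 (-1) x = (jp ((x - 1) / 2) (n + 1) + jp ((x - 1) / 2) n) / 2 := by
  rw [jp_ext _ n (n + 1) (by omega), jp_ext _ (n + 1) (n + 1) (by omega), ← Finset.sum_add_distrib,
    Finset.sum_div]
  apply Finset.sum_congr rfl
  intro k hk
  have hk : k ≤ n + 1 := by simp at hk; omega
  have e : ((n + 1 : ℕ) : ℂ) + 0 + -1 + 1 = (n : ℂ) + 1 := by push_cast; ring
  rw [e, zero_add, jasc, jasc, show k + (n + 1 - k) = n + 1 by omega, Nat.choose_symm hk]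
  have a1 : (k.factorial : ℂ) ≠ 0 := Nat.cast_ne_zero.2 k.factorial_ne_zero
  have a2 : ((n + 1 - k).factorial : ℂ) ≠ 0 := Nat.cast_ne_zero.2 (n + 1 - k).factorial_ne_zero
  have h1 := jch3 n k
  have h2 := jch4 n k
  have hn : (n : ℂ) + 1 ≠ 0 := Nat.cast_add_one_ne_zero n
  have key : ((n + k).choose k : ℂ) * ((n + 1).choose k : ℂ) * 2 = jcc (n + 1) k + jcc n k := by
    simp only [jcc]
    rw [show n + 1 + k = n + k + 1 by ring]
    apply mul_left_cancel₀ hn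
    linear_combination (-((n + 1).choose k : ℂ)) * h2 + ((n + k).choose k : ℂ) * h1
  rw [← add_mul, ← key]
  field_simp

open PowerSeries in
lemma jmain (x t : ℂ) (ht : x = 1 + 2 * t) (q : ℕ → ℂ) (hq0 : q 0 = 0)
    (hq : ∀ n : ℕ, ((n : ℂ) + 1) * q (n + 1) = (jp t (n + 1) + jp t n) / 2) :
    PowerSeries.mk (jd t) = PowerSeries.mk q * PowerSeries.mk (jp t) := by
  have p0 : jp t 0 = 1 := by simp [jp, jcc]
  have d0 : jd t 0 = 0 := by simp [jd, jhh]
  have p1 : jp t 1 = x := by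
    simp [jp, jcc, Finset.sum_range_succ, ht]
  have d1 : jd t 1 = 1 + t := by
    simp [jd, jcc, jhh, Finset.sum_range_succ]; norm_num
  have cd : ∀ f : ℕ → ℂ, constantCoeff (d⁄dX ℂ (PowerSeries.mk f)) = f 1 := by
    intro f
    rw [← coeff_zero_eq_constantCoeff_apply, coeff_derivative]
    simp
  have h20 : (2 : ℂ⟦X⟧) ≠ 0 := by
    intro h
    have := congrArg (constantCoeff (R := ℂ)) h
    rw [map_ofNat, map_zero] at this
    exact two_ne_zero this
  set P : ℂ⟦X⟧ := PowerSeries.mk (jp t) with hP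
  set D : ℂ⟦X⟧ := PowerSeries.mk (jd t) with hD
  set L : ℂ⟦X⟧ := PowerSeries.mk q with hL
  set c : ℂ⟦X⟧ := PowerSeries.C x with hc
  set R : ℂ⟦X⟧ := 1 - c * (X + X) + X * X with hR
  have dR : d⁄dX ℂ R = (X - c) + (X - c) := by
    simp [hR, hc, Derivation.leibniz]; ring
  have odeP : R * d⁄dX ℂ P = (c - X) * P := by
    ext n
    have : R * d⁄dX ℂ P = d⁄dX ℂ P - c * (X * d⁄dX ℂ P) - c * (X * d⁄dX ℂ P)
      + X * (X * d⁄dX ℂ P) := by rw [hR]; ring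
    rw [this, sub_mul]
    rcases n with _ | _ | n
    · simp [hc, hP, cd, p0, p1]
    · have := jp_rec t 0
      simp [hc, hP, cd, coeff_derivative, coeff_succ_X_mul, coeff_C_mul, p0, p1] at this ⊢
      rw [← ht] at this
      linear_combination this
    · have := jp_rec t (n + 1)
      simp [hc, hP, cd, coeff_derivative, coeff_succ_X_mul, coeff_C_mul] at this ⊢
      rw [← ht] at this
      linear_combination this
  have odeD : (X * (R * d⁄dX ℂ D)) + (X * (R * d⁄dX ℂ D)) = X * (c - X) * D + X * (c - X) * D
      + (1 + X) - R * P := by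
    ext n
    have : R * d⁄dX ℂ D = d⁄dX ℂ D - c * (X * d⁄dX ℂ D) - c * (X * d⁄dX ℂ D)
      + X * (X * d⁄dX ℂ D) := by rw [hR]; ring
    rw [this, hR]
    have e1 : X * (c - X) * D = c * (X * D) - X * (X * D) := by ring
    have e2 : (1 - c * (X + X) + X * X) * P = P - c * (X * P) - c * (X * P) + X * (X * P) := by ring
    rw [e1, e2]
    rcases n with _ | _ | n
    · simp [hc, hP, hD, coeff_derivative, p0, p1]
    · simp [hc, hP, hD, cd, coeff_derivative, coeff_succ_X_mul, coeff_C_mul, p0, p1, d0, d1, coeff_X,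
        coeff_one]
      rw [ht]; ring
    · have := jd_rec t n
      rw [← ht] at this
      rcases n with _ | n
      · simp [hc, hP, hD, cd, coeff_derivative, coeff_succ_X_mul, coeff_C_mul, coeff_X, coeff_one] at this ⊢
        linear_combination 2 * this
      · simp [hc, hP, hD, cd, coeff_derivative, coeff_succ_X_mul, coeff_C_mul, coeff_X, coeff_one] at this ⊢
        linear_combination 2 * this
  have odeL : X * d⁄dX ℂ L + X * d⁄dX ℂ L = P + X * P - 1 := by
    ext n
    rcases n with _ | n
    · simp [hP, p0]
    · have := hq n
      simp [hP, hL, coeff_derivative, coeff_succ_X_mul, coeff_one]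
      linear_combination 2 * this
  have RP : R * P * P = 1 := by
    apply PowerSeries.derivative.ext
    · simp only [Derivation.leibniz, smul_eq_mul, dR, map_one_eq_zero, Derivation.map_one_eq_zero]
      linear_combination 2 * P * odeP
    · simp [hR, hP, p0]
  have key : R * P * D = L := by
    apply PowerSeries.derivative.ext
    · have h2 : (2 * X : ℂ⟦X⟧) ≠ 0 := mul_ne_zero h20 PowerSeries.X_ne_zero
      apply mul_left_cancel₀ h2
      simp only [Derivation.leibniz, smul_eq_mul, dR]
      linear_combination 2 * X * D * odeP + P * odeD - odeL - RP
    · simp [hD, hL, d0, hq0]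
  linear_combination (-D) * RP + P * key

theorem stmt15 (n : ℕ) (hn : 1 ≤ n) (x : ℂ) :
    HasDerivAt (fun α : ℂ => jacobiP n α 0 x)
      (∑ k ∈ Finset.Icc 1 n, (1 / (k : ℂ)) * jacobiP k 0 (-1) x * jacobiP (n - k) 0 0 x)
      0 := by
  have h := jmain x ((x - 1) / 2) (by ring) (fun k => (1 / (k : ℂ)) * jacobiP k 0 (-1) x)
    (by simp) (fun m => by
      have hm : (m : ℂ) + 1 ≠ 0 := Nat.cast_add_one_ne_zero m
      rw [jQ]; push_cast; field_simp)
  have h2 := congrArg (PowerSeries.coeff n) h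
  rw [PowerSeries.coeff_mul, Finset.Nat.sum_antidiagonal_eq_sum_range_succ_mk] at h2
  simp only [PowerSeries.coeff_mk] at h2
  refine (jP_deriv n x).congr_deriv ?_
  rw [h2, Finset.sum_range_succ']
  simp only [jP_zero, Nat.cast_zero, div_zero, zero_mul, add_zero]
  rw [← Finset.sum_image (s := Finset.range n) (g := fun k : ℕ => k + 1)
    (f := fun k : ℕ => (1 / (k : ℂ)) * jacobiP k 0 (-1) x * jp ((x - 1) / 2) (n - k))
    (fun a _ b _ hab => by simpa using hab)]
  refine Finset.sum_congr ?_ fun _ _ => rfl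
  ext k
  simp only [Finset.mem_Icc, Finset.mem_image, Finset.mem_range]
  constructor
  · rintro ⟨a, ha, rfl⟩
    omega
  · rintro ⟨h1, h2⟩
    exact ⟨k - 1, by omega, by omega⟩
end

section
/- Let m ≥ 1 be a natural number, let α₁, β₁, α₂, β₂ be complex numbers and let x be complex. (i) If α₁ + α₂ = -2m and β₁ + β₂ = -2m, then Σ_{k=0}^{2m} P_{2m-k}^{(α₁,β₁)}(x) · P_k^{(α₂,β₂)}(x) = 2·((x²-1)/4)^m. (ii) If α₁ + α₂ = -(2m-1) and β₁ + β₂ = -(2m-1), then Σ_{k=0}^{2m-1} P_{2m-1-k}^{(α₁,β₁)}(x) · P_k^{(α₂,β₂)}(x) = x·((x²-1)/4)^{m-1}. -/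
lemma asc_A (k : ℕ) (s : ℂ) : (ascPochhammer ℂ (k+1)).eval (s+1) =
    (ascPochhammer ℂ (k+1)).eval s + (k+1) * (ascPochhammer ℂ k).eval (s+1) := by
  have h := congrArg (Polynomial.eval s) (ascPochhammer_succ_comp_X_add_one ℂ k)
  simpa [Polynomial.eval_comp] using h

lemma asc_B (k : ℕ) (s : ℂ) : (ascPochhammer ℂ (k+1)).eval s =
    s * (ascPochhammer ℂ k).eval (s+1) := by
  rw [ascPochhammer_succ_left]; simp [Polynomial.eval_comp]

lemma jac_beta (n : ℕ) (α β x : ℂ) : jacobiP (n+1) α (β+1) x =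
    jacobiP (n+1) α β x + (x-1)/2 * jacobiP n (α+1) (β+1) x := by
  unfold jacobiP
  rw [Finset.sum_range_succ', Finset.sum_range_succ' _ (n+1), Finset.mul_sum, add_right_comm (∑ _ ∈ _, _) _ (∑ _ ∈ _, _),
    ← Finset.sum_add_distrib]
  congr 1
  · refine Finset.sum_congr rfl fun k hk => ?_
    have e1 : ((n+1 : ℕ):ℂ) + α + (β+1) + 1 = (((n+1 : ℕ):ℂ) + α + β + 1) + 1 := by ring
    have e2 : (n:ℂ) + (α+1) + (β+1) + 1 = (((n+1 : ℕ):ℂ) + α + β + 1) + 1 := by push_cast; ring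
    have e3 : α + 1 + (k:ℂ) + 1 = α + ((k+1 : ℕ):ℂ) + 1 := by push_cast; ring
    rw [e1, e2, e3, asc_A, Nat.add_sub_add_right, Nat.factorial_succ]
    have h1 : ((k:ℂ)+1) ≠ 0 := by exact_mod_cast Nat.succ_ne_zero k
    have h2 : (k.factorial : ℂ) ≠ 0 := by exact_mod_cast k.factorial_ne_zero
    have h3 : ((n-k).factorial : ℂ) ≠ 0 := by exact_mod_cast (n-k).factorial_ne_zero
    push_cast
    field_simp
    ring
  · simp

lemma jac_mix (n : ℕ) (α β x : ℂ) : jacobiP (n+1) (α+1) β x =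
    jacobiP (n+1) α (β+1) x + jacobiP n (α+1) (β+1) x := by
  unfold jacobiP
  rw [Finset.sum_range_succ, Finset.sum_range_succ _ (n+1), add_right_comm (∑ _ ∈ _, _) _ (∑ _ ∈ _, _),
    ← Finset.sum_add_distrib]
  congr 1
  · refine Finset.sum_congr rfl fun k hk => ?_
    have hk' : k ≤ n := by simpa [Nat.lt_succ_iff] using hk
    have e1 : ((n+1 : ℕ):ℂ) + α + (β+1) + 1 = ((n+1 : ℕ):ℂ) + (α + 1) + β + 1 := by ring
    have e2 : (n:ℂ) + (α+1) + (β+1) + 1 = ((n+1 : ℕ):ℂ) + (α + 1) + β + 1 := by push_cast; ring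
    have e3 : α + 1 + (k:ℂ) + 1 = (α + (k:ℂ) + 1) + 1 := by ring
    rw [e1, e2, e3, Nat.succ_sub hk', Nat.succ_eq_add_one, asc_A, Nat.factorial_succ]
    have h1 : (((n-k : ℕ):ℂ)+1) ≠ 0 := by exact_mod_cast Nat.succ_ne_zero (n-k)
    have h2 : (k.factorial : ℂ) ≠ 0 := by exact_mod_cast k.factorial_ne_zero
    have h3 : ((n-k).factorial : ℂ) ≠ 0 := by exact_mod_cast (n-k).factorial_ne_zero
    generalize n - k = j at *
    push_cast
    field_simp
  · have e1 : ((n+1 : ℕ):ℂ) + α + (β+1) + 1 = ((n+1 : ℕ):ℂ) + (α + 1) + β + 1 := by ring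
    rw [e1]; simp

lemma jac_base (n : ℕ) (x : ℂ) : jacobiP (n+1) (-1) 0 x = (x-1)/2 * jacobiP n 1 0 x := by
  unfold jacobiP
  rw [Finset.sum_range_succ', Finset.mul_sum]
  have h0 : (ascPochhammer ℂ (n+1)).eval (0:ℂ) = 0 := by simp
  simp only [Nat.cast_zero, neg_add_cancel, Nat.sub_zero, add_zero, h0, mul_zero, zero_div, zero_mul]
  refine Finset.sum_congr rfl fun k hk => ?_
  have hk' : k ≤ n := by simpa [Nat.lt_succ_iff] using hk
  have e1 : ((n+1 : ℕ):ℂ) + -1 + 1 = (n:ℂ) + 1 := by push_cast; ring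
  have e2 : (n:ℂ) + 1 + 1 = ((n:ℂ) + 1) + 1 := by ring
  have e3 : -1 + ((k+1 : ℕ):ℂ) + 1 = (k:ℂ) + 1 := by push_cast; ring
  have e4 : 1 + (k:ℂ) + 1 = ((k:ℂ) + 1) + 1 := by ring
  rw [e1, e3, e4, asc_B, Nat.add_sub_add_right, Nat.factorial_succ]
  have h1 : ((k:ℂ)+1) ≠ 0 := by exact_mod_cast Nat.succ_ne_zero k
  have h2 : (k.factorial : ℂ) ≠ 0 := by exact_mod_cast k.factorial_ne_zero
  have h3 : ((n-k).factorial : ℂ) ≠ 0 := by exact_mod_cast (n-k).factorial_ne_zero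
  have key : ((n:ℂ)+1) * (ascPochhammer ℂ (n-k)).eval ((k:ℂ)+1) =
      ((k:ℂ)+1) * (ascPochhammer ℂ (n-k)).eval ((k:ℂ)+1+1) := by
    rw [← asc_B, ascPochhammer_succ_eval, Nat.cast_sub hk']; ring
  push_cast
  generalize (x-1)/2 = y
  field_simp
  linear_combination y * y^k * (ascPochhammer ℂ k).eval ((n:ℂ)+1+1) * key

lemma jac_zero (α β x : ℂ) : jacobiP 0 α β x = 1 := by simp [jacobiP]

open PowerSeries in
/-- generating series -/
noncomputable def jacE (x α β : ℂ) : PowerSeries ℂ := PowerSeries.mk fun n => jacobiP n α β x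

open PowerSeries in
lemma jacE_beta (x α β : ℂ) : jacE x α (β+1) =
    jacE x α β + C ((x-1)/2) * X * jacE x (α+1) (β+1) := by
  ext n
  cases n with
  | zero => simp [jacE, jac_zero, mul_assoc]
  | succ n => simp [jacE, jac_beta, mul_assoc, coeff_succ_X_mul]

open PowerSeries in
lemma jacE_alpha (x α β : ℂ) : jacE x (α+1) β =
    jacE x α β + C ((x+1)/2) * X * jacE x (α+1) (β+1) := by
  ext n
  cases n with
  | zero => simp [jacE, jac_zero, mul_assoc]
  | succ n =>
    simp [jacE, jac_beta, jac_mix, mul_assoc, coeff_succ_X_mul]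
    ring

open PowerSeries in
lemma jacE_base (x : ℂ) : jacE x (-1) 0 = 1 + C ((x-1)/2) * X * jacE x 1 0 := by
  ext n
  cases n with
  | zero => simp [jacE, jac_zero, mul_assoc]
  | succ n => simp [jacE, jac_base, mul_assoc, coeff_succ_X_mul, coeff_one]

open PowerSeries in
lemma exists_phi (x c : ℂ) : ∃ φ : PowerSeries ℂ, φ = 1 + C x * X * φ + C c * X^2 * φ^2 := by
  have hcat := congrArg (PowerSeries.map (Nat.castRingHom ℂ)) catalanSeries_sq_mul_X_add_one
  set K := PowerSeries.map (Nat.castRingHom ℂ) catalanSeries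
  have hd : (1 - C x * X : PowerSeries ℂ) * (1 - C x * X : PowerSeries ℂ)⁻¹ = 1 :=
    PowerSeries.mul_inv_cancel _ (by simp)
  set d := (1 - C x * X : PowerSeries ℂ)⁻¹
  have hs : HasSubst (C c * X^2 * d^2 : PowerSeries ℂ) :=
    HasSubst.of_constantCoeff_zero' (by simp)
  have h2 := congrArg (substAlgHom (R := ℂ) hs) hcat
  simp only [map_add, map_mul, map_pow, map_one, PowerSeries.map_X, substAlgHom_X] at h2
  refine ⟨d * substAlgHom hs K, ?_⟩
  set K' := substAlgHom hs K
  linear_combination K' * hd - h2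

open PowerSeries in
lemma exists_pq (x : ℂ) : ∃ p q : PowerSeries ℂ, p = 1 + C ((x+1)/2) * X * (p * q) ∧
    q = 1 + C ((x-1)/2) * X * (p * q) := by
  obtain ⟨φ, h⟩ := exists_phi x ((x+1)/2 * ((x-1)/2))
  have e : (1 + C ((x+1)/2) * X * φ) * (1 + C ((x-1)/2) * X * φ) = φ := by
    have : C x = C ((x+1)/2) + C ((x-1)/2) := by rw [← map_add]; congr 1; ring
    rw [this, map_mul] at h
    linear_combination -h
  exact ⟨1 + C ((x+1)/2) * X * φ, 1 + C ((x-1)/2) * X * φ, by rw [e], by rw [e]⟩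

open PowerSeries in
lemma jacE_shift (x : ℂ) (p q : PowerSeries ℂ) (hp : p = 1 + C ((x+1)/2) * X * (p * q))
    (hq : q = 1 + C ((x-1)/2) * X * (p * q)) (α β : ℂ) :
    jacE x (α+1) β = p * jacE x α β ∧ jacE x α (β+1) = q * jacE x α β := by
  have key : ∀ n : ℕ, ∀ α β : ℂ, X^n ∣ jacE x (α+1) β - p * jacE x α β ∧
      X^n ∣ jacE x α (β+1) - q * jacE x α β := by
    intro n
    induction n with
    | zero => intro α β; simp
    | succ n ih =>
      intro α β
      constructor
      · have e : jacE x (α+1) β - p * jacE x α β = X * (C ((x+1)/2) *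
            ((jacE x (α+1) (β+1) - p * jacE x α (β+1)) +
              p * (jacE x α (β+1) - q * jacE x α β))) := by
          linear_combination jacE_alpha x α β - jacE x α β * hp
        rw [e, pow_succ']
        exact mul_dvd_mul_left _ (Dvd.dvd.mul_left
          (dvd_add (ih α (β+1)).1 (Dvd.dvd.mul_left (ih α β).2 _)) _)
      · have e : jacE x α (β+1) - q * jacE x α β = X * (C ((x-1)/2) *
            ((jacE x (α+1) (β+1) - q * jacE x (α+1) β) +
              q * (jacE x (α+1) β - p * jacE x α β))) := by
          linear_combination jacE_beta x α β - jacE x α β * hq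
        rw [e, pow_succ']
        exact mul_dvd_mul_left _ (Dvd.dvd.mul_left
          (dvd_add (ih (α+1) β).2 (Dvd.dvd.mul_left (ih α β).1 _)) _)
  have z : ∀ f : PowerSeries ℂ, (∀ n : ℕ, X^n ∣ f) → f = 0 := by
    intro f hf
    ext n
    simpa using (X_pow_dvd_iff.1 (hf (n+1))) n (Nat.lt_succ_self n)
  exact ⟨sub_eq_zero.1 (z _ fun n => (key n α β).1), sub_eq_zero.1 (z _ fun n => (key n α β).2)⟩

open PowerSeries in
lemma exists_Y (x c : ℂ) (u v : PowerSeries ℂ) (h1 : u + v = 1 - C x * X)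
    (h2 : u * v = C c * X^2) (N : ℕ) : ∃ Y : PowerSeries ℂ, (∀ k > N, coeff k Y = 0) ∧
      (u - v) * Y = u^(N+1) - v^(N+1) := by
  induction N using Nat.twoStepInduction with
  | zero => exact ⟨1, fun k hk => by simp [coeff_one]; omega, by ring⟩
  | one =>
    refine ⟨1 - C x * X, fun k hk => ?_, by rw [← h1]; ring⟩
    have e1 : k ≠ 0 := by omega
    have e2 : k ≠ 1 := by omega
    simp [coeff_one, coeff_X, e1, e2]
  | more n ih0 ih1 =>
    obtain ⟨Y0, a0, b0⟩ := ih0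
    obtain ⟨Y1, a1, b1⟩ := ih1
    refine ⟨(1 - C x * X) * Y1 - C c * X^2 * Y0, fun k hk => ?_, ?_⟩
    · obtain ⟨j, rfl⟩ : ∃ j, k = j + 1 + 1 := ⟨k-2, by omega⟩
      have := a1 (j+1+1) (by omega)
      have := a1 (j+1) (by omega)
      have := a0 j (by omega)
      simp_all [sub_mul, mul_assoc, coeff_succ_X_mul, pow_two]
    · rw [← h1, ← h2]
      linear_combination (u+v) * b1 - u * v * b0

open PowerSeries in
lemma coeff_main_s16 (x c : ℂ) (E u v : PowerSeries ℂ) (h1 : u + v = 1 - C x * X)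
    (h2 : u * v = C c * X^2) (h3 : E * (u - v) = 1) (hE0 : coeff 0 E = 1) (hE1 : coeff 1 E = x)
    (m : ℕ) : coeff (2*m) (E^2 * (u^(2*m) + v^(2*m))) = 2 * c^m ∧
      coeff (2*m+1) (E^2 * (u^(2*m+1) + v^(2*m+1))) = x * c^m := by
  have step : ∀ N, coeff (N+2) (E^2 * (u^(N+2) + v^(N+2))) =
      c * coeff N (E^2 * (u^N + v^N)) := by
    intro N
    obtain ⟨Y, hY, hY2⟩ := exists_Y x c u v h1 h2 N
    have : E^2 * (u^(N+2) + v^(N+2)) = C c * (X^2 * (E^2 * (u^N + v^N))) + Y := by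
      linear_combination E^2 * (u^N + v^N) * h2 - E^2 * (u-v) * hY2 + Y * (E * (u-v) + 1) * h3
    rw [this, map_add, hY _ (by omega), add_zero, coeff_C_mul, coeff_X_pow_mul]
  have hE0' : constantCoeff E = 1 := by simpa using hE0
  induction m with
  | zero =>
    constructor
    · simp [hE0']; norm_num
    · simp only [mul_zero, zero_add, pow_one, pow_zero, mul_one]
      rw [h1, mul_sub, mul_one, map_sub, ← mul_assoc, coeff_succ_mul_X, pow_two, coeff_mul]
      simp [Finset.Nat.antidiagonal_succ, hE0', hE1, coeff_mul_C]
  | succ m ih =>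
    constructor
    · rw [show 2*(m+1) = 2*m+2 by ring, step, ih.1]; ring
    · rw [show 2*(m+1)+1 = (2*m+1)+2 by ring, step, ih.2]; ring

open PowerSeries in
lemma base_coeff (x : ℂ) (N : ℕ) (hN : 1 ≤ N) : ∃ (E u v : PowerSeries ℂ),
    u + v = 1 - C x * X ∧ u * v = C ((x^2-1)/4) * X^2 ∧ E * (u - v) = 1 ∧ coeff 0 E = 1 ∧
    coeff 1 E = x ∧
    coeff N (jacE x (-N) (-N) * jacE x 0 0) = coeff N (E^2 * (u^N + v^N)) := by
  obtain ⟨p, q, hp, hq⟩ := exists_pq x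
  have hs := jacE_shift x p q hp hq
  set a := C ((x+1)/2) with ha
  set b := C ((x-1)/2) with hb
  have hab : a + b = C x := by rw [ha, hb, ← map_add]; congr 1; ring
  have hab2 : a * b = C ((x^2-1)/4) := by rw [ha, hb, ← map_mul]; congr 1; ring
  have pp : p * (1 - a * X * q) = 1 := by linear_combination hp
  have qq : q * (1 - b * X * p) = 1 := by linear_combination hq
  have hu : p * q * ((1 - a * X * q) * (1 - b * X * p)) = 1 := by
    linear_combination q * (1 - b * X * p) * pp + qq
  have hEm : ∀ n : ℕ, jacE x (-n) (-n) =
      jacE x 0 0 * ((1 - a * X * q) * (1 - b * X * p))^n := by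
    intro n
    induction n with
    | zero => simp
    | succ n ih =>
      have e1 := (hs (-((n+1:ℕ):ℂ)) (-((n+1:ℕ):ℂ))).1
      have e2 := (hs (-((n+1:ℕ):ℂ)+1) (-((n+1:ℕ):ℂ))).2
      have e3 : -((n+1:ℕ):ℂ)+1 = -(n:ℂ) := by push_cast; ring
      rw [e1, e3, ih] at e2
      rw [pow_succ]
      linear_combination (-((1 - a * X * q) * (1 - b * X * p))) * e2 -
        jacE x (-((n+1:ℕ):ℂ)) (-((n+1:ℕ):ℂ)) * hu
  refine ⟨jacE x 0 0, (1 - a * X * q) * (1 - b * X * p), a * b * X^2 * p * q, ?_, ?_, ?_, ?_, ?_, ?_⟩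
  · rw [← hab]
    linear_combination -b * X * hp - a * X * hq
  · rw [← hab2]; linear_combination a * b * X^2 * hu
  · have e1 := (hs (-1) 0).1
    have e2 := (hs 0 0).1
    have e3 := jacE_base x
    rw [neg_add_cancel] at e1
    rw [zero_add] at e2
    rw [e2] at e3
    linear_combination e3 + (1 - a * X * q) * e1 + jacE x (-1) 0 * pp
  · simp [jacE, jac_zero]
  · simp [jacE, jacobiP, Finset.sum_range_succ]; ring
  · rw [hEm, mul_add, map_add]
    have : coeff N (jacE x 0 0 ^ 2 * (a * b * X^2 * p * q)^N) = 0 := by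
      have hd : X^(2*N) ∣ jacE x 0 0 ^ 2 * (a * b * X^2 * p * q)^N :=
        ⟨jacE x 0 0 ^ 2 * (a * b * p * q)^N, by rw [pow_mul]; simp only [mul_pow]; ring⟩
      exact X_pow_dvd_iff.1 hd N (by omega)
    rw [this, add_zero]
    congr 1; ring

open Polynomial in
lemma jac_poly (n : ℕ) (g h : ℂ[X]) (x : ℂ) :
    ∃ Q : ℂ[X], ∀ z, jacobiP n (g.eval z) (h.eval z) x = Q.eval z := by
  refine ⟨∑ k ∈ Finset.range (n + 1),
    ((ascPochhammer ℂ k).comp (C (n : ℂ) + g + h + 1) *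
        (ascPochhammer ℂ (n - k)).comp (g + C (k : ℂ) + 1)) *
      C (((k.factorial : ℂ) * ((n - k).factorial : ℂ))⁻¹ * ((x - 1) / 2) ^ k), fun z => ?_⟩
  unfold jacobiP
  rw [eval_finsetSum]
  refine Finset.sum_congr rfl fun k _ => ?_
  simp only [eval_mul, eval_comp, eval_add, eval_C, eval_one]
  ring

open PowerSeries in
lemma conv_poly (N : ℕ) (g h g' h' : Polynomial ℂ) (x : ℂ) :
    ∃ Q : Polynomial ℂ, ∀ z, coeff N (jacE x (g.eval z) (h.eval z) *
      jacE x (g'.eval z) (h'.eval z)) = Q.eval z := by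
  choose A hA using fun n => jac_poly n g h x
  choose B hB using fun n => jac_poly n g' h' x
  refine ⟨∑ ij ∈ Finset.HasAntidiagonal.antidiagonal N, A ij.1 * B ij.2, fun z => ?_⟩
  simp [coeff_mul, jacE, hA, hB, Polynomial.eval_finsetSum]

lemma poly_periodic (Q : Polynomial ℂ) (h : ∀ z, Q.eval (z+1) = Q.eval z) (z : ℂ) :
    Q.eval z = Q.eval 0 := by
  have hn : ∀ n : ℕ, Q.eval (n:ℂ) = Q.eval 0 := by
    intro n
    induction n with
    | zero => simp
    | succ n ih => rw [Nat.cast_succ, h, ih]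
  have : Q = Polynomial.C (Q.eval 0) := by
    apply Polynomial.eq_of_infinite_eval_eq
    refine (Set.infinite_range_of_injective (Nat.cast_injective (R := ℂ))).mono ?_
    rintro _ ⟨n, rfl⟩
    simp [hn]
  rw [this]; simp

open PowerSeries in
lemma conv_indep (x α β γ δ : ℂ) (N : ℕ) :
    coeff N (jacE x γ δ * jacE x α β) = coeff N (jacE x (γ+α) (δ+β) * jacE x 0 0) := by
  obtain ⟨p, q, hp, hq⟩ := exists_pq x
  have hs := jacE_shift x p q hp hq
  have hA : coeff N (jacE x γ δ * jacE x α β) = coeff N (jacE x (γ+α) δ * jacE x 0 β) := by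
    obtain ⟨Q, hQ⟩ := conv_poly N (Polynomial.C (γ+α) - Polynomial.X) (Polynomial.C δ)
      Polynomial.X (Polynomial.C β) x
    simp only [Polynomial.eval_sub, Polynomial.eval_C, Polynomial.eval_X] at hQ
    have := poly_periodic Q (fun z => by
      rw [← hQ, ← hQ]
      have e1 := (hs (γ+α-(z+1)) δ).1
      rw [show γ+α-(z+1)+1 = γ+α-z by ring] at e1
      rw [e1, (hs z β).1]
      congr 1; ring) α
    rw [← hQ, ← hQ] at this
    simpa using this
  have hB : coeff N (jacE x (γ+α) δ * jacE x 0 β) =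
      coeff N (jacE x (γ+α) (δ+β) * jacE x 0 0) := by
    obtain ⟨Q, hQ⟩ := conv_poly N (Polynomial.C (γ+α)) (Polynomial.C (δ+β) - Polynomial.X)
      (Polynomial.C 0) Polynomial.X x
    simp only [Polynomial.eval_sub, Polynomial.eval_C, Polynomial.eval_X] at hQ
    have := poly_periodic Q (fun z => by
      rw [← hQ, ← hQ]
      have e1 := (hs (γ+α) (δ+β-(z+1))).2
      rw [show δ+β-(z+1)+1 = δ+β-z by ring] at e1
      rw [e1, (hs 0 z).2]
      congr 1; ring) β
    rw [← hQ, ← hQ] at this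
    simpa using this
  rw [hA, hB]

open PowerSeries in
lemma conv_sum (x α₁ β₁ α₂ β₂ : ℂ) (N : ℕ) :
    ∑ k ∈ Finset.range (N + 1), jacobiP (N - k) α₁ β₁ x * jacobiP k α₂ β₂ x =
      coeff N (jacE x (α₂+α₁) (β₂+β₁) * jacE x 0 0) := by
  rw [← conv_indep, coeff_mul, Finset.Nat.sum_antidiagonal_eq_sum_range_succ
    (fun i j => coeff i (jacE x α₂ β₂) * coeff j (jacE x α₁ β₁))]
  exact Finset.sum_congr rfl fun k _ => by simp [jacE, mul_comm]

theorem stmt16 (m : ℕ) (hm : 1 ≤ m) (α₁ β₁ α₂ β₂ x : ℂ) :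
    (α₁ + α₂ = -(2 * (m : ℂ)) → β₁ + β₂ = -(2 * (m : ℂ)) →
      ∑ k ∈ Finset.range (2 * m + 1),
          jacobiP (2 * m - k) α₁ β₁ x * jacobiP k α₂ β₂ x
        = 2 * ((x ^ 2 - 1) / 4) ^ m) ∧
    (α₁ + α₂ = -(2 * (m : ℂ) - 1) → β₁ + β₂ = -(2 * (m : ℂ) - 1) →
      ∑ k ∈ Finset.range (2 * m),
          jacobiP (2 * m - 1 - k) α₁ β₁ x * jacobiP k α₂ β₂ x
        = x * ((x ^ 2 - 1) / 4) ^ (m - 1)) := by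
  constructor
  · intro ha hb
    obtain ⟨E, u, v, h1, h2, h3, h4, h5, h6⟩ := base_coeff x (2*m) (by omega)
    rw [conv_sum, add_comm α₂, add_comm β₂, ha, hb]
    push_cast at h6
    rw [h6]
    exact (coeff_main_s16 x _ E u v h1 h2 h3 h4 h5 m).1
  · intro ha hb
    obtain ⟨n, rfl⟩ : ∃ n, m = n + 1 := ⟨m - 1, by omega⟩
    obtain ⟨E, u, v, h1, h2, h3, h4, h5, h6⟩ := base_coeff x (2*n+1) (by omega)
    have e : 2 * (n+1) - 1 = 2*n+1 := by omega
    have e' : 2 * (n+1) = (2*n+1) + 1 := by omega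
    have e2 : -(2 * ((n+1:ℕ):ℂ) - 1) = -((2*n+1:ℕ):ℂ) := by push_cast; ring
    rw [e, e', conv_sum, add_comm α₂, add_comm β₂, ha, hb, e2, h6]
    exact (coeff_main_s16 x _ E u v h1 h2 h3 h4 h5 n).2
end

section
/- For every natural number n, all complex α, β and all complex x, y, one has P_n^{(α,β)}(x) = Σ_{k=0}^{n} ((n+α+β+1)_k / k!) · P_{n-k}^{(α+k, β+k)}(y) · ((x-y)/2)^k. -/
theorem asc_split (c : ℂ) (k j : ℕ) :
    (ascPochhammer ℂ (k + j)).eval c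
      = (ascPochhammer ℂ k).eval c * (ascPochhammer ℂ j).eval (c + k) := by
  rw [← ascPochhammer_mul]
  simp

theorem stmt17 (n : ℕ) (α β x y : ℂ) :
    jacobiP n α β x
      = ∑ k ∈ Finset.range (n + 1),
          (ascPochhammer ℂ k).eval ((n : ℂ) + α + β + 1) / (k.factorial : ℂ) *
            jacobiP (n - k) (α + (k : ℂ)) (β + (k : ℂ)) y * ((x - y) / 2) ^ k := by
  unfold jacobiP
  have hL : ∀ m : ℕ, ((x - 1) / 2) ^ m = ∑ k ∈ Finset.range (m + 1),
      ((x - y) / 2) ^ k * ((y - 1) / 2) ^ (m - k) * (m.choose k : ℂ) := by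
    intro m
    rw [← add_pow]
    congr 1
    ring
  simp_rw [hL, Finset.mul_sum, Finset.sum_mul]
  rw [Finset.sum_sigma', Finset.sum_sigma']
  refine Finset.sum_bij' (fun p _ => ⟨p.2, p.1 - p.2⟩) (fun p _ => ⟨p.1 + p.2, p.1⟩)
    ?_ ?_ ?_ ?_ ?_
  · rintro ⟨m, k⟩ h
    simp only [Finset.mem_sigma, Finset.mem_range] at h ⊢
    omega
  · rintro ⟨k, j⟩ h
    simp only [Finset.mem_sigma, Finset.mem_range] at h ⊢
    omega
  · rintro ⟨m, k⟩ h
    simp only [Finset.mem_sigma, Finset.mem_range] at h ⊢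
    have : k + (m - k) = m := by omega
    simp [this]
  · rintro ⟨k, j⟩ h
    simp
  · rintro ⟨m, k⟩ h
    simp only [Finset.mem_sigma, Finset.mem_range] at h ⊢
    obtain ⟨j, rfl⟩ : ∃ j, m = k + j := ⟨m - k, by omega⟩
    obtain ⟨l, rfl⟩ : ∃ l, n = k + j + l := ⟨n - (k + j), by omega⟩
    have e1 : k + j + l - (k + j) = l := by omega
    have e2 : k + j - k = j := by omega
    have e3 : k + j + l - k = j + l := by omega
    have e4 : j + l - j = l := by omega
    rw [e1, e2, e3, e4, asc_split, Nat.cast_add_choose]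
    have a1 : ((j + l : ℕ) : ℂ) + (α + k) + (β + k) + 1
        = ((k + j + l : ℕ) : ℂ) + α + β + 1 + k := by push_cast; ring
    have a2 : α + (k : ℂ) + (j : ℂ) + 1 = α + ((k + j : ℕ) : ℂ) + 1 := by push_cast; ring
    rw [a1, a2]
    have f1 : ((k + j).factorial : ℂ) ≠ 0 := by exact_mod_cast (k + j).factorial_ne_zero
    have f2 : (k.factorial : ℂ) ≠ 0 := by exact_mod_cast k.factorial_ne_zero
    have f3 : (j.factorial : ℂ) ≠ 0 := by exact_mod_cast j.factorial_ne_zero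
    have f4 : (l.factorial : ℂ) ≠ 0 := by exact_mod_cast l.factorial_ne_zero
    generalize ((k + j).factorial : ℂ) = F at *
    field_simp
end

section
/- Let n be a natural number and let α, β be complex numbers such that α + β + j ≠ 0 for every integer j with 1 ≤ j ≤ 2n + 1. Then for all complex x, y, one has ((x-y)/2)^n = Σ_{k=0}^{n} ((α+β+2k+1)/(α+β+k+1)) · (n! / (α+β+k+2)_n) · P_{n-k}^{(-α-n-1, -β-n-1)}(y) · P_k^{(α,β)}(x). -/
lemma jac_choose (l m : ℕ) :
    (l + m).choose l * l.factorial * m.factorial = (l + m).factorial := by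
  have := Nat.choose_mul_factorial_mul_factorial (Nat.le_add_right l m)
  rwa [Nat.add_sub_cancel_left] at this

/-- Local shorthand for the evaluated Pochhammer symbol. -/
noncomputable def poch_s18 (m : ℕ) (a : ℂ) : ℂ := (ascPochhammer ℂ m).eval a

lemma poch_zero (a : ℂ) : poch_s18 0 a = 1 := by simp [poch_s18]

lemma poch_succ_right (m : ℕ) (a : ℂ) : poch_s18 (m + 1) a = poch_s18 m a * (a + m) := by
  simp [poch_s18, ascPochhammer_succ_eval]

lemma poch_add (m k : ℕ) (a : ℂ) : poch_s18 (m + k) a = poch_s18 m a * poch_s18 k (a + m) := by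
  induction k with
  | zero => simp [poch_zero]
  | succ k ih =>
    rw [← add_assoc, poch_succ_right, ih, poch_succ_right]; push_cast; ring

lemma poch_succ_left (m : ℕ) (a : ℂ) : poch_s18 (m + 1) a = a * poch_s18 m (a + 1) := by
  rw [add_comm m 1, poch_add, poch_succ_right, poch_zero]; push_cast; ring

lemma poch_neg (m : ℕ) (a : ℂ) : poch_s18 m (-a) = (-1) ^ m * poch_s18 m (a - m + 1) := by
  induction m generalizing a with
  | zero => simp [poch_zero]
  | succ m ih =>
    rw [poch_succ_left, show -a + 1 = -(a - 1) by ring, ih, poch_succ_right]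
    push_cast
    rw [show a - 1 - (m : ℂ) + 1 = a - (m + 1) + 1 by ring]
    ring

lemma poch_ne_zero (m : ℕ) (a : ℂ) (h : ∀ t < m, a + (t : ℂ) ≠ 0) : poch_s18 m a ≠ 0 := by
  induction m with
  | zero => simp [poch_zero]
  | succ m ih =>
    rw [poch_succ_right]
    exact mul_ne_zero (ih fun t ht => h t (by omega)) (h m (by omega))

lemma tele (M L : ℕ) (c : ℂ) (h : ∀ t ≤ L + M + 1, c + (t : ℂ) ≠ 0) :
    ∑ l ∈ Finset.range (L + 1), (-1 : ℂ) ^ l * ((M + 1).choose l) * (c + 2 * l) /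
      poch_s18 (M + 2) (c + l) = (-1) ^ L * (M.choose L) / poch_s18 (M + 1) (c + L + 1) := by
  induction L with
  | zero =>
    have h0 := h 0 (by omega)
    have h1 : poch_s18 (M + 1) (c + 1) ≠ 0 := poch_ne_zero _ _ fun t ht => by
      have := h (t + 1) (by omega)
      push_cast at this
      rwa [show c + 1 + (t : ℂ) = c + (t + 1) by ring]
    simp only [Nat.cast_zero, add_zero] at h0
    simp [poch_succ_left (M + 1)]
    field_simp
  | succ L ih =>
    rw [Finset.sum_range_succ, ih fun t ht => h t (by omega)]
    have h1 : poch_s18 M (c + L + 2) ≠ 0 := poch_ne_zero _ _ fun t ht => by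
      have := h (t + L + 2) (by omega)
      push_cast at this
      rwa [show c + L + 2 + (t : ℂ) = c + (t + L + 2) by ring]
    have h2 := h (L + 1) (by omega)
    have h3 := h (L + 1 + M + 1) (by omega)
    have e1 : poch_s18 (M + 1) (c + L + 1) = (c + (L + 1 : ℕ)) * poch_s18 M (c + L + 2) := by
      rw [poch_succ_left]; push_cast; ring_nf
    have e2 : poch_s18 (M + 1) (c + (L + 1 : ℕ) + 1) = poch_s18 M (c + L + 2) * (c + (L + 1 + M + 1 : ℕ)) := by
      rw [poch_succ_right]; push_cast; ring_nf
    have e3 : poch_s18 (M + 2) (c + (L + 1 : ℕ)) =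
        (c + (L + 1 : ℕ)) * (poch_s18 M (c + L + 2) * (c + (L + 1 + M + 1 : ℕ))) := by
      rw [poch_succ_left, ← e2]
    rw [e1, e2, e3]
    have hc : ((M + 1).choose (L + 1) : ℂ) = M.choose L + M.choose (L + 1) := by
      rw [Nat.choose_succ_succ]; push_cast; rfl
    have hd : ((M : ℂ) + 1) * M.choose L = (M + 1).choose (L + 1) * (L + 1) := by
      exact_mod_cast Nat.add_one_mul_choose_eq M L
    rw [hc] at hd ⊢
    field_simp
    push_cast
    rw [pow_succ]
    linear_combination (-1 : ℂ) ^ L * hd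

lemma jac_inner_sum (N : ℕ) (c : ℂ) (h : ∀ t ≤ 2 * N, c + (t : ℂ) ≠ 0) :
    ∑ l ∈ Finset.range (N + 1), (-1 : ℂ) ^ l * (N.choose l) * (c + 2 * l) /
      poch_s18 (N + 1) (c + l) = if N = 0 then 1 else 0 := by
  cases N with
  | zero =>
    have := h 0 (by omega)
    simp at this
    simp [poch_succ_right, poch_zero, this]
  | succ M =>
    rw [tele M (M + 1) c fun t ht => h t (by omega)]
    simp

/-- The summand. -/
noncomputable def term (n : ℕ) (α β X Y : ℂ) (k i j : ℕ) : ℂ :=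
  (α + β + 2 * (k : ℂ) + 1) / (α + β + (k : ℂ) + 1) *
    ((n.factorial : ℂ) / poch_s18 n (α + β + (k : ℂ) + 2)) *
    (poch_s18 j (((n - k : ℕ) : ℂ) + (-α - (n : ℂ) - 1) + (-β - (n : ℂ) - 1) + 1) *
        poch_s18 (n - k - j) ((-α - (n : ℂ) - 1) + (j : ℂ) + 1) /
      ((j.factorial : ℂ) * ((n - k - j).factorial : ℂ)) * Y ^ j) *
    (poch_s18 i ((k : ℂ) + α + β + 1) * poch_s18 (k - i) (α + (i : ℂ) + 1) /
      ((i.factorial : ℂ) * ((k - i).factorial : ℂ)) * X ^ i)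

lemma term_eq (α β X Y : ℂ) (i l j m : ℕ)
    (h : ∀ t : ℕ, 1 ≤ t → t ≤ 2 * (i + l + j + m) + 1 → α + β + (t : ℂ) ≠ 0) :
    term (i + l + j + m) α β X Y (i + l) i j =
      (i + l + j + m).factorial / (i.factorial * j.factorial) * (-1) ^ (j + (l + m)) *
      poch_s18 (l + m) (α + i + 1) / (l + m).factorial * X ^ i * Y ^ j *
      ((-1 : ℂ) ^ l * ((l + m).choose l) * ((α + β + 2 * i + 1) + 2 * l) /
        poch_s18 (l + m + 1) ((α + β + 2 * i + 1) + l)) := by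
  unfold term
  rw [show i + l + j + m - (i + l) = j + m by omega, show j + m - j = m by omega,
    show i + l - i = l by omega]
  have a1 : poch_s18 j (((j + m : ℕ) : ℂ) + (-α - ((i + l + j + m : ℕ) : ℂ) - 1)
      + (-β - ((i + l + j + m : ℕ) : ℂ) - 1) + 1)
      = (-1) ^ j * poch_s18 j (α + β + (i + l : ℕ) + 2 + (i + l + m : ℕ)) := by
    rw [show ((j + m : ℕ) : ℂ) + (-α - ((i + l + j + m : ℕ) : ℂ) - 1)
      + (-β - ((i + l + j + m : ℕ) : ℂ) - 1) + 1
      = -(α + β + 2 * i + 2 * l + j + m + 1) by push_cast; ring, poch_neg]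
    congr 2; push_cast; ring
  have a2 : poch_s18 m ((-α - ((i + l + j + m : ℕ) : ℂ) - 1) + (j : ℂ) + 1)
      = (-1) ^ m * poch_s18 m (α + i + 1 + l) := by
    rw [show (-α - ((i + l + j + m : ℕ) : ℂ) - 1) + (j : ℂ) + 1
      = -(α + i + l + m) by push_cast; ring, poch_neg]
    congr 2; ring
  have a3 : poch_s18 (i + l + j + m) (α + β + (i + l : ℕ) + 2) =
      poch_s18 (i + l + m) (α + β + (i + l : ℕ) + 2) *
        poch_s18 j (α + β + (i + l : ℕ) + 2 + (i + l + m : ℕ)) := by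
    rw [← poch_add]; congr 1; ring
  have a4 : (α + β + (i + l : ℕ) + 1) * poch_s18 (i + l + m) (α + β + (i + l : ℕ) + 2) =
      poch_s18 i ((i + l : ℕ) + α + β + 1) * poch_s18 (l + m + 1) ((α + β + 2 * i + 1) + l) := by
    rw [show α + β + ((i + l : ℕ) : ℂ) + 2 = α + β + ((i + l : ℕ) : ℂ) + 1 + 1 by ring,
      ← poch_succ_left, show i + l + m + 1 = i + (l + m + 1) by ring, poch_add]
    congr 2 <;> push_cast <;> ring
  have a5 : poch_s18 (l + m) (α + i + 1) = poch_s18 l (α + i + 1) * poch_s18 m (α + i + 1 + l) := poch_add _ _ _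
  have n0 : α + β + ((i + l : ℕ) : ℂ) + 1 ≠ 0 := by
    have := h (i + l + 1) (by omega) (by omega)
    rw [Nat.cast_succ, ← add_assoc] at this; exact this
  have n1 : poch_s18 (i + l + m) (α + β + (i + l : ℕ) + 2) ≠ 0 := poch_ne_zero _ _ fun t ht => by
    have := h (i + l + 2 + t) (by omega) (by omega)
    convert this using 1; push_cast; ring
  have n2 : poch_s18 j (α + β + (i + l : ℕ) + 2 + (i + l + m : ℕ)) ≠ 0 :=
    poch_ne_zero _ _ fun t ht => by
      have := h (i + l + 2 + (i + l + m) + t) (by omega) (by omega)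
      convert this using 1; push_cast; ring
  have n3 := mul_ne_zero n0 n1
  rw [a4] at n3
  have n4 := left_ne_zero_of_mul n3
  have n5 := right_ne_zero_of_mul n3
  have f : ((l + m).choose l : ℂ) * l.factorial * m.factorial = (l + m).factorial := by
    exact_mod_cast jac_choose l m
  have fl : (l.factorial : ℂ) ≠ 0 := by exact_mod_cast l.factorial_ne_zero
  have fm : (m.factorial : ℂ) ≠ 0 := by exact_mod_cast m.factorial_ne_zero
  have fi : (i.factorial : ℂ) ≠ 0 := by exact_mod_cast i.factorial_ne_zero
  have fj : (j.factorial : ℂ) ≠ 0 := by exact_mod_cast j.factorial_ne_zero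
  have fc : ((l + m).choose l : ℂ) ≠ 0 := by
    exact_mod_cast (Nat.choose_pos (by omega)).ne'
  rw [a1, a2, a3, a5, ← f]
  have hs : (-1 : ℂ) ^ (j + (l + m)) * (-1) ^ l = (-1) ^ j * (-1) ^ m := by
    rw [pow_add, pow_add]
    have : (-1 : ℂ) ^ l * (-1) ^ l = 1 := by rw [← mul_pow]; simp
    linear_combination (-1 : ℂ) ^ j * (-1) ^ m * this
  have hk : α + β + 2 * ((i + l : ℕ) : ℂ) + 1 = (α + β + 2 * i + 1) + 2 * l := by
    push_cast; ring
  rw [hk]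
  generalize (α + β + 2 * (i : ℂ) + 1) + 2 * l = W at *
  generalize poch_s18 (i + l + m) (α + β + (i + l : ℕ) + 2) = A at *
  generalize poch_s18 j (α + β + (i + l : ℕ) + 2 + (i + l + m : ℕ)) = B at *
  generalize poch_s18 i ((i + l : ℕ) + α + β + 1) = C at *
  generalize poch_s18 (l + m + 1) ((α + β + 2 * i + 1) + l) = D at *
  generalize poch_s18 m (α + i + 1 + l) = E at *
  generalize poch_s18 l (α + i + 1) = F at *
  generalize α + β + ((i + l : ℕ) : ℂ) + 1 = G at *
  generalize ((i + l + j + m).factorial : ℂ) = H at *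
  generalize ((l + m).choose l : ℂ) = K at *
  generalize (l.factorial : ℂ) = fl' at *
  generalize (m.factorial : ℂ) = fm' at *
  generalize (i.factorial : ℂ) = fi' at *
  generalize (j.factorial : ℂ) = fj' at *
  generalize (-1 : ℂ) ^ (j + (l + m)) = s1 at *
  generalize (-1 : ℂ) ^ l = s2 at *
  generalize (-1 : ℂ) ^ j = s3 at *
  generalize (-1 : ℂ) ^ m = s4 at *
  have hL : W / G * (H / (A * B)) * (s3 * B * (s4 * E) / (fj' * fm') * Y ^ j) *
      (C * F / (fi' * fl') * X ^ i) =
      (s3 * s4) * W * H * E * F * Y ^ j * X ^ i / (fj' * fm' * fi' * fl') * (C / (G * A)) := by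
    field_simp
  rw [hL, a4, ← hs]
  field_simp

theorem stmt18 (n : ℕ) (α β : ℂ)
    (h : ∀ j : ℤ, 1 ≤ j → j ≤ 2 * (n : ℤ) + 1 → α + β + (j : ℂ) ≠ 0) (x y : ℂ) :
    ((x - y) / 2) ^ n
      = ∑ k ∈ Finset.range (n + 1),
          (α + β + 2 * (k : ℂ) + 1) / (α + β + (k : ℂ) + 1) *
            ((n.factorial : ℂ) / (ascPochhammer ℂ n).eval (α + β + (k : ℂ) + 2)) *
            jacobiP (n - k) (-α - (n : ℂ) - 1) (-β - (n : ℂ) - 1) y *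
            jacobiP k α β x := by
  have h' : ∀ t : ℕ, 1 ≤ t → t ≤ 2 * n + 1 → α + β + (t : ℂ) ≠ 0 := fun t h1 h2 => by
    have := h t (by omega) (by omega)
    exact_mod_cast this
  set X := (x - 1) / 2 with hX
  set Y := (y - 1) / 2 with hY
  have hxy : (x - y) / 2 = X + -Y := by rw [hX, hY]; ring
  have step1 : ∀ k ∈ Finset.range (n + 1),
      (α + β + 2 * (k : ℂ) + 1) / (α + β + (k : ℂ) + 1) *
            ((n.factorial : ℂ) / (ascPochhammer ℂ n).eval (α + β + (k : ℂ) + 2)) *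
            jacobiP (n - k) (-α - (n : ℂ) - 1) (-β - (n : ℂ) - 1) y *
            jacobiP k α β x =
      ∑ i ∈ Finset.range (k + 1), ∑ j ∈ Finset.range (n - k + 1), term n α β X Y k i j := by
    intro k _
    unfold jacobiP term
    rw [Finset.mul_sum]
    refine Finset.sum_congr rfl fun i _ => ?_
    rw [Finset.mul_sum, Finset.sum_mul]
    rfl
  rw [Finset.sum_congr rfl step1]
  have step2 : ∑ k ∈ Finset.range (n + 1), ∑ i ∈ Finset.range (k + 1),
      ∑ j ∈ Finset.range (n - k + 1), term n α β X Y k i j =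
      ∑ i ∈ Finset.range (n + 1), ∑ j ∈ Finset.range (n - i + 1),
        ∑ l ∈ Finset.range (n - i - j + 1), term n α β X Y (i + l) i j := by
    simp only [Finset.sum_sigma']
    refine Finset.sum_bij' (fun p _ => ⟨p.2.1, p.2.2, p.1 - p.2.1⟩)
      (fun p _ => ⟨p.1 + p.2.2, p.1, p.2.1⟩) ?_ ?_ ?_ ?_ ?_
    · rintro ⟨k, i, j⟩ hp
      simp only [Finset.mem_sigma, Finset.mem_range] at hp ⊢
      omega
    · rintro ⟨k, i, j⟩ hp
      simp only [Finset.mem_sigma, Finset.mem_range] at hp ⊢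
      omega
    · rintro ⟨k, i, j⟩ hp
      simp only [Finset.mem_sigma, Finset.mem_range] at hp ⊢
      rw [show i + (k - i) = k by omega]
    · rintro ⟨k, i, j⟩ hp
      simp only [Finset.mem_sigma, Finset.mem_range] at hp ⊢
      rw [show k + j - k = j by omega]
    · rintro ⟨k, i, j⟩ hp
      simp only [Finset.mem_sigma, Finset.mem_range] at hp ⊢
      rw [show i + (k - i) = k by omega]
  rw [step2, hxy, add_pow]
  refine Finset.sum_congr rfl fun i hi => ?_
  have hi : i ≤ n := by simpa [Nat.lt_succ_iff] using hi
  have step3 : ∀ j ∈ Finset.range (n - i + 1),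
      ∑ l ∈ Finset.range (n - i - j + 1), term n α β X Y (i + l) i j =
      if j = n - i then X ^ i * (-Y) ^ (n - i) * (n.choose i : ℂ) else 0 := by
    intro j hj
    have hj : j ≤ n - i := by simpa [Nat.lt_succ_iff] using hj
    obtain ⟨N, rfl⟩ : ∃ N, n = i + j + N := ⟨n - i - j, by omega⟩
    rw [show i + j + N - i - j = N by omega]
    have key : ∀ l ∈ Finset.range (N + 1), term (i + j + N) α β X Y (i + l) i j =
        (i + j + N).factorial / (i.factorial * j.factorial) * (-1) ^ (j + N) *
        poch_s18 N (α + i + 1) / N.factorial * X ^ i * Y ^ j *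
        ((-1 : ℂ) ^ l * (N.choose l) * ((α + β + 2 * i + 1) + 2 * l) /
        poch_s18 (N + 1) ((α + β + 2 * i + 1) + l)) := by
      intro l hl
      obtain ⟨m, rfl⟩ : ∃ m, N = l + m := ⟨N - l, by
        have := Finset.mem_range.1 hl; omega⟩
      have e : i + j + (l + m) = i + l + j + m := by ring
      rw [e] at h' ⊢
      exact term_eq α β X Y i l j m h'
    rw [Finset.sum_congr rfl key, ← Finset.mul_sum, jac_inner_sum N _ fun t ht => by
      have := h' (2 * i + 1 + t) (by omega) (by omega)
      convert this using 1; push_cast; ring]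
    by_cases hN : N = 0
    · subst hN
      have fi : (i.factorial : ℂ) ≠ 0 := by exact_mod_cast i.factorial_ne_zero
      have fj : (j.factorial : ℂ) ≠ 0 := by exact_mod_cast j.factorial_ne_zero
      have f : ((i + j).choose i : ℂ) * i.factorial * j.factorial = (i + j).factorial := by
        exact_mod_cast jac_choose i j
      simp only [add_zero, poch_zero, Nat.add_sub_cancel_left, if_true, Nat.factorial_zero,
        Nat.cast_one]
      rw [← f, neg_pow Y]
      field_simp
    · rw [if_neg hN, if_neg (by omega), mul_zero]
  rw [Finset.sum_congr rfl step3, Finset.sum_ite_eq' , if_pos (by simp)]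
end
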